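/- Fix δ > 0 and let Q₀ be the unit cube in ℝⁿ. For a harmonic function u defined on a sufficiently large neighborhood of Q₀ and a > 0, define m(u,a) = H^{n-2+δ}_∞( { x ∈ Q₀ : |∇u(x)| < e^{-a} · sup_{Q₀} |∇u| } ), and for N > 0 define M(N,a) as the supremum of m(u,a) over all such harmonic functions u with maximal doubling index N(Q₀) ≤ N. Then there exist constants c > 0, C₁ > 0 and an integer A ≥ 3 (depending only on n and δ, with 2A+1 a power of 3) such that for all N > N₀(n) and all a > C₁·N·log A: M(N, a) ≤ A^{2-δ} · M( N/(1+c), a − C₁·N·log A ) + A^{-δ} · M( N, a − C₁·N·log A ). -/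

import Mathlib

open MeasureTheory Metric Set ENNReal Matrix RealInnerProductSpace

/-- `sup` of `|∇u|` over a set. -/
noncomputable def supGrad {n : ℕ} (u : EuclideanSpace ℝ (Fin n) → ℝ)
    (s : Set (EuclideanSpace ℝ (Fin n))) : ℝ :=
  sSup ((fun x => ‖fderiv ℝ u x‖) '' s)

/-- `u` is harmonic on `U`: smooth on `U` and its Laplacian vanishes on `U`. -/
def IsHarmonicOn {n : ℕ} (u : EuclideanSpace ℝ (Fin n) → ℝ)
    (U : Set (EuclideanSpace ℝ (Fin n))) : Prop :=
  ContDiffOn ℝ (⊤ : ℕ∞) u U ∧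
    ∀ x ∈ U, ∑ i : Fin n,
      fderiv ℝ (fun y => fderiv ℝ u y (EuclideanSpace.single i 1)) x (EuclideanSpace.single i 1) = 0

/-- normalized doubling index of the gradient on `B(x,r)`:
`N(x,r) = log ( sup_{B(x,2r)} |∇u| / sup_{B(x,r)} |∇u| )`. -/
noncomputable def doublingIndex {n : ℕ} (u : EuclideanSpace ℝ (Fin n) → ℝ)
    (x : EuclideanSpace ℝ (Fin n)) (r : ℝ) : ℝ :=
  Real.log (supGrad u (ball x (2 * r)) / supGrad u (ball x r))

/-- the closed axis-parallel cube with center `c` and side length `ℓ` -/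
def cube {n : ℕ} (c : EuclideanSpace ℝ (Fin n)) (ℓ : ℝ) : Set (EuclideanSpace ℝ (Fin n)) :=
  {x | ∀ i, |x i - c i| ≤ ℓ / 2}

/-- maximal normalized doubling index of the cube of center `c` and side `ℓ`:
`N(Q) = sup_{x ∈ Q, 0 < r ≤ ℓ(Q)} log ( sup_{B(x,10nr)} |∇u| / sup_{B(x,r)} |∇u| )`. -/
noncomputable def cubeDoublingIndex {n : ℕ} (u : EuclideanSpace ℝ (Fin n) → ℝ)
    (c : EuclideanSpace ℝ (Fin n)) (ℓ : ℝ) : ℝ :=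
  sSup {t | ∃ x ∈ cube c ℓ, ∃ r : ℝ, 0 < r ∧ r ≤ ℓ ∧
    t = Real.log (supGrad u (ball x (10 * n * r)) / supGrad u (ball x r))}

/-- `s`-dimensional Hausdorff content -/
noncomputable def hausdorffContent {n : ℕ} (s : ℝ) (E : Set (EuclideanSpace ℝ (Fin n))) : ℝ≥0∞ :=
  ⨅ (U : ℕ → Set (EuclideanSpace ℝ (Fin n))) (_ : E ⊆ ⋃ i, U i), ∑' i, EMetric.diam (U i) ^ s

/-- Riesz `s`-energy of a measure: `I_s(μ) = ∬ |x-y|^{-s} dμ(x) dμ(y)`. -/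
noncomputable def rieszEnergy {n : ℕ} (s : ℝ) (μ : Measure (EuclideanSpace ℝ (Fin n))) : ℝ≥0∞ :=
  ∫⁻ x, ∫⁻ y, edist x y ^ (-s) ∂μ ∂μ

/-- Riesz `s`-capacity of a set: the sup of `I_s(μ)⁻¹` over probability measures compactly
supported in `E`. -/
noncomputable def rieszCapacity {n : ℕ} (s : ℝ) (E : Set (EuclideanSpace ℝ (Fin n))) : ℝ≥0∞ :=
  ⨆ (μ : Measure (EuclideanSpace ℝ (Fin n)))
    (_ : μ E = 1 ∧ ∃ K, IsCompact K ∧ K ⊆ E ∧ μ Kᶜ = 0), (rieszEnergy s μ)⁻¹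

/-- a function `Fin n → ℝ` regarded as a point of `EuclideanSpace ℝ (Fin n)` -/
noncomputable def vec {n : ℕ} (f : Fin n → ℝ) : EuclideanSpace ℝ (Fin n) :=
  (EuclideanSpace.equiv (Fin n) ℝ).symm f

/-- center of the subcube indexed by `k` when the cube of center `c` and side `ℓ` is divided
into `M^n` congruent subcubes -/
noncomputable def subCenter {n : ℕ} (c : EuclideanSpace ℝ (Fin n)) (ℓ : ℝ) (M : ℕ)
    (k : Fin n → Fin M) : EuclideanSpace ℝ (Fin n) :=
  vec (fun i => c i + (((k i : ℝ) + 1 / 2) / M - 1 / 2) * ℓ)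

/-- the last coordinate index of `Fin n` -/
def lastIdx (n : ℕ) (hn : 0 < n) : Fin n := ⟨n - 1, Nat.sub_lt hn Nat.one_pos⟩

/-- the hyperplane `{xₙ = 0}` -/
def lastHyperplane (n : ℕ) (hn : 0 < n) : Set (EuclideanSpace ℝ (Fin n)) :=
  {x | x (lastIdx n hn) = 0}

/-- `m(u,a)`: the `(n-2+δ)`-Hausdorff content of the sublevel set
`{x ∈ Q₀ : |∇u(x)| < e^{-a} sup_{Q₀}|∇u|}` of the unit cube `Q₀`. -/
noncomputable def sublevelContent (n : ℕ) (δ : ℝ) (u : EuclideanSpace ℝ (Fin n) → ℝ)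
    (a : ℝ) : ℝ≥0∞ :=
  hausdorffContent ((n : ℝ) - 2 + δ) {x ∈ cube (0 : EuclideanSpace ℝ (Fin n)) 1 |
    ‖fderiv ℝ u x‖ < Real.exp (-a) * supGrad u (cube 0 1)}

/-- `M(N,a)`: the supremum of `m(u,a)` over all harmonic functions (on a large neighborhood
of the unit cube) whose maximal doubling index on the unit cube is at most `N`. -/
noncomputable def Mquantity (n : ℕ) (δ N a : ℝ) : ℝ≥0∞ :=
  ⨆ (u : EuclideanSpace ℝ (Fin n) → ℝ)
    (_ : IsHarmonicOn u (ball 0 (100 * n)) ∧ cubeDoublingIndex u 0 1 ≤ N),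
    sublevelContent n δ u a


abbrev EE (n : ℕ) := EuclideanSpace ℝ (Fin n)

noncomputable def pw {n : ℕ} (k : ℕ) (y : EE n) : ℝ := (max (1 - ‖y‖ ^ 2) 0) ^ k

theorem hasDerivAt_maxpow (k : ℕ) (s : ℝ) :
    HasDerivAt (fun s : ℝ => (max s 0) ^ (k + 2)) ((k + 2 : ℝ) * (max s 0) ^ (k + 1)) s := by
  rcases lt_trichotomy s 0 with h | h | h
  · have : (fun s : ℝ => (max s 0) ^ (k + 2)) =ᶠ[nhds s] fun _ => 0 := by
      filter_upwards [Iio_mem_nhds h] with x hx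
      have hx' : x ≤ 0 := le_of_lt (mem_Iio.1 hx)
      simp [max_eq_right hx']
    rw [max_eq_right h.le]
    simpa using (hasDerivAt_const s (0 : ℝ)).congr_of_eventuallyEq this
  · subst h
    have h2 : HasDerivAt (fun s : ℝ => (max s 0) ^ (k + 2)) 0 0 := by
      rw [hasDerivAt_iff_isLittleO_nhds_zero]
      simp only [zero_add, max_self, smul_zero, sub_zero]
      have : (fun h : ℝ => (max h 0) ^ (k + 2) - (0 : ℝ) ^ (k + 2)) =O[nhds 0] fun h : ℝ => h ^ (k+2) := by
        apply Asymptotics.IsBigO.of_bound 1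
        filter_upwards with x
        simp only [ne_eq, Nat.add_eq_zero_iff, OfNat.ofNat_ne_zero, and_false, not_false_eq_true, zero_pow, sub_zero, norm_pow, one_mul]
        gcongr
        rw [Real.norm_eq_abs, Real.norm_eq_abs, abs_of_nonneg (le_max_right _ _)]
        exact max_le (le_abs_self _) (abs_nonneg _)
      exact this.trans_isLittleO (by
        have := Asymptotics.isLittleO_pow_id (𝕜 := ℝ) (n := k + 2) (by omega)
        exact this)
    simpa using h2
  · have : (fun s : ℝ => (max s 0) ^ (k + 2)) =ᶠ[nhds s] fun s => s ^ (k+2) := by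
      filter_upwards [Ioi_mem_nhds h] with x hx
      rw [max_eq_left (le_of_lt hx)]
    rw [max_eq_left h.le]
    have h3 := (hasDerivAt_pow (k+2) s).congr_of_eventuallyEq this
    simpa using h3

section
variable {n : ℕ}

theorem hasFDerivAt_pw (k : ℕ) (y : EE n) :
    HasFDerivAt (pw (n := n) (k + 2)) ((-(2 * (k + 2 : ℝ)) * pw (k + 1) y) • innerSL ℝ y) y := by
  have h1 : HasFDerivAt (fun y : EE n => 1 - ‖y‖ ^ 2) (-(2 • innerSL ℝ y)) y :=
    ((hasStrictFDerivAt_norm_sq y).hasFDerivAt).const_sub 1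
  have h2 := (hasDerivAt_maxpow k (1 - ‖y‖ ^ 2)).comp_hasFDerivAt y h1
  refine h2.congr_fderiv ?_
  ext v
  simp [pw]
  ring

theorem fderiv_pw (k : ℕ) (y v : EE n) :
    fderiv ℝ (pw (n := n) (k + 2)) y v = -(2 * (k + 2 : ℝ)) * pw (k + 1) y * ⟪y, v⟫ := by
  rw [(hasFDerivAt_pw k y).fderiv]; simp

theorem continuous_pw (k : ℕ) : Continuous (pw (n := n) k) := by
  unfold pw; fun_prop

theorem pw_nonneg (k : ℕ) (y : EE n) : 0 ≤ pw k y := by unfold pw; positivity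

theorem pw_le_one (k : ℕ) (y : EE n) : pw k y ≤ 1 := by
  unfold pw
  apply pow_le_one₀ (le_max_right _ _)
  apply max_le _ zero_le_one
  nlinarith [norm_nonneg y]

theorem pw_zero {k : ℕ} (hk : k ≠ 0) {y : EE n} (h : 1 ≤ ‖y‖) : pw k y = 0 := by
  unfold pw
  rw [max_eq_right (by nlinarith), zero_pow hk]

theorem pw_le_pw {k l : ℕ} (h : k ≤ l) (y : EE n) : pw l y ≤ pw k y := by
  unfold pw
  apply pow_le_pow_of_le_one (le_max_right _ _) _ h
  apply max_le _ zero_le_one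
  nlinarith [norm_nonneg y]

theorem hcs_pw {k : ℕ} (hk : k ≠ 0) : HasCompactSupport (pw (n := n) k) := by
  apply HasCompactSupport.intro (isCompact_closedBall (0 : EE n) 1)
  intro x hx
  apply pw_zero hk
  simp at hx; exact hx.le

theorem integrable_pw_mul {k : ℕ} (hk : k ≠ 0) {g : EE n → ℝ} (hg : Continuous g) :
    Integrable (fun y => pw k y * g y) := by
  apply Continuous.integrable_of_hasCompactSupport
  · exact (continuous_pw k).mul hg
  · exact (hcs_pw hk).mul_right

theorem integrable_pw {k : ℕ} (hk : k ≠ 0) : Integrable (pw (n := n) k) := by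
  simpa using integrable_pw_mul (n := n) hk (g := fun _ => 1) continuous_const

theorem ibp_pw (k : ℕ) {g : EE n → ℝ} (hg : ContDiff ℝ 1 g) (v : EE n) :
    ∫ y, pw (k + 2) y * fderiv ℝ g y v = ∫ y, pw (k + 1) y * (2 * (k + 2 : ℝ) * ⟪y, v⟫ * g y) := by
  have hgc := hg.continuous
  have hg' : Continuous fun y => fderiv ℝ g y v :=
    (hg.continuous_fderiv (by norm_num)).clm_apply continuous_const
  rw [integral_mul_fderiv_eq_neg_fderiv_mul_of_integrable]
  · rw [← integral_neg]
    congr 1; ext y; rw [fderiv_pw]; ring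
  · have := (integrable_pw_mul (n := n) (k := k+1) (by omega) (g := fun y => -(2 * (k + 2 : ℝ)) * ⟪y, v⟫ * g y)
      (by fun_prop))
    refine this.congr (.of_forall fun y => ?_)
    simp only [fderiv_pw]; ring
  · exact integrable_pw_mul (by omega) hg'
  · exact integrable_pw_mul (by omega) hgc
  · exact fun x _ => (hasFDerivAt_pw k x).differentiableAt
  · exact fun x _ => (hg.differentiable (by norm_num)) x

abbrev Sm (f : EE n → ℝ) : Prop := ContDiff ℝ (⊤ : ℕ∞) f

noncomputable def pd (v : EE n) (f : EE n → ℝ) : EE n → ℝ := fun y => fderiv ℝ f y v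

noncomputable def lap (f : EE n → ℝ) (x : EE n) : ℝ :=
  ∑ i : Fin n, pd (EuclideanSpace.single i 1) (pd (EuclideanSpace.single i 1) f) x

theorem Sm.pd {f : EE n → ℝ} (hf : Sm f) (v : EE n) : Sm (pd v f) := by
  unfold _root_.pd
  exact (hf.fderiv_right (m := (⊤ : ℕ∞)) (by simp)).clm_apply contDiff_const

theorem Sm.diff {f : EE n → ℝ} (hf : Sm f) : Differentiable ℝ f := hf.differentiable (by simp)

theorem Sm.one {f : EE n → ℝ} (hf : Sm f) : ContDiff ℝ 1 f := hf.of_le (by exact_mod_cast le_top)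

theorem Sm.lap_cont {f : EE n → ℝ} (hf : Sm f) : Continuous (lap f) := by
  unfold lap
  exact continuous_finsetSum _ fun i _ => ((hf.pd _).pd _).continuous

theorem sum_single (y : EE n) : ∑ i, y i • (EuclideanSpace.single i (1:ℝ) : EE n) = y := by
  ext j
  simp [Finset.sum_apply, Pi.single_apply]

theorem sum_coord_fderiv (L : EE n →L[ℝ] ℝ) (y : EE n) :
    ∑ i, y i * L (EuclideanSpace.single i 1) = L y := by
  conv_rhs => rw [← sum_single y]
  simp [map_sum]

theorem green {v z : EE n → ℝ} (hv : Sm v) (hz : Sm z) :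
    ∫ y, pw 3 y * (z y * lap v y - v y * lap z y) =
      6 * ∫ y, pw 2 y * (z y * fderiv ℝ v y y - v y * fderiv ℝ z y y) := by
  set e : Fin n → EE n := fun i => EuclideanSpace.single i 1 with he
  set g : Fin n → EE n → ℝ := fun i y => z y * pd (e i) v y - v y * pd (e i) z y with hg
  have hgs : ∀ i, Sm (g i) := fun i => (hz.mul (hv.pd _)).sub (hv.mul (hz.pd _))
  have hgd : ∀ i y, fderiv ℝ (g i) y (e i) = z y * pd (e i) (pd (e i) v) y - v y * pd (e i) (pd (e i) z) y := by
    intro i y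
    have h1 := ((hz.diff y).hasFDerivAt.mul ((hv.pd (e i)).diff y).hasFDerivAt).sub
      ((hv.diff y).hasFDerivAt.mul ((hz.pd (e i)).diff y).hasFDerivAt)
    rw [show g i = (z * pd (e i) v - v * pd (e i) z) from rfl, h1.fderiv]
    simp [pd]; ring
  have h := fun i => ibp_pw (n := n) 1 (hgs i).one (e i)
  have hs : ∑ i, ∫ y, pw 3 y * fderiv ℝ (g i) y (e i) =
      ∑ i, ∫ y, pw 2 y * (6 * ⟪y, e i⟫ * g i y) := by
    refine Finset.sum_congr rfl fun i _ => ?_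
    have := h i
    norm_num at this
    exact this
  rw [← integral_finsetSum, ← integral_finsetSum] at hs
  · rw [← integral_const_mul]
    refine (integral_congr_ae (.of_forall fun y => ?_)).trans (hs.trans (integral_congr_ae (.of_forall fun y => ?_)))
    · simp only [hgd, lap, ← Finset.mul_sum, Finset.sum_sub_distrib]; rfl
    · dsimp only
      rw [← sum_coord_fderiv (fderiv ℝ v y) y, ← sum_coord_fderiv (fderiv ℝ z y) y]
      simp only [hg, he, pd, EuclideanSpace.inner_single_right]
      simp only [Finset.mul_sum, ← Finset.sum_sub_distrib]
      refine Finset.sum_congr rfl fun i _ => ?_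
      simp; ring
  · intro i _
    have := (hgs i).continuous
    exact integrable_pw_mul (by norm_num) (by fun_prop)
  · intro i _
    exact integrable_pw_mul (by norm_num) (((hgs i).pd (e i)).continuous)

/-- affine rescaling -/
def af (x : EE n) (s : ℝ) (f : EE n → ℝ) : EE n → ℝ := fun y => f (x + s • y)

theorem Sm.af {f : EE n → ℝ} (hf : Sm f) (x : EE n) (s : ℝ) : Sm (af x s f) :=
  hf.comp (contDiff_const.add (contDiff_id.const_smul s))

theorem af_hasFDerivAt {f : EE n → ℝ} (hf : Sm f) (x : EE n) (s : ℝ) (y : EE n) :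
    HasFDerivAt (af x s f) (s • fderiv ℝ f (x + s • y)) y := by
  have h1 : HasFDerivAt (fun y : EE n => x + s • y) (s • ContinuousLinearMap.id ℝ (EE n)) y :=
    ((hasFDerivAt_id y).const_smul s).const_add x
  have := (hf.diff (x + s • y)).hasFDerivAt.comp y h1
  refine this.congr_fderiv ?_
  ext v; simp

theorem pd_af {f : EE n → ℝ} (hf : Sm f) (x : EE n) (s : ℝ) (v : EE n) :
    pd v (af x s f) = fun y => s * af x s (pd v f) y := by
  ext y; simp [pd, (af_hasFDerivAt hf x s y).fderiv, af]

theorem pd_const_mul {f : EE n → ℝ} (hf : Sm f) (c : ℝ) (v : EE n) :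
    pd v (fun y => c * f y) = fun y => c * pd v f y := by
  ext y; simp [pd, fderiv_const_mul (hf.diff y)]

theorem lap_af {f : EE n → ℝ} (hf : Sm f) (x : EE n) (s : ℝ) (y : EE n) :
    lap (af x s f) y = s ^ 2 * lap f (x + s • y) := by
  simp only [lap, Finset.mul_sum]
  refine Finset.sum_congr rfl fun i _ => ?_
  rw [pd_af hf, pd_const_mul ((hf.pd _).af x s), pd_af (hf.pd _)]
  simp [af]; ring
end


section
variable {n : ℕ}

theorem hasDerivAt_pw_integral {k : ℕ} (hk : k ≠ 0) {Φ Φ' : ℝ → EE n → ℝ}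
    (hc : Continuous fun p : ℝ × EE n => Φ p.1 p.2)
    (hc' : Continuous fun p : ℝ × EE n => Φ' p.1 p.2)
    (hd : ∀ τ y, HasDerivAt (fun τ => Φ τ y) (Φ' τ y) τ) (τ₀ : ℝ) :
    HasDerivAt (fun τ => ∫ y, pw k y * Φ τ y) (∫ y, pw k y * Φ' τ₀ y) τ₀ := by
  obtain ⟨C, hC⟩ := ((isCompact_closedBall τ₀ 1).prod (isCompact_closedBall (0 : EE n) 1)).exists_bound_of_continuousOn
    hc'.continuousOn
  refine (hasDerivAt_integral_of_dominated_loc_of_deriv_le (μ := volume)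
    (F := fun τ y => pw k y * Φ τ y) (F' := fun τ y => pw k y * Φ' τ y) (bound := fun y => pw k y * C)
    (ball_mem_nhds τ₀ one_pos) ?_ ?_ ?_ ?_ ?_ ?_).2
  · refine .of_forall fun τ => ?_
    exact ((continuous_pw k).mul (hc.comp (Continuous.prodMk_right τ))).aestronglyMeasurable
  · exact integrable_pw_mul hk (hc.comp (Continuous.prodMk_right τ₀))
  · exact ((continuous_pw k).mul (hc'.comp (Continuous.prodMk_right τ₀))).aestronglyMeasurable
  · refine .of_forall fun y τ hτ => ?_
    rw [norm_mul, Real.norm_of_nonneg (pw_nonneg _ _)]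
    by_cases hy : ‖y‖ ≤ 1
    · refine mul_le_mul_of_nonneg_left ?_ (pw_nonneg _ _)
      exact hC (τ, y) ⟨ball_subset_closedBall hτ, by simpa using hy⟩
    · rw [pw_zero hk (not_le.1 hy).le]; simp
  · exact integrable_pw_mul hk continuous_const
  · exact .of_forall fun y τ _ => (hd τ y).const_mul _

/-- two-scale correlation -/
noncomputable def GG (f g : EE n → ℝ) (x : EE n) (s t : ℝ) : ℝ :=
  ∫ y, pw 2 y * (f (x + s • y) * g (x + t • y))

theorem hasDerivAt_ray {f : EE n → ℝ} (hf : Sm f) (x y : EE n) {φ : ℝ → ℝ} {φ' τ : ℝ}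
    (hφ : HasDerivAt φ φ' τ) :
    HasDerivAt (fun τ => f (x + φ τ • y)) (φ' * fderiv ℝ f (x + φ τ • y) y) τ := by
  have h1 : HasDerivAt (fun τ => x + φ τ • y) (φ' • y) τ := (hφ.smul_const y).const_add x
  have := (hf.diff (x + φ τ • y)).hasFDerivAt.comp_hasDerivAt τ h1
  refine HasDerivAt.congr_deriv this ?_
  simp

theorem Sm.fcont {f : EE n → ℝ} (hf : Sm f) : Continuous (fderiv ℝ f) :=
  hf.continuous_fderiv (by simp)

theorem GG_deriv {f g : EE n → ℝ} (hf : Sm f) (hg : Sm g) (x : EE n) (r τ₀ : ℝ) :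
    HasDerivAt (fun τ => GG f g x (r * Real.exp (-τ)) (r * Real.exp τ))
      ((1 / 6) * ∫ y, pw 3 y * (f (x + (r * Real.exp (-τ₀)) • y) * ((r * Real.exp τ₀) ^ 2 * lap g (x + (r * Real.exp τ₀) • y))
        - g (x + (r * Real.exp τ₀) • y) * ((r * Real.exp (-τ₀)) ^ 2 * lap f (x + (r * Real.exp (-τ₀)) • y)))) τ₀ := by
  have key := green (hg.af x (r * Real.exp τ₀)) (hf.af x (r * Real.exp (-τ₀)))
  simp only [lap_af hf, lap_af hg] at key
  simp only [af] at key
  have hfc := hf.continuous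
  have hgc := hg.continuous
  have hfc' := hf.fcont
  have hgc' := hg.fcont
  have hD := hasDerivAt_pw_integral (n := n) (k := 2) (by norm_num)
    (Φ := fun τ y => f (x + (r * Real.exp (-τ)) • y) * g (x + (r * Real.exp τ) • y))
    (Φ' := fun τ y => (-(r * Real.exp (-τ)) * fderiv ℝ f (x + (r * Real.exp (-τ)) • y) y) * g (x + (r * Real.exp τ) • y)
      + f (x + (r * Real.exp (-τ)) • y) * ((r * Real.exp τ) * fderiv ℝ g (x + (r * Real.exp τ) • y) y))
    (by fun_prop) (by fun_prop)
    (fun τ y => by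
      have e1 : HasDerivAt (fun τ => r * Real.exp (-τ)) (-(r * Real.exp (-τ))) τ := by
        have := ((hasDerivAt_neg τ).exp.const_mul r)
        simpa using this
      have e2 : HasDerivAt (fun τ => r * Real.exp τ) (r * Real.exp τ) τ := (Real.hasDerivAt_exp τ).const_mul r
      exact (hasDerivAt_ray hf x y e1).mul (hasDerivAt_ray hg x y e2)) τ₀
  refine hD.congr_deriv ?_
  rw [key, ← mul_assoc]
  norm_num
  refine integral_congr_ae (.of_forall fun y => ?_)
  simp only
  have a1 := (af_hasFDerivAt hf x (r * Real.exp (-τ₀)) y).fderiv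
  have a2 := (af_hasFDerivAt hg x (r * Real.exp (τ₀)) y).fderiv
  rw [a1, a2]
  simp
  left; ring

noncomputable def I2 (n : ℕ) : ℝ := ∫ y : EE n, pw 2 y

theorem I2_pos : 0 < I2 n := by
  unfold I2
  rw [integral_pos_iff_support_of_nonneg (fun y => pw_nonneg 2 y) (integrable_pw (by norm_num))]
  have : ball (0 : EE n) 1 ⊆ Function.support (pw (n := n) 2) := by
    intro y hy
    have : ‖y‖ < 1 := by simpa using hy
    simp only [Function.mem_support, pw]
    have : 0 < 1 - ‖y‖ ^ 2 := by nlinarith [norm_nonneg y]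
    positivity
  exact (isOpen_ball.measure_pos volume ⟨0, by simp⟩).trans_le (measure_mono this)

theorem GG_diff {f g : EE n → ℝ} (hf : Sm f) (hg : Sm g) (x : EE n) {r l mf ef mg eg : ℝ}
    (hr : 0 < r) (hl : 1 ≤ l)
    (hmf : ∀ z ∈ ball x r, |f z| ≤ mf) (hef : ∀ z ∈ ball x r, |lap f z| ≤ ef)
    (hmg : ∀ z ∈ ball x (l * r), |g z| ≤ mg) (heg : ∀ z ∈ ball x (l * r), |lap g z| ≤ eg) :
    |GG f g x (r / l) (r * l) - GG f g x r r| ≤ Real.log l * (l * r) ^ 2 * (mf * eg + mg * ef) * I2 n := by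
  have hl0 : 0 < l := by linarith
  have hmf0 : 0 ≤ mf := (abs_nonneg _).trans (hmf x (mem_ball_self hr))
  have hef0 : 0 ≤ ef := (abs_nonneg _).trans (hef x (mem_ball_self hr))
  have hmg0 : 0 ≤ mg := (abs_nonneg _).trans (hmg x (mem_ball_self (by positivity)))
  have heg0 : 0 ≤ eg := (abs_nonneg _).trans (heg x (mem_ball_self (by positivity)))
  have hb : ∀ τ ∈ Icc 0 (Real.log l), ‖((1 / 6) * ∫ y, pw 3 y * (f (x + (r * Real.exp (-τ)) • y) * ((r * Real.exp τ) ^ 2 * lap g (x + (r * Real.exp τ) • y))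
        - g (x + (r * Real.exp τ) • y) * ((r * Real.exp (-τ)) ^ 2 * lap f (x + (r * Real.exp (-τ)) • y))))‖ ≤ (l * r) ^ 2 * (mf * eg + mg * ef) * I2 n := by
    intro τ hτ
    have e1 : Real.exp (-τ) ≤ 1 := by simpa using hτ.1
    have e2 : Real.exp τ ≤ l := by
      calc Real.exp τ ≤ Real.exp (Real.log l) := Real.exp_le_exp.2 hτ.2
        _ = l := Real.exp_log hl0
    have p1 := Real.exp_pos (-τ)
    have p2 := Real.exp_pos τ
    have hs : r * Real.exp (-τ) ≤ r := by nlinarith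
    have ht : r * Real.exp τ ≤ l * r := by nlinarith
    have : ‖∫ y, pw 3 y * (f (x + (r * Real.exp (-τ)) • y) * ((r * Real.exp τ) ^ 2 * lap g (x + (r * Real.exp τ) • y))
        - g (x + (r * Real.exp τ) • y) * ((r * Real.exp (-τ)) ^ 2 * lap f (x + (r * Real.exp (-τ)) • y)))‖ ≤ ∫ y : EE n, pw 2 y * ((l * r) ^ 2 * (mf * eg + mg * ef)) := by
      refine norm_integral_le_of_norm_le (integrable_pw_mul (by norm_num) continuous_const) (.of_forall fun y => ?_)
      by_cases hy : ‖y‖ < 1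
      · rw [norm_mul, Real.norm_of_nonneg (pw_nonneg _ _), Real.norm_eq_abs]
        refine mul_le_mul (pw_le_pw (by norm_num) y) ?_ (abs_nonneg _) (pw_nonneg _ _)
        have m1 : x + (r * Real.exp (-τ)) • y ∈ ball x r := by
          simp only [mem_ball, dist_self_add_left, norm_smul, Real.norm_eq_abs, abs_of_pos (mul_pos hr p1)]
          nlinarith [norm_nonneg y, mul_pos hr p1]
        have m2 : x + (r * Real.exp τ) • y ∈ ball x (l * r) := by
          simp only [mem_ball, dist_self_add_left, norm_smul, Real.norm_eq_abs, abs_of_pos (mul_pos hr p2)]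
          nlinarith [norm_nonneg y, mul_pos hr p2]
        refine (abs_sub _ _).trans ?_
        rw [abs_mul, abs_mul, abs_mul, abs_mul, abs_of_nonneg (sq_nonneg (r * Real.exp τ)), abs_of_nonneg (sq_nonneg (r * Real.exp (-τ)))]
        have q1 : (r * Real.exp τ) ^ 2 ≤ (l * r) ^ 2 := by gcongr
        have q2 : (r * Real.exp (-τ)) ^ 2 ≤ (l * r) ^ 2 := by
          have : r * Real.exp (-τ) ≤ l * r := by nlinarith
          gcongr
        calc _ ≤ mf * ((l * r) ^ 2 * eg) + mg * ((l * r) ^ 2 * ef) := by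
              gcongr
              · exact hmf _ m1
              · exact heg _ m2
              · exact hmg _ m2
              · exact hef _ m1
          _ = _ := by ring
      · rw [pw_zero (by norm_num) (not_lt.1 hy), pw_zero (by norm_num) (not_lt.1 hy)]; simp
    rw [integral_mul_const] at this
    rw [norm_mul]
    have h6 : ‖(1 / 6 : ℝ)‖ ≤ 1 := by norm_num
    calc _ ≤ 1 * _ := mul_le_mul h6 this (norm_nonneg _) zero_le_one
      _ = _ := by rw [I2]; ring
  have := (convex_Icc 0 (Real.log l)).norm_image_sub_le_of_norm_hasDerivWithin_le
    (fun τ _ => (GG_deriv hf hg x r τ).hasDerivWithinAt) hb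
    (left_mem_Icc.2 (Real.log_nonneg hl)) (right_mem_Icc.2 (Real.log_nonneg hl))
  simp only [Real.exp_log hl0, Real.exp_neg, neg_zero, Real.exp_zero, mul_one, sub_zero] at this
  rw [Real.norm_eq_abs, Real.norm_of_nonneg (Real.log_nonneg hl)] at this
  rw [div_eq_mul_inv]
  calc _ ≤ _ := this
    _ = _ := by ring

theorem GG_harm {f g : EE n → ℝ} (hf : Sm f) (hg : Sm g) (x : EE n) {r l : ℝ}
    (hr : 0 < r) (hl : 1 ≤ l) (hef : ∀ z ∈ ball x r, lap f z = 0)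
    (heg : ∀ z ∈ ball x (l * r), lap g z = 0) :
    GG f g x (r / l) (r * l) = GG f g x r r := by
  obtain ⟨mf, hmf⟩ := (isCompact_closedBall x r).exists_bound_of_continuousOn hf.continuous.continuousOn
  obtain ⟨mg, hmg⟩ := (isCompact_closedBall x (l * r)).exists_bound_of_continuousOn hg.continuous.continuousOn
  have := GG_diff hf hg x (ef := 0) (eg := 0) hr hl (fun z hz => hmf z (ball_subset_closedBall hz))
    (fun z hz => by simp [hef z hz]) (fun z hz => hmg z (ball_subset_closedBall hz)) (fun z hz => by simp [heg z hz])
  simp only [mul_zero, add_zero, zero_mul] at this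
  exact sub_eq_zero.1 (abs_eq_zero.1 (le_antisymm this (abs_nonneg _)))

theorem lap_const (c : ℝ) (x : EE n) : lap (fun _ => c) x = 0 := by
  unfold lap
  apply Finset.sum_eq_zero
  intro i _
  have : pd (EuclideanSpace.single i 1) (fun _ : EE n => c) = fun _ => 0 := by
    ext y; simp [pd]
  rw [this]; simp [pd]

/-- mean value -/
theorem mean_value {f : EE n → ℝ} (hf : Sm f) (x : EE n) {r : ℝ} (hr : 0 < r)
    (hef : ∀ z ∈ ball x r, lap f z = 0) :
    ∫ y, pw 2 y * f (x + r • y) = f x * I2 n := by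
  have h : ∀ l : ℝ, 1 ≤ l → ∫ y, pw 2 y * f (x + (r / l) • y) = ∫ y, pw 2 y * f (x + r • y) := by
    intro l hl
    have := GG_harm hf (contDiff_const (c := (1 : ℝ))) x hr hl hef (fun z _ => lap_const 1 z)
    simpa [GG] using this
  have hc : Continuous fun s : ℝ => ∫ y, pw 2 y * f (x + s • y) := by
    have hD := fun τ₀ => hasDerivAt_pw_integral (n := n) (k := 2) (by norm_num)
      (Φ := fun τ y => f (x + τ • y)) (Φ' := fun τ y => 1 * fderiv ℝ f (x + τ • y) y)
      (by have := hf.continuous; fun_prop) (by have := hf.fcont; fun_prop)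
      (fun τ y => hasDerivAt_ray hf x y (hasDerivAt_id τ)) τ₀
    exact continuous_iff_continuousAt.2 fun τ => (hD τ).continuousAt
  have h0 : Filter.Tendsto (fun l : ℝ => ∫ y, pw 2 y * f (x + (r / l) • y)) Filter.atTop (nhds (∫ y, pw 2 y * f (x + (0:ℝ) • y))) := by
    refine (hc.tendsto 0).comp ?_
    exact Filter.Tendsto.div_atTop tendsto_const_nhds Filter.tendsto_id
  have h1 : Filter.Tendsto (fun l : ℝ => ∫ y, pw 2 y * f (x + (r / l) • y)) Filter.atTop (nhds (∫ y, pw 2 y * f (x + r • y))) := by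
    refine tendsto_const_nhds.congr' ?_
    filter_upwards [Filter.eventually_ge_atTop 1] with l hl
    exact (h l hl).symm
  have := tendsto_nhds_unique h1 h0
  rw [this]
  simp only [zero_smul, add_zero]
  rw [integral_mul_const, mul_comm]; rfl
end


section
variable {n : ℕ}

theorem pd_comm {f : EE n → ℝ} (hf : Sm f) (v w : EE n) : pd v (pd w f) = pd w (pd v f) := by
  ext x
  have hs : IsSymmSndFDerivAt ℝ f x := by
    apply ContDiffAt.isSymmSndFDerivAt (n := (⊤ : ℕ∞)) hf.contDiffAt
    simp only [minSmoothness_of_isRCLikeNormedField]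
    exact WithTop.coe_le_coe.2 (le_top : (2:ℕ∞) ≤ ⊤)
  have hd : DifferentiableAt ℝ (fderiv ℝ f) x :=
    ((hf.fderiv_right (m := (⊤ : ℕ∞)) (by simp)).differentiable (by simp)) x
  have h : ∀ v w : EE n, pd v (pd w f) x = fderiv ℝ (fderiv ℝ f) x v w := by
    intro v w
    have := hd.hasFDerivAt.clm_apply (hasFDerivAt_const w x)
    unfold pd
    rw [this.fderiv]; simp
  rw [h, h, hs v w]

theorem pd_sum {ι : Type*} (s : Finset ι) {F : ι → EE n → ℝ} (hF : ∀ i, Sm (F i)) (v : EE n) (x : EE n) :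
    pd v (fun y => ∑ i ∈ s, F i y) x = ∑ i ∈ s, pd v (F i) x := by
  unfold pd
  rw [fderiv_fun_sum (fun i _ => (hF i).diff x)]
  simp

theorem lap_pd {f : EE n → ℝ} (hf : Sm f) (v : EE n) (x : EE n) :
    lap (pd v f) x = pd v (lap f) x := by
  have : lap f = fun y => ∑ i : Fin n, pd (EuclideanSpace.single i 1) (pd (EuclideanSpace.single i 1) f) y := rfl
  rw [this, pd_sum _ (fun i => (hf.pd _).pd _)]
  refine Finset.sum_congr rfl fun i _ => ?_
  rw [pd_comm hf _ v, pd_comm (hf.pd _) _ v]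

theorem lap_pd_zero {f : EE n → ℝ} (hf : Sm f) (v : EE n) {U : Set (EE n)} (hU : IsOpen U)
    (h : ∀ x ∈ U, lap f x = 0) : ∀ x ∈ U, lap (pd v f) x = 0 := by
  intro x hx
  rw [lap_pd hf]
  have : lap f =ᶠ[nhds x] fun _ => 0 := by
    filter_upwards [hU.mem_nhds hx] with y hy using h y hy
  unfold pd
  rw [this.fderiv_eq]; simp

noncomputable def I1 (n : ℕ) : ℝ := ∫ y : EE n, pw 1 y

theorem I1_ge : I2 n ≤ I1 n :=
  integral_mono (integrable_pw (by norm_num)) (integrable_pw (by norm_num)) fun y => pw_le_pw (by norm_num) y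

/-- gradient constant -/
noncomputable def Cg (n : ℕ) : ℝ := 4 * I1 n / I2 n

theorem Cg_ge : 4 ≤ Cg n := by
  unfold Cg
  rw [le_div_iff₀ I2_pos]
  have := I1_ge (n := n)
  linarith

theorem grad_est {f : EE n → ℝ} (hf : Sm f) (x v : EE n) {r M : ℝ} (hr : 0 < r)
    (hef : ∀ z ∈ ball x r, lap f z = 0) (hM : ∀ z ∈ ball x r, |f z| ≤ M) :
    |pd v f x| ≤ Cg n * ‖v‖ / r * M := by
  have h1 := mean_value (hf.pd v) x hr (lap_pd_zero hf v isOpen_ball hef)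
  have h2 := ibp_pw (n := n) 0 (hf.af x r).one v
  have h3 : (∫ y, pw (0 + 2) y * fderiv ℝ (af x r f) y v) = r * (pd v f x * I2 n) := by
    rw [← h1, ← integral_const_mul]
    refine integral_congr_ae (.of_forall fun y => ?_)
    simp only
    rw [(af_hasFDerivAt hf x r y).fderiv]
    simp [pd]; ring
  rw [h3] at h2
  have h4 : |r * (pd v f x * I2 n)| ≤ ∫ y : EE n, pw 1 y * (4 * ‖v‖ * M) := by
    rw [h2, ← Real.norm_eq_abs]
    refine norm_integral_le_of_norm_le (integrable_pw_mul (by norm_num) continuous_const) (.of_forall fun y => ?_)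
    by_cases hy : ‖y‖ < 1
    · rw [norm_mul, Real.norm_of_nonneg (pw_nonneg _ _)]
      refine mul_le_mul_of_nonneg_left ?_ (pw_nonneg _ _)
      rw [norm_mul, norm_mul]
      have hin : ‖(⟪y, v⟫ : ℝ)‖ ≤ ‖v‖ := (norm_inner_le_norm y v).trans (by nlinarith [norm_nonneg v])
      have hm : x + r • y ∈ ball x r := by
        simp only [mem_ball, dist_self_add_left, norm_smul, Real.norm_eq_abs, abs_of_pos hr]
        nlinarith
      have := hM _ hm
      have h4 : ‖(2 * (((0 : ℕ) : ℝ) + 2))‖ = 4 := by norm_num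
      rw [h4]
      refine mul_le_mul (mul_le_mul_of_nonneg_left hin (by norm_num)) this (norm_nonneg _) (by positivity)
    · rw [pw_zero (by norm_num) (not_lt.1 hy)]; simp
  rw [integral_mul_const, abs_mul, abs_mul, abs_of_pos hr, abs_of_pos I2_pos] at h4
  have hI := I2_pos (n := n)
  have : |pd v f x| = (r * (|pd v f x| * I2 n)) / (r * I2 n) := by field_simp
  rw [this, Cg]
  calc _ ≤ ((∫ y : EE n, pw 1 y) * (4 * ‖v‖ * M)) / (r * I2 n) := by gcongr
    _ = _ := by rw [I1]; field_simp

theorem iter_pd_sm {f : EE n → ℝ} (hf : Sm f) (v : EE n) (k : ℕ) : Sm ((pd v)^[k] f) := by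
  induction k with
  | zero => simpa
  | succ k ih => rw [Function.iterate_succ_apply']; exact ih.pd v

theorem iter_grad_est (v : EE n) {ρ : ℝ} (hρ : 0 < ρ) (k : ℕ) : ∀ {f : EE n → ℝ} (_ : Sm f) (x : EE n) {M : ℝ}
    (_ : ∀ z ∈ ball x (k * ρ), lap f z = 0) (_ : ∀ z ∈ closedBall x (k * ρ), |f z| ≤ M),
    |(pd v)^[k] f x| ≤ (Cg n * ‖v‖ / ρ) ^ k * M := by
  induction k with
  | zero => intro f hf x M _ hM; simpa using hM x (by simp)
  | succ k ih =>
    intro f hf x M hl hM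
    rw [Function.iterate_succ_apply]
    have hsub : ∀ z ∈ closedBall x (k * ρ), ball z ρ ⊆ ball x ((k + 1 : ℕ) * ρ) := by
      intro z hz
      apply ball_subset_ball'
      rw [mem_closedBall] at hz
      push_cast; linarith
    refine (ih (hf.pd v) x (M := Cg n * ‖v‖ / ρ * M) ?_ ?_).trans_eq (by ring)
    · intro z hz
      refine lap_pd_zero hf v isOpen_ball hl z (ball_subset_ball ?_ hz)
      push_cast; linarith
    · intro z hz
      refine grad_est hf z v hρ (fun w hw => hl w (hsub z hz hw)) (fun w hw => ?_)
      exact hM w (ball_subset_closedBall (hsub z hz hw))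
end


theorem rolle_iter (m : ℕ) : ∀ (G : ℕ → ℝ → ℝ) (_ : ∀ i t, HasDerivAt (G i) (G (i + 1) t) t) (z : ℕ → ℝ)
    (_ : ∀ i < m, z i < z (i + 1)) (_ : ∀ i ≤ m, z i ∈ Icc (0:ℝ) 1 ∧ G 0 (z i) = 0),
    ∃ ξ ∈ Icc (0:ℝ) 1, G m ξ = 0 := by
  induction m with
  | zero => intro G _ z _ h; exact ⟨z 0, h 0 le_rfl⟩
  | succ m ih =>
    intro G hG z hz h
    have : ∀ i, ∃ ξ, i ≤ m → (z i < ξ ∧ ξ < z (i+1) ∧ G 1 ξ = 0) := by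
      intro i
      by_cases hi : i ≤ m
      · obtain ⟨ξ, h1, h2⟩ := exists_hasDerivAt_eq_zero (f := G 0) (f' := G 1) (hz i (by omega))
          (fun t _ => (hG 0 t).continuousAt.continuousWithinAt)
          ((h i (by omega)).2.trans (h (i+1) (by omega)).2.symm) (fun x _ => hG 0 x)
        exact ⟨ξ, fun _ => ⟨h1.1, h1.2, h2⟩⟩
      · exact ⟨0, fun h => absurd h hi⟩
    choose ξ hξ using this
    obtain ⟨x, hx, h0⟩ := ih (fun i => G (i + 1)) (fun i t => hG (i+1) t) ξ
      (fun i hi => (hξ i (by omega)).2.1.trans (hξ (i+1) (by omega)).1)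
      (fun i hi => ⟨⟨(h i (by omega)).1.1.trans (hξ i hi).1.le, (hξ i hi).2.1.le.trans (h (i+1) (by omega)).1.2⟩,
        (hξ i hi).2.2⟩)
    exact ⟨x, hx, h0⟩

theorem rolle_finset (G : ℕ → ℝ → ℝ) (hG : ∀ i t, HasDerivAt (G i) (G (i + 1) t) t) {m : ℕ} (Z : Finset ℝ)
    (hc : Z.card = m + 1) (hZ : ∀ z ∈ Z, z ∈ Icc (0:ℝ) 1 ∧ G 0 z = 0) :
    ∃ ξ ∈ Icc (0:ℝ) 1, G m ξ = 0 := by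
  let e := Z.orderEmbOfFin hc
  refine rolle_iter m G hG (fun i => if h : i < m + 1 then e ⟨i, h⟩ else 0) ?_ ?_
  · intro i hi
    rw [dif_pos (by omega), dif_pos (by omega)]
    exact e.strictMono (by simp [Fin.lt_def])
  · intro i hi
    simp only [dif_pos (show i < m + 1 by omega)]
    exact hZ _ (Z.orderEmbOfFin_mem hc _)

open Polynomial in
theorem lagrange_error {ι : Type*} [DecidableEq ι] (s : Finset ι) (v : ι → ℝ) (hv : Set.InjOn v s)
    (hI : ∀ i ∈ s, v i ∈ Icc (0:ℝ) 1) (G : ℕ → ℝ → ℝ) (hG : ∀ i t, HasDerivAt (G i) (G (i + 1) t) t)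
    {D : ℝ} (hD : ∀ t ∈ Icc (0:ℝ) 1, |G s.card t| ≤ D) {t : ℝ} (ht : t ∈ Icc (0:ℝ) 1) :
    |G 0 t| ≤ ∑ i ∈ s, |G 0 (v i)| * |(Lagrange.basis s v i).eval t| + D / (s.card).factorial := by
  set P := Lagrange.interpolate s v (fun i => G 0 (v i)) with hP
  have hPt : |P.eval t| ≤ ∑ i ∈ s, |G 0 (v i)| * |(Lagrange.basis s v i).eval t| := by
    rw [hP, Lagrange.interpolate_apply, eval_finsetSum]
    refine (Finset.abs_sum_le_sum_abs _ _).trans_eq ?_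
    refine Finset.sum_congr rfl fun i _ => ?_
    rw [eval_mul, eval_C, abs_mul]
  have hD0 : 0 ≤ D := (abs_nonneg _).trans (hD t ht)
  suffices h : |G 0 t - P.eval t| ≤ D / (s.card).factorial by
    have := abs_sub_abs_le_abs_sub (G 0 t) (P.eval t)
    linarith
  by_cases hn : ∃ i ∈ s, t = v i
  · obtain ⟨i, hi, rfl⟩ := hn
    rw [hP, Lagrange.eval_interpolate_at_node _ hv hi]
    simp; positivity
  push Not at hn
  set W := Lagrange.nodal s v with hW
  have hWt : W.eval t ≠ 0 := Lagrange.eval_nodal_not_at_node hn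
  set κ := (G 0 t - P.eval t) / W.eval t with hκ
  set Q : ℝ[X] := P + C κ * W with hQ
  obtain ⟨ξ, hξ, h0⟩ := rolle_finset (fun i x => G i x - (derivative^[i] Q).eval x) (fun i x => by
      rw [Function.iterate_succ_apply']
      exact (hG i x).sub (Polynomial.hasDerivAt _ _)) (m := s.card) (insert t (s.image v)) (by
      rw [Finset.card_insert_of_notMem, Finset.card_image_of_injOn hv]
      intro h
      obtain ⟨i, hi, h⟩ := Finset.mem_image.1 h
      exact hn i hi h.symm) (by
      intro z hz
      rcases Finset.mem_insert.1 hz with rfl | hz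
      · refine ⟨ht, ?_⟩
        simp only [Function.iterate_zero, id, hQ, eval_add, eval_mul, eval_C, hκ]
        field_simp; ring
      · obtain ⟨i, hi, rfl⟩ := Finset.mem_image.1 hz
        refine ⟨hI i hi, ?_⟩
        simp only [Function.iterate_zero, id, hQ, eval_add, eval_mul, eval_C, hP, hW]
        rw [Lagrange.eval_interpolate_at_node _ hv hi, Lagrange.eval_nodal_at_node hi]; ring)
  have hdP : derivative^[s.card] P = 0 := by
    by_cases hP0 : P = 0
    · rw [hP0]; simp
    apply Polynomial.iterate_derivative_eq_zero
    exact (Polynomial.natDegree_lt_iff_degree_lt hP0).2 (Lagrange.degree_interpolate_lt _ hv)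
  have hdW : derivative^[s.card] W = C ((s.card.factorial : ℕ) : ℝ) := by
    have hd : W.natDegree = s.card := Lagrange.natDegree_nodal
    have hm : W.Monic := Lagrange.nodal_monic
    have h1 : (derivative^[s.card] W).natDegree = 0 := by
      have := Polynomial.natDegree_iterate_derivative W s.card
      omega
    rw [Polynomial.eq_C_of_natDegree_eq_zero h1, Polynomial.coeff_iterate_derivative]
    have : W.coeff s.card = 1 := by rw [← hd]; exact hm
    simp [this, Nat.descFactorial_self]
  have h1 : (derivative^[s.card] Q) = C (κ * s.card.factorial) := by
    rw [hQ, iterate_map_add, hdP, Polynomial.iterate_derivative_C_mul, hdW, zero_add, C_mul]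
  rw [h1, eval_C] at h0
  have hf : (0:ℝ) < (s.card.factorial : ℝ) := by positivity
  have hκ' : κ = G s.card ξ / s.card.factorial := by
    rw [eq_div_iff hf.ne']; linarith
  have hGP : G 0 t - P.eval t = κ * W.eval t := by rw [hκ]; field_simp
  have hW1 : |W.eval t| ≤ 1 := by
    rw [hW, Lagrange.eval_nodal, Finset.abs_prod]
    refine Finset.prod_le_one (fun _ _ => abs_nonneg _) fun i hi => ?_
    rw [abs_le]
    have := hI i hi
    constructor <;> linarith [this.1, this.2, ht.1, ht.2]
  rw [hGP, abs_mul, hκ', abs_div, abs_of_pos hf]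
  calc _ ≤ D / s.card.factorial * 1 := by
        gcongr
        exact hD ξ hξ
    _ = _ := by ring

theorem cluster_prod {a : ℕ} {i : ℕ} (hi : i < a) {τ : ℝ} (hτ : 0 < τ) (hτ1 : τ ≤ 1) :
    ∏ j ∈ Finset.range a, (if j = i then 1 else (τ / a * |(i:ℝ) - j|)⁻¹) ≤ 6 ^ a * τ⁻¹ ^ a := by
  obtain ⟨k, rfl⟩ : ∃ k, a = i + (1 + k) := ⟨a - i - 1, by omega⟩
  set a := i + (1 + k) with ha
  have ha0 : (0:ℝ) < a := by simp only [ha]; push_cast; positivity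
  have e1 : ∏ j ∈ Finset.range a, (if j = i then 1 else (τ / a * |(i:ℝ) - j|)⁻¹) =
      (a / τ) ^ (i + k) * ((i.factorial : ℝ) * k.factorial)⁻¹ := by
    conv_lhs => rw [ha]
    rw [Finset.prod_range_add, Finset.prod_range_add]
    simp only [Finset.prod_range_one, add_zero, if_true, one_mul]
    have q1 : ∏ x ∈ Finset.range i, (if x = i then (1:ℝ) else (τ / a * |(i:ℝ) - x|)⁻¹) = (a/τ)^i * (i.factorial : ℝ)⁻¹ := by
      rw [← Finset.prod_range_reflect]
      rw [← Finset.prod_range_add_one_eq_factorial, Nat.cast_prod, ← Finset.prod_inv_distrib,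
        show ((a:ℝ) / τ) ^ i = ∏ _x ∈ Finset.range i, ((a:ℝ) / τ) by simp [div_pow], ← Finset.prod_mul_distrib]
      refine Finset.prod_congr rfl fun x hx => ?_
      have hx := Finset.mem_range.1 hx
      rw [if_neg (by omega)]
      have : ((i - 1 - x : ℕ) : ℝ) = (i:ℝ) - 1 - x := by
        rw [Nat.sub_sub, Nat.cast_sub (by omega)]; push_cast; ring
      rw [this, show (i:ℝ) - (i - 1 - x) = x + 1 by ring, abs_of_pos (by positivity)]
      push_cast
      rw [mul_inv, inv_div]
    have q2 : ∏ x ∈ Finset.range k, (if i + (1 + x) = i then (1:ℝ) else (τ / a * |(i:ℝ) - (i + (1 + x) : ℕ)|)⁻¹) = (a/τ)^k * (k.factorial : ℝ)⁻¹ := by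
      rw [← Finset.prod_range_add_one_eq_factorial, Nat.cast_prod, ← Finset.prod_inv_distrib,
        show ((a:ℝ) / τ) ^ k = ∏ _x ∈ Finset.range k, ((a:ℝ) / τ) by simp [div_pow], ← Finset.prod_mul_distrib]
      refine Finset.prod_congr rfl fun x hx => ?_
      rw [if_neg (by omega)]
      push_cast
      rw [show (i:ℝ) - (i + (1 + x)) = -(x + 1) by ring, abs_neg, abs_of_pos (by positivity)]
      rw [mul_inv, inv_div]
    rw [q1, q2, mul_inv, pow_add]; ring
  rw [e1]
  have hch : ((i + k).factorial : ℝ) ≤ 2 ^ (i + k) * ((i.factorial : ℝ) * k.factorial) := by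
    have h1 := Nat.add_choose_mul_factorial_mul_factorial i k
    have h2 := Nat.choose_le_two_pow (i + k) k
    have : (i + k).factorial ≤ 2 ^ (i+k) * (i.factorial * k.factorial) := by
      rw [← h1, mul_assoc]; exact Nat.mul_le_mul_right _ h2
    exact_mod_cast this
  have hinv : ((i.factorial : ℝ) * k.factorial)⁻¹ ≤ 2 ^ (i + k) * ((i + k).factorial : ℝ)⁻¹ := by
    rw [← div_eq_mul_inv, le_div_iff₀ (by positivity), inv_mul_le_iff₀ (by positivity)]
    linarith
  have hexp : (a:ℝ) ^ (i + k) / (i + k).factorial ≤ 3 ^ a := by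
    refine (Real.pow_div_factorial_le_exp (a:ℝ) ha0.le (i + k)).trans ?_
    rw [← Real.exp_one_pow]
    gcongr
    linarith [Real.exp_one_lt_d9]
  have hτ' : 1 ≤ τ⁻¹ := (one_le_inv₀ hτ).2 hτ1
  calc (a / τ) ^ (i + k) * ((i.factorial : ℝ) * k.factorial)⁻¹
      ≤ (a / τ) ^ (i + k) * (2 ^ (i + k) * ((i + k).factorial : ℝ)⁻¹) := by gcongr
    _ = (a:ℝ) ^ (i + k) / (i + k).factorial * (2 ^ (i + k) * τ⁻¹ ^ (i + k)) := by
        rw [div_pow, inv_pow]; field_simp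
    _ ≤ 3 ^ a * (2 ^ a * τ⁻¹ ^ a) := by
        have hik : i + k ≤ a := by omega
        refine mul_le_mul hexp (mul_le_mul (pow_le_pow_right₀ (by norm_num) hik) (pow_le_pow_right₀ hτ' hik) (by positivity) (by positivity)) (by positivity) (by positivity)
    _ = _ := by rw [show (6:ℝ) = 3 * 2 by norm_num, mul_pow]; ring

theorem interp2 {a b : ℕ} (ha : 0 < a) (hb : 0 < b) {τ : ℝ} (hτ : 0 < τ) (hτ1 : τ ≤ 1 / 4)
    (G : ℕ → ℝ → ℝ) (hG : ∀ i t, HasDerivAt (G i) (G (i + 1) t) t)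
    {A B D : ℝ} (hA : ∀ t ∈ Icc 0 τ, |G 0 t| ≤ A) (hB : ∀ t ∈ Icc (1 - τ) 1, |G 0 t| ≤ B)
    (hD : ∀ t ∈ Icc (0:ℝ) 1, |G (a + b) t| ≤ D) {t : ℝ} (ht : t ∈ Icc (0:ℝ) 1) :
    |G 0 t| ≤ 12 ^ (a + b) * (A * τ⁻¹ ^ a + B * τ⁻¹ ^ b) + D / (a + b).factorial := by
  classical
  set s : Finset (ℕ ⊕ ℕ) := (Finset.range a).disjSum (Finset.range b) with hs
  set v : ℕ ⊕ ℕ → ℝ := Sum.elim (fun i => τ / a * i) (fun j => 1 - τ / b * j) with hv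
  have hcard : s.card = a + b := by simp [hs]
  have ha0 : (0:ℝ) < a := by exact_mod_cast ha
  have hb0 : (0:ℝ) < b := by exact_mod_cast hb
  have b1 : ∀ i < a, τ / a * i ∈ Icc 0 τ := by
    intro i hi
    refine ⟨by positivity, ?_⟩
    have : (i:ℝ) ≤ a := by exact_mod_cast hi.le
    calc τ / a * i ≤ τ / a * a := by gcongr
      _ = τ := by field_simp
  have b2 : ∀ i < b, 1 - τ / b * i ∈ Icc (1 - τ) 1 := by
    intro i hi
    have : (i:ℝ) ≤ b := by exact_mod_cast hi.le
    have h1 : τ / b * i ≤ τ := by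
      calc τ / b * i ≤ τ / b * b := by gcongr
        _ = τ := by field_simp
    have h2 : 0 ≤ τ / b * i := by positivity
    constructor <;> linarith
  have hvI : ∀ i ∈ s, v i ∈ Icc (0:ℝ) 1 := by
    rintro (i | i) hi
    · have := b1 i (by simpa [hs] using hi)
      exact ⟨this.1, this.2.trans (by linarith)⟩
    · have := b2 i (by simpa [hs] using hi)
      exact ⟨by simp only [hv, Sum.elim_inr]; linarith [this.1], this.2⟩
  have hinj : Set.InjOn v s := by
    rintro (i | i) hi (j | j) hj h
    · simp only [hv, Sum.elim_inl] at h
      have : (i:ℝ) = j := by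
        have hne : τ / a ≠ 0 := by positivity
        exact mul_left_cancel₀ hne h
      simpa using this
    · have h1 := b1 i (by simpa [hs] using hi)
      have h2 := b2 j (by simpa [hs] using hj)
      simp only [hv, Sum.elim_inl, Sum.elim_inr] at h
      have := h1.2; have := h2.1; linarith
    · have h1 := b1 j (by simpa [hs] using hj)
      have h2 := b2 i (by simpa [hs] using hi)
      simp only [hv, Sum.elim_inl, Sum.elim_inr] at h
      have := h1.2; have := h2.1; linarith
    · simp only [hv, Sum.elim_inr] at h
      have : (i:ℝ) = j := by
        have hne : τ / b ≠ 0 := by positivity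
        apply mul_left_cancel₀ hne; linarith
      simpa using this
  have hτ' : 1 ≤ τ⁻¹ := (one_le_inv₀ hτ).2 (by linarith)
  have key := lagrange_error s v hinj hvI G hG (by rw [hcard]; exact hD) ht
  rw [hcard] at key
  have hbasis : ∀ i ∈ s, |(Lagrange.basis s v i).eval t| ≤ ∏ j ∈ s, (if j = i then 1 else |v i - v j|⁻¹) := by
    intro i hi
    rw [Lagrange.basis, Polynomial.eval_prod, Finset.abs_prod]
    rw [← Finset.prod_erase (a := i) s (f := fun j => (if j = i then 1 else |v i - v j|⁻¹)) (by simp)]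
    refine Finset.prod_le_prod (fun _ _ => abs_nonneg _) fun j hj => ?_
    obtain ⟨hji, hjs⟩ := Finset.mem_erase.1 hj
    rw [if_neg hji, Lagrange.basisDivisor]
    simp only [Polynomial.eval_mul, Polynomial.eval_C, Polynomial.eval_sub, Polynomial.eval_X, abs_mul, abs_inv]
    have : |t - v j| ≤ 1 := by
      rw [abs_le]
      have := hvI j hjs
      constructor <;> linarith [this.1, this.2, ht.1, ht.2]
    exact mul_le_of_le_one_right (by positivity) this
  have hl : ∀ i < a, |(Lagrange.basis s v (Sum.inl i)).eval t| ≤ 6 ^ (a + b) * τ⁻¹ ^ a := by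
    intro i hi
    refine (hbasis _ (by simpa [hs] using hi)).trans ?_
    rw [hs, Finset.prod_disjSum]
    have h1 : ∏ j ∈ Finset.range a, (if (Sum.inl j : ℕ ⊕ ℕ) = Sum.inl i then (1:ℝ) else |v (Sum.inl i) - v (Sum.inl j)|⁻¹) ≤ 6 ^ a * τ⁻¹ ^ a := by
      refine le_trans (le_of_eq ?_) (cluster_prod hi hτ (by linarith))
      refine Finset.prod_congr rfl fun j _ => ?_
      simp only [Sum.inl.injEq, hv, Sum.elim_inl]
      split_ifs
      · rfl
      · rw [← mul_sub, abs_mul, abs_of_pos (show 0 < τ / a by positivity)]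
    have h2 : ∏ j ∈ Finset.range b, (if (Sum.inr j : ℕ ⊕ ℕ) = Sum.inl i then (1:ℝ) else |v (Sum.inl i) - v (Sum.inr j)|⁻¹) ≤ 6 ^ b := by
      rw [show (6:ℝ) ^ b = ∏ _x ∈ Finset.range b, (6:ℝ) by simp]
      refine Finset.prod_le_prod (fun _ _ => ?_) fun j hj => ?_
      · split_ifs <;> positivity
      rw [if_neg (by simp)]
      simp only [hv, Sum.elim_inl, Sum.elim_inr]
      have q1 := b1 i hi
      have q2 := b2 j (Finset.mem_range.1 hj)
      have : 1 / 2 ≤ |τ / a * i - (1 - τ / b * j)| := by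
        rw [abs_sub_comm]
        refine le_trans ?_ (le_abs_self _)
        have := q1.2; have := q2.1; linarith
      refine (inv_anti₀ (by norm_num) this).trans (by norm_num)
    calc _ ≤ (6 ^ a * τ⁻¹ ^ a) * 6 ^ b := by
          refine mul_le_mul h1 h2 (Finset.prod_nonneg fun j _ => ?_) (by positivity)
          split_ifs <;> positivity
      _ = _ := by rw [pow_add]; ring
  have hr : ∀ i < b, |(Lagrange.basis s v (Sum.inr i)).eval t| ≤ 6 ^ (a + b) * τ⁻¹ ^ b := by
    intro i hi
    refine (hbasis _ (by simpa [hs] using hi)).trans ?_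
    rw [hs, Finset.prod_disjSum]
    have h1 : ∏ j ∈ Finset.range b, (if (Sum.inr j : ℕ ⊕ ℕ) = Sum.inr i then (1:ℝ) else |v (Sum.inr i) - v (Sum.inr j)|⁻¹) ≤ 6 ^ b * τ⁻¹ ^ b := by
      refine le_trans (le_of_eq ?_) (cluster_prod hi hτ (by linarith))
      refine Finset.prod_congr rfl fun j _ => ?_
      simp only [Sum.inr.injEq, hv, Sum.elim_inr]
      split_ifs
      · rfl
      · rw [show 1 - τ / b * (i:ℝ) - (1 - τ / b * j) = τ / b * ((j:ℝ) - i) by ring, abs_mul, abs_of_pos (show 0 < τ / b by positivity), abs_sub_comm]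
    have h2 : ∏ j ∈ Finset.range a, (if (Sum.inl j : ℕ ⊕ ℕ) = Sum.inr i then (1:ℝ) else |v (Sum.inr i) - v (Sum.inl j)|⁻¹) ≤ 6 ^ a := by
      rw [show (6:ℝ) ^ a = ∏ _x ∈ Finset.range a, (6:ℝ) by simp]
      refine Finset.prod_le_prod (fun _ _ => ?_) fun j hj => ?_
      · split_ifs <;> positivity
      rw [if_neg (by simp)]
      simp only [hv, Sum.elim_inl, Sum.elim_inr]
      have q1 := b1 j (Finset.mem_range.1 hj)
      have q2 := b2 i hi
      have : 1 / 2 ≤ |1 - τ / b * i - τ / a * j| := by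
        refine le_trans ?_ (le_abs_self _)
        have := q1.2; have := q2.1; linarith
      refine (inv_anti₀ (by norm_num) this).trans (by norm_num)
    calc _ ≤ 6 ^ a * (6 ^ b * τ⁻¹ ^ b) := by
          refine mul_le_mul h2 h1 (Finset.prod_nonneg fun j _ => ?_) (by positivity)
          split_ifs <;> positivity
      _ = _ := by rw [pow_add]; ring
  have hA0 : 0 ≤ A := (abs_nonneg _).trans (hA 0 ⟨le_rfl, hτ.le⟩)
  have hB0 : 0 ≤ B := (abs_nonneg _).trans (hB 1 ⟨by linarith, le_rfl⟩)
  have hsum : ∑ i ∈ s, |G 0 (v i)| * |(Lagrange.basis s v i).eval t| ≤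
      a * (A * (6 ^ (a + b) * τ⁻¹ ^ a)) + b * (B * (6 ^ (a + b) * τ⁻¹ ^ b)) := by
    conv_lhs => rw [hs, Finset.sum_disjSum]
    refine add_le_add ?_ ?_
    · rw [← nsmul_eq_mul]
      conv_rhs => rw [← Finset.card_range a]
      refine Finset.sum_le_card_nsmul _ _ _ fun i hi => ?_
      have hi := Finset.mem_range.1 hi
      rw [Finset.card_range]
      exact mul_le_mul (hA _ (b1 i hi)) (hl i hi) (abs_nonneg _) hA0
    · rw [← nsmul_eq_mul]
      conv_rhs => rw [← Finset.card_range b]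
      refine Finset.sum_le_card_nsmul _ _ _ fun i hi => ?_
      have hi := Finset.mem_range.1 hi
      rw [Finset.card_range]
      exact mul_le_mul (hB _ (b2 i hi)) (hr i hi) (abs_nonneg _) hB0
  have h2a : (a:ℝ) ≤ 2 ^ (a + b) := by
    have : a < 2 ^ a := Nat.lt_two_pow_self
    have h2 : 2 ^ a ≤ 2 ^ (a + b) := Nat.pow_le_pow_right (by norm_num) (by omega)
    exact_mod_cast (this.le.trans h2)
  have h2b : (b:ℝ) ≤ 2 ^ (a + b) := by
    have : b < 2 ^ b := Nat.lt_two_pow_self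
    have h2 : 2 ^ b ≤ 2 ^ (a + b) := Nat.pow_le_pow_right (by norm_num) (by omega)
    exact_mod_cast (this.le.trans h2)
  have : (12:ℝ) ^ (a + b) = 2 ^ (a + b) * 6 ^ (a + b) := by rw [← mul_pow]; norm_num
  calc |G 0 t| ≤ _ := key
    _ ≤ (2 ^ (a + b) * (A * (6 ^ (a + b) * τ⁻¹ ^ a)) + 2 ^ (a + b) * (B * (6 ^ (a + b) * τ⁻¹ ^ b))) + D / (a + b).factorial := by
        gcongr
        refine hsum.trans ?_
        gcongr
    _ = _ := by rw [this]; ring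


section
variable {n : ℕ}

/-- squared length of a family -/
def sq2 (F : Fin n → EE n → ℝ) (x : EE n) : ℝ := ∑ k, F k x ^ 2

/-- length of a family -/
noncomputable def gn (F : Fin n → EE n → ℝ) (x : EE n) : ℝ := Real.sqrt (sq2 F x)

noncomputable def sg (F : Fin n → EE n → ℝ) (x : EE n) (r : ℝ) : ℝ := sSup (gn F '' ball x r)

theorem sq2_nonneg (F : Fin n → EE n → ℝ) (x : EE n) : 0 ≤ sq2 F x :=
  Finset.sum_nonneg fun _ _ => sq_nonneg _

theorem gn_nonneg (F : Fin n → EE n → ℝ) (x : EE n) : 0 ≤ gn F x := Real.sqrt_nonneg _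

theorem gn_sq (F : Fin n → EE n → ℝ) (x : EE n) : gn F x ^ 2 = sq2 F x := Real.sq_sqrt (sq2_nonneg F x)

theorem abs_le_gn (F : Fin n → EE n → ℝ) (k : Fin n) (x : EE n) : |F k x| ≤ gn F x := by
  apply Real.le_sqrt_of_sq_le
  rw [sq_abs]
  exact Finset.single_le_sum (f := fun k => F k x ^ 2) (fun _ _ => sq_nonneg _) (Finset.mem_univ k)

theorem gn_le (F : Fin n → EE n → ℝ) (x : EE n) {M : ℝ} (hM : 0 ≤ M) (h : ∀ k, |F k x| ≤ M) : gn F x ≤ n * M := by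
  apply Real.sqrt_le_iff.2
  refine ⟨by positivity, ?_⟩
  calc sq2 F x ≤ ∑ _k : Fin n, M ^ 2 := Finset.sum_le_sum fun k _ => by
        rw [← sq_abs]; gcongr; exact h k
    _ = n * M ^ 2 := by simp
    _ ≤ (n * M) ^ 2 := by
        rw [mul_pow]
        gcongr
        have : n ≤ n ^ 2 := Nat.le_self_pow (by norm_num) n
        exact_mod_cast this

def SF (F : Fin n → EE n → ℝ) : Prop := ∀ k, Sm (F k)

theorem SF.sq2c {F : Fin n → EE n → ℝ} (hF : SF F) : Continuous (sq2 F) := by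
  unfold sq2
  exact continuous_finsetSum _ fun k _ => (hF k).continuous.pow 2

theorem SF.gnc {F : Fin n → EE n → ℝ} (hF : SF F) : Continuous (gn F) := Real.continuous_sqrt.comp hF.sq2c

theorem SF.bdd {F : Fin n → EE n → ℝ} (hF : SF F) (x : EE n) (r : ℝ) : BddAbove (gn F '' ball x r) :=
  ((isCompact_closedBall x r).image hF.gnc).bddAbove.mono (image_mono ball_subset_closedBall)

theorem SF.le_sg {F : Fin n → EE n → ℝ} (hF : SF F) {x z : EE n} {r : ℝ} (hz : z ∈ ball x r) : gn F z ≤ sg F x r :=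
  le_csSup (hF.bdd x r) (mem_image_of_mem _ hz)

theorem SF.abs_le_sg {F : Fin n → EE n → ℝ} (hF : SF F) {x z : EE n} {r : ℝ} (hz : z ∈ ball x r) (k : Fin n) :
    |F k z| ≤ sg F x r := (abs_le_gn F k z).trans (hF.le_sg hz)

theorem sg_nonneg (F : Fin n → EE n → ℝ) (x : EE n) (r : ℝ) : 0 ≤ sg F x r :=
  Real.sSup_nonneg (by rintro _ ⟨z, _, rfl⟩; exact gn_nonneg F z)

theorem sg_le {F : Fin n → EE n → ℝ} {x : EE n} {r M : ℝ} (hM : 0 ≤ M) (h : ∀ z ∈ ball x r, gn F z ≤ M) :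
    sg F x r ≤ M :=
  Real.sSup_le (by rintro _ ⟨z, hz, rfl⟩; exact h z hz) hM

theorem SF.sg_mono {F : Fin n → EE n → ℝ} (hF : SF F) {x y : EE n} {r R : ℝ} (h : ball x r ⊆ ball y R) :
    sg F x r ≤ sg F y R := sg_le (sg_nonneg _ _ _) fun _ hz => hF.le_sg (h hz)

/-- weighted mean square -/
noncomputable def hh (F : Fin n → EE n → ℝ) (x : EE n) (r : ℝ) : ℝ := ∫ y, pw 2 y * sq2 F (x + r • y)

theorem hh_nonneg (F : Fin n → EE n → ℝ) (x : EE n) (r : ℝ) : 0 ≤ hh F x r :=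
  integral_nonneg fun _ => mul_nonneg (pw_nonneg _ _) (sq2_nonneg _ _)

theorem SF.hh_eq {F : Fin n → EE n → ℝ} (hF : SF F) (x : EE n) (r : ℝ) : hh F x r = ∑ k, GG (F k) (F k) x r r := by
  unfold hh GG
  rw [← integral_finsetSum]
  · refine integral_congr_ae (.of_forall fun y => ?_)
    simp only [sq2, Finset.mul_sum, sq]
  · intro k _
    have := (hF k).continuous
    exact integrable_pw_mul (by norm_num) (by fun_prop)

/-- harmonic family on a set -/
def HF (F : Fin n → EE n → ℝ) (U : Set (EE n)) : Prop := ∀ k, ∀ z ∈ U, lap (F k) z = 0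

theorem hh_logconvex {F : Fin n → EE n → ℝ} (hF : SF F) (x : EE n) {r l : ℝ} (hr : 0 < r) (hl : 1 ≤ l)
    (hh0 : HF F (ball x (l * r))) : hh F x r ^ 2 ≤ hh F x (r / l) * hh F x (r * l) := by
  have hsub : ball x r ⊆ ball x (l * r) := ball_subset_ball (by nlinarith)
  have h1 : hh F x r = ∑ k, GG (F k) (F k) x (r / l) (r * l) := by
    rw [hF.hh_eq]
    refine Finset.sum_congr rfl fun k _ => ?_
    rw [GG_harm (hF k) (hF k) x hr hl (fun z hz => hh0 k z (hsub hz)) (fun z hz => hh0 k z hz)]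
  have hc := fun k => (hF k).continuous
  have h2 : hh F x r = ∫ y, pw 2 y * ∑ k, F k (x + (r / l) • y) * F k (x + (r * l) • y) := by
    rw [h1]
    unfold GG
    rw [← integral_finsetSum]
    · simp only [Finset.mul_sum]
    · intro k _
      exact integrable_pw_mul (by norm_num) (by fun_prop)
  have hq := hF.sq2c
  have key : ∀ t : ℝ, 0 ≤ hh F x (r * l) * (t * t) + (-2 * hh F x r) * t + hh F x (r / l) := by
    intro t
    have : hh F x (r * l) * (t * t) + (-2 * hh F x r) * t + hh F x (r / l) =
        ∫ y, pw 2 y * ∑ k, (t * F k (x + (r * l) • y) - F k (x + (r / l) • y)) ^ 2 := by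
      rw [h2]
      unfold hh
      rw [← integral_mul_const, ← integral_const_mul, ← integral_mul_const, ← integral_add, ← integral_add]
      · refine integral_congr_ae (.of_forall fun y => ?_)
        simp only [sq2, Finset.mul_sum, Finset.sum_mul, ← Finset.sum_add_distrib]
        refine Finset.sum_congr rfl fun k _ => ?_
        ring
      · refine Integrable.add ?_ ?_
        · exact (integrable_pw_mul (by norm_num) (by fun_prop)).mul_const _
        · exact ((integrable_pw_mul (by norm_num) (by fun_prop)).const_mul _).mul_const _
      · exact integrable_pw_mul (by norm_num) (by fun_prop)
      · exact (integrable_pw_mul (by norm_num) (by fun_prop)).mul_const _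
      · exact ((integrable_pw_mul (by norm_num) (by fun_prop)).const_mul _).mul_const _
    rw [this]
    exact integral_nonneg fun y => mul_nonneg (pw_nonneg _ _) (Finset.sum_nonneg fun k _ => sq_nonneg _)
  have := discrim_le_zero key
  unfold discrim at this
  nlinarith

theorem hh_le {F : Fin n → EE n → ℝ} (hF : SF F) (x : EE n) {r : ℝ} (hr : 0 < r) : hh F x r ≤ I2 n * sg F x r ^ 2 := by
  unfold hh I2
  rw [← integral_mul_const]
  refine integral_mono (integrable_pw_mul (by norm_num) ?_) (integrable_pw_mul (by norm_num) continuous_const) fun y => ?_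
  · have := hF.sq2c; fun_prop
  · by_cases hy : ‖y‖ < 1
    · refine mul_le_mul_of_nonneg_left ?_ (pw_nonneg _ _)
      rw [← gn_sq]
      have : x + r • y ∈ ball x r := by
        simp only [mem_ball, dist_self_add_left, norm_smul, Real.norm_eq_abs, abs_of_pos hr]
        nlinarith
      have := hF.le_sg this
      gcongr
      exact gn_nonneg _ _
    · simp only [pw_zero (show 2 ≠ 0 by norm_num) (not_lt.1 hy)]; simp

theorem sq2_le_mean {F : Fin n → EE n → ℝ} (hF : SF F) (z : EE n) {σ : ℝ} (hσ : 0 < σ) (h0 : HF F (ball z σ)) :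
    sq2 F z * I2 n ≤ ∫ y, pw 2 y * sq2 F (z + σ • y) := by
  have hc := fun k => (hF k).continuous
  have hq := hF.sq2c
  have e : sq2 F z * I2 n = ∫ y, pw 2 y * ∑ k, F k z * F k (z + σ • y) := by
    have : ∀ k, F k z ^ 2 * I2 n = ∫ y, pw 2 y * (F k z * F k (z + σ • y)) := by
      intro k
      have := mean_value (hF k) z hσ (h0 k)
      rw [sq, mul_assoc, ← this, ← integral_const_mul]
      refine integral_congr_ae (.of_forall fun y => ?_)
      simp only; ring
    unfold sq2
    rw [Finset.sum_mul]
    simp only [this]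
    rw [← integral_finsetSum]
    · simp only [Finset.mul_sum]
    · intro k _
      exact integrable_pw_mul (by norm_num) (by fun_prop)
  have e2 : sq2 F z * I2 n ≤ ∫ y, (pw 2 y * (sq2 F z / 2) + pw 2 y * (sq2 F (z + σ • y) / 2)) := by
    rw [e]
    refine integral_mono (integrable_pw_mul (by norm_num) (by fun_prop))
      ((integrable_pw_mul (by norm_num) (by fun_prop)).add (integrable_pw_mul (by norm_num) (by fun_prop))) fun y => ?_
    simp only
    rw [← mul_add]
    refine mul_le_mul_of_nonneg_left ?_ (pw_nonneg _ _)
    unfold sq2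
    rw [← add_div, ← Finset.sum_add_distrib, Finset.sum_div]
    refine Finset.sum_le_sum fun k _ => ?_
    nlinarith [sq_nonneg (F k z - F k (z + σ • y))]
  rw [integral_add (integrable_pw_mul (by norm_num) (by fun_prop)) (integrable_pw_mul (by norm_num) (by fun_prop)),
    integral_mul_const] at e2
  simp only [← mul_div_assoc] at e2
  rw [integral_div] at e2
  have : ∫ y : EE n, pw 2 y = I2 n := rfl
  rw [this] at e2
  linarith

theorem rescale_int (Φ : EE n → ℝ) (w : EE n) {ρ : ℝ} (hρ : 0 < ρ) :
    ∫ y, Φ y = ρ ^ n * ∫ y, Φ (w + ρ • y) := by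
  have h1 := Measure.integral_comp_smul (volume : Measure (EE n)) (fun y => Φ (w + y)) ρ
  rw [integral_add_left_eq_self (μ := (volume : Measure (EE n))) Φ w] at h1
  rw [h1]
  simp only [finrank_euclideanSpace, Fintype.card_fin, smul_eq_mul]
  rw [abs_of_pos (by positivity), ← mul_assoc, mul_inv_cancel₀ (by positivity), one_mul]

theorem mean_le_hh {F : Fin n → EE n → ℝ} (hF : SF F) (x z : EE n) {σ R : ℝ} (hσ : 0 < σ) (hR : 0 < R)
    (hz : dist z x ≤ R - 2 * σ) : ∫ y, pw 2 y * sq2 F (z + σ • y) ≤ (R / σ) ^ (n + 2) * hh F x R := by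
  have hq := hF.sq2c
  have hhn := hh_nonneg F x R
  rw [rescale_int (fun y => pw 2 y * sq2 F (z + σ • y)) (σ⁻¹ • (x - z)) (div_pos hR hσ)]
  have hpt : ∀ y : EE n, z + σ • (σ⁻¹ • (x - z) + (R / σ) • y) = x + R • y := by
    intro y
    rw [smul_add, smul_smul, smul_smul, mul_inv_cancel₀ hσ.ne', one_smul, mul_div_cancel₀ _ hσ.ne']
    abel
  simp only [hpt]
  have h2 : ∫ y : EE n, pw 2 (σ⁻¹ • (x - z) + (R / σ) • y) * sq2 F (x + R • y) ≤ (R / σ) ^ 2 * hh F x R := by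
    unfold hh
    rw [← integral_const_mul]
    refine integral_mono_of_nonneg (.of_forall fun y => mul_nonneg (pw_nonneg _ _) (sq2_nonneg _ _))
      ((integrable_pw_mul (by norm_num) (by fun_prop)).const_mul _) (.of_forall fun y => ?_)
    simp only
    rw [← mul_assoc]
    refine mul_le_mul_of_nonneg_right ?_ (sq2_nonneg _ _)
    by_cases hy : ‖σ⁻¹ • (x - z) + (R / σ) • y‖ < 1
    · refine (pw_le_one _ _).trans ?_
      have hn1 : ‖(x + R • y) - z‖ < σ := by
        rw [← hpt y, add_sub_cancel_left, norm_smul, Real.norm_of_nonneg hσ.le]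
        nlinarith
      have hn2 : ‖R • y‖ < R - σ := by
        have : R • y = ((x + R • y) - z) + (z - x) := by abel
        rw [this]
        have h3 := norm_add_le ((x + R • y) - z) (z - x)
        rw [dist_eq_norm] at hz
        linarith
      rw [norm_smul, Real.norm_of_nonneg hR.le] at hn2
      have hn3 : ‖y‖ < 1 - σ / R := by
        rw [show 1 - σ / R = (R - σ) / R by field_simp, lt_div_iff₀ hR]; linarith
      have hsR : 0 < σ / R := by positivity
      have h4 : σ / R ≤ max (1 - ‖y‖ ^ 2) 0 := by
        refine le_trans ?_ (le_max_left _ _)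
        nlinarith [norm_nonneg y]
      unfold pw
      calc (1:ℝ) = (R / σ) ^ 2 * (σ / R) ^ 2 := by field_simp
        _ ≤ _ := by gcongr
    · rw [pw_zero (by norm_num) (not_lt.1 hy)]
      exact mul_nonneg (by positivity) (pw_nonneg _ _)
  calc _ ≤ (R / σ) ^ n * ((R / σ) ^ 2 * hh F x R) := by gcongr
    _ = _ := by ring

theorem sg_sq_le {F : Fin n → EE n → ℝ} (hF : SF F) (x : EE n) {r R : ℝ} (hr : 0 < r) (hrR : r < R)
    (h0 : HF F (ball x R)) : sg F x r ^ 2 ≤ (2 * R / (R - r)) ^ (n + 2) / I2 n * hh F x R := by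
  have hI := I2_pos (n := n)
  have hR : 0 < R := hr.trans hrR
  have hRr : 0 < R - r := by linarith
  have hhn := hh_nonneg F x R
  have hq := hF.sq2c
  set K := (2 * R / (R - r)) ^ (n + 2) / I2 n * hh F x R with hK
  have hK0 : 0 ≤ K := by positivity
  suffices h : ∀ z ∈ ball x r, gn F z ≤ Real.sqrt K by
    have := sg_le (Real.sqrt_nonneg K) h
    calc sg F x r ^ 2 ≤ Real.sqrt K ^ 2 := by
          have := sg_nonneg F x r
          gcongr
      _ = K := Real.sq_sqrt hK0
  intro z hz
  apply Real.sqrt_le_sqrt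
  set σ := (R - r) / 2 with hσd
  have hσ : 0 < σ := by positivity
  rw [mem_ball] at hz
  have hsub : ball z σ ⊆ ball x R := ball_subset_ball' (by linarith)
  have h1 := sq2_le_mean hF z hσ (fun k w hw => h0 k w (hsub hw))
  have h2 := mean_le_hh hF x z hσ hR (by linarith)
  have e : 2 * R / (R - r) = R / σ := by rw [hσd]; field_simp
  rw [hK, e]
  rw [div_mul_eq_mul_div, le_div_iff₀ hI]
  calc _ ≤ _ := h1
    _ ≤ _ := h2
end


section
variable {n : ℕ}

theorem seq_pos {H : ℕ → ℝ} (hH : ∀ j, 0 ≤ H j) {k : ℕ} (hc : ∀ j, j + 1 ≤ k → H (j + 1) ^ 2 ≤ H j * H (j + 2))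
    (hk : 0 < H k) : ∀ j ≤ k, 0 < H j := by
  intro j hj
  by_contra h
  have h0 : H j = 0 := le_antisymm (not_lt.1 h) (hH j)
  have : ∀ i, j + i ≤ k → H (j + i) = 0 := by
    intro i
    induction i with
    | zero => intro _; exact h0
    | succ i ih =>
      intro hi
      have h1 := hc (j + i) (by omega)
      rw [ih (by omega), zero_mul] at h1
      exact pow_eq_zero_iff (two_ne_zero) |>.1 (le_antisymm h1 (sq_nonneg _))
  have := this (k - j) (by omega)
  rw [show j + (k - j) = k by omega] at this
  linarith

theorem seq_ratio {H : ℕ → ℝ} {k : ℕ} (hc : ∀ j, j + 1 ≤ k → H (j + 1) ^ 2 ≤ H j * H (j + 2))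
    (hp : ∀ j ≤ k, 0 < H j) : ∀ j ≤ k, H 1 * H j ≤ H 0 * H (j + 1) := by
  intro j
  induction j with
  | zero => intro _; rw [zero_add, mul_comm]
  | succ j ih =>
    intro hj
    have h1 := ih (by omega)
    have h2 := hc j hj
    have p0 := hp 0 (by omega)
    have p1 := hp j (by omega)
    have p2 := hp (j + 1) hj
    have : H j * (H 1 * H (j + 1)) ≤ H j * (H 0 * H (j + 2)) := by
      calc H j * (H 1 * H (j + 1)) = (H 1 * H j) * H (j + 1) := by ring
        _ ≤ (H 0 * H (j + 1)) * H (j + 1) := by gcongr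
        _ = H 0 * H (j + 1) ^ 2 := by ring
        _ ≤ H 0 * (H j * H (j + 2)) := by gcongr
        _ = _ := by ring
    exact le_of_mul_le_mul_left this p1

theorem cube_norm {x : EE n} (hx : x ∈ cube (0 : EE n) 1) : ‖x‖ ≤ n := by
  have h : ‖x‖ ^ 2 ≤ n := by
    rw [EuclideanSpace.norm_sq_eq]
    calc ∑ i, ‖x i‖ ^ 2 ≤ ∑ _i : Fin n, (1:ℝ) := Finset.sum_le_sum fun i _ => by
          have := hx i
          simp at this
          have h0 := abs_nonneg (x i)
          rw [Real.norm_eq_abs]; nlinarith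
      _ = n := by simp
  rcases Nat.eq_zero_or_pos n with h0 | h0
  · subst h0; simp at h; simp [h]
  have : (1:ℝ) ≤ n := by exact_mod_cast h0
  nlinarith [norm_nonneg x]

theorem cube_dist {x y : EE n} (hx : x ∈ cube (0 : EE n) 1) (hy : y ∈ cube (0 : EE n) 1) : dist x y ^ 2 ≤ n := by
  rw [dist_eq_norm, EuclideanSpace.norm_sq_eq]
  calc ∑ i, ‖(x - y) i‖ ^ 2 ≤ ∑ _i : Fin n, (1:ℝ) := Finset.sum_le_sum fun i _ => by
        have h1 := hx i
        have h2 := hy i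
        simp at h1 h2
        rw [abs_le] at h1 h2
        have : ‖(x - y) i‖ ≤ 1 := by
          rw [Real.norm_eq_abs, abs_le]; simp; constructor <;> linarith
        nlinarith [norm_nonneg ((x - y) i)]
    _ = n := by simp

theorem cube_sub {x : EE n} (hx : x ∈ cube (0 : EE n) 1) {R : ℝ} (hR : R ≤ 80 * n) : ball x R ⊆ ball 0 (90 * n) := by
  apply ball_subset_ball'
  rw [dist_zero_right]
  have := cube_norm hx
  have : (0:ℝ) ≤ n := by positivity
  linarith

/-- standing assumptions -/
structure Stg (F : Fin n → EE n → ℝ) : Prop where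
  n2 : 2 ≤ n
  sm : SF F
  harm : HF F (ball 0 (90 * n))
  nd : ∃ z ∈ cube (0 : EE n) 1, 0 < gn F z

theorem Stg.hfb {F : Fin n → EE n → ℝ} (hF : Stg F) {x : EE n} (hx : x ∈ cube (0 : EE n) 1) {R : ℝ} (hR : R ≤ 80 * n) :
    HF F (ball x R) := fun k z hz => hF.harm k z (cube_sub hx hR hz)

theorem Stg.n2' {F : Fin n → EE n → ℝ} (hF : Stg F) : (2:ℝ) ≤ n := by exact_mod_cast hF.n2

theorem Stg.logc {F : Fin n → EE n → ℝ} (hF : Stg F) {x : EE n} (hx : x ∈ cube (0 : EE n) 1) {t R : ℝ} (ht : 0 < t)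
    (htR : t ≤ R) (hR : R ≤ 80 * n) : hh F x (Real.sqrt (R * t)) ^ 2 ≤ hh F x t * hh F x R := by
  have hR0 : 0 < R := ht.trans_le htR
  have hs : 0 < Real.sqrt (R * t) := Real.sqrt_pos.2 (by positivity)
  have hl : 1 ≤ Real.sqrt (R / t) := by
    rw [Real.one_le_sqrt, one_le_div ht]; exact htR
  have e1 : Real.sqrt (R / t) * Real.sqrt (R * t) = R := by
    rw [← Real.sqrt_mul (by positivity), show R / t * (R * t) = R ^ 2 by field_simp, Real.sqrt_sq hR0.le]
  have e2 : Real.sqrt (R * t) / Real.sqrt (R / t) = t := by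
    rw [← Real.sqrt_div (by positivity), show R * t / (R / t) = t ^ 2 by field_simp, Real.sqrt_sq ht.le]
  have := hh_logconvex hF.sm x hs hl (by rw [e1]; exact hF.hfb hx hR)
  rw [e2, mul_comm (Real.sqrt (R * t)), e1] at this
  exact this

theorem Stg.low {F : Fin n → EE n → ℝ} (hF : Stg F) : ∃ κ K : ℝ, 0 < κ ∧ 0 < K ∧
    (∀ x ∈ cube (0 : EE n) 1, ∀ t : ℝ, 1 / (5 * n) ≤ t → t ≤ 4 → κ ≤ hh F x t) ∧
    (∀ x ∈ cube (0 : EE n) 1, ∀ R : ℝ, 0 < R → R ≤ 80 * n → hh F x R ≤ K) := by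
  obtain ⟨z, hz, hz0⟩ := hF.nd
  have hI := I2_pos (n := n)
  have hn := hF.n2'
  set K := I2 n * sg F 0 (90 * n) ^ 2 + 1 with hK
  have hK0 : 0 < K := by positivity
  have hup : ∀ x ∈ cube (0 : EE n) 1, ∀ R : ℝ, 0 < R → R ≤ 80 * n → hh F x R ≤ K := by
    intro x hx R hR0 hR
    refine (hh_le hF.sm x hR0).trans ?_
    have := hF.sm.sg_mono (cube_sub hx hR)
    have := sg_nonneg F x R
    rw [hK]
    have : I2 n * sg F x R ^ 2 ≤ I2 n * sg F 0 (90 * n) ^ 2 := by gcongr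
    linarith
  set κ := gn F z ^ 2 * I2 n / 4 ^ (n + 2) with hκ
  have hκ0 : 0 < κ := by positivity
  refine ⟨κ ^ 4 / K ^ 3, K, by positivity, hK0, ?_, hup⟩
  intro x hx t ht1 ht4
  have ht0 : 0 < t := lt_of_lt_of_le (by positivity) ht1
  set t1 := Real.sqrt (80 * n * t) with ht1d
  have h4 : 4 ≤ t1 := by
    apply Real.le_sqrt_of_sq_le
    calc (4:ℝ) ^ 2 = 80 * n * (1 / (5 * n)) := by field_simp; norm_num
      _ ≤ _ := by gcongr
  have h1n : t1 ≤ 80 * n := by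
    apply Real.sqrt_le_iff.2
    constructor
    · positivity
    · nlinarith
  have s1 := hF.logc hx ht0 (show t ≤ 80 * n by linarith) le_rfl
  have s2 := hF.logc hx (by linarith : 0 < t1) h1n le_rfl
  rw [← ht1d] at s1
  set t2 := Real.sqrt (80 * n * t1) with ht2d
  have ht2 : 320 * n ≤ t2 ^ 2 := by
    rw [ht2d, Real.sq_sqrt (by positivity)]; nlinarith
  have ht2p : 0 < t2 := Real.sqrt_pos.2 (by positivity)
  have ht2n : t2 ≤ 80 * n := by
    apply Real.sqrt_le_iff.2
    constructor
    · positivity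
    · nlinarith
  have hzb : z ∈ ball x (t2 / 2) := by
    rw [mem_ball]
    have := cube_dist hz hx
    by_contra hcon
    push Not at hcon
    nlinarith
  have b2 : κ ≤ hh F x t2 := by
    have h1 := sg_sq_le hF.sm x (r := t2 / 2) (R := t2) (by positivity) (by linarith) (hF.hfb hx ht2n)
    rw [show 2 * t2 / (t2 - t2 / 2) = 4 by field_simp; norm_num] at h1
    have h2 := hF.sm.le_sg hzb
    have h3 : gn F z ^ 2 ≤ 4 ^ (n + 2) / I2 n * hh F x t2 := le_trans (by gcongr) h1
    rw [hκ, div_le_iff₀ (by positivity)]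
    calc gn F z ^ 2 * I2 n ≤ 4 ^ (n + 2) / I2 n * hh F x t2 * I2 n := by gcongr
      _ = _ := by field_simp
  have u := hup x hx (80 * n) (by positivity) le_rfl
  have b1 : κ ^ 2 / K ≤ hh F x t1 := by
    rw [div_le_iff₀ hK0]
    have p := hh_nonneg F x t1
    calc κ ^ 2 ≤ hh F x t2 ^ 2 := by gcongr
      _ ≤ _ := s2
      _ ≤ _ := by gcongr
  have p := hh_nonneg F x t
  calc κ ^ 4 / K ^ 3 = (κ ^ 2 / K) ^ 2 / K := by field_simp
    _ ≤ hh F x t1 ^ 2 / K := by gcongr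
    _ ≤ hh F x t := by
        rw [div_le_iff₀ hK0]
        exact s1.trans (by gcongr)

theorem Stg.chain {F : Fin n → EE n → ℝ} (hF : Stg F) {x : EE n} (hx : x ∈ cube (0 : EE n) 1) {L r : ℝ} (hL : 1 ≤ L)
    (hr : 0 < r) {k : ℕ} (hk : L ^ (k + 1) * r ≤ 80 * n) :
    ∀ j, j + 1 ≤ k → hh F x (L ^ (j + 1) * r) ^ 2 ≤ hh F x (L ^ j * r) * hh F x (L ^ (j + 2) * r) := by
  intro j hj
  have hL0 : 0 < L := by linarith
  have := hh_logconvex hF.sm x (r := L ^ (j + 1) * r) (by positivity) hL (hF.hfb hx (by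
    refine le_trans ?_ hk
    rw [← mul_assoc, ← pow_succ']
    gcongr))
  rw [show L ^ (j + 1) * r / L = L ^ j * r by rw [pow_succ]; field_simp,
    show L ^ (j + 1) * r * L = L ^ (j + 2) * r by ring] at this
  exact this

theorem Stg.hh_pos {F : Fin n → EE n → ℝ} (hF : Stg F) {x : EE n} (hx : x ∈ cube (0 : EE n) 1) {r : ℝ}
    (hr : 0 < r) (hr4 : r ≤ 4) : 0 < hh F x r := by
  obtain ⟨κ, K, hκ, hK, hlow, hup⟩ := hF.low
  have hn := hF.n2'
  obtain ⟨L, hL⟩ : ∃ L : ℝ, L = 20 * n := ⟨_, rfl⟩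
  obtain ⟨k, h1, h2⟩ := exists_nat_pow_near (x := 4 / r) (y := L) ((one_le_div hr).2 hr4) (by linarith)
  rw [le_div_iff₀ hr] at h1
  rw [div_lt_iff₀ hr] at h2
  have hk : L ^ (k + 1) * r ≤ 80 * n := by
    rw [pow_succ]; nlinarith
  have hc := hF.chain hx (L := L) (by linarith) hr hk
  have := seq_pos (H := fun j => hh F x (L ^ j * r)) (fun j => hh_nonneg _ _ _) hc (by
    refine hκ.trans_le (hlow x hx _ ?_ h1)
    rw [div_le_iff₀ (by positivity)]
    rw [pow_succ] at h2
    nlinarith) 0 (Nat.zero_le _)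
  simpa using this

theorem Stg.sg_pos {F : Fin n → EE n → ℝ} (hF : Stg F) {x : EE n} (hx : x ∈ cube (0 : EE n) 1) {r : ℝ}
    (hr : 0 < r) (hr4 : r ≤ 4) : 0 < sg F x r := by
  have h1 := hF.hh_pos hx hr hr4
  have h2 := hh_le hF.sm x hr
  by_contra h
  have : sg F x r = 0 := le_antisymm (not_lt.1 h) (sg_nonneg _ _ _)
  rw [this] at h2
  simp at h2; linarith

theorem Stg.bdd {F : Fin n → EE n → ℝ} (hF : Stg F) : ∃ B : ℝ, ∀ x ∈ cube (0 : EE n) 1, ∀ r, 0 < r → r ≤ 1 →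
    sg F x (10 * n * r) ^ 2 ≤ B * sg F x r ^ 2 := by
  obtain ⟨κ, K, hκ, hK, hlow, hup⟩ := hF.low
  have hn := hF.n2'
  obtain ⟨L, hL⟩ : ∃ L : ℝ, L = 20 * n := ⟨_, rfl⟩
  have hI := I2_pos (n := n)
  refine ⟨4 ^ (n + 2) * K / κ, fun x hx r hr hr1 => ?_⟩
  obtain ⟨k, h1, h2⟩ := exists_nat_pow_near (x := 4 / r) (y := L) ((one_le_div hr).2 (by linarith)) (by linarith)
  rw [le_div_iff₀ hr] at h1
  rw [div_lt_iff₀ hr] at h2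
  have hk : L ^ (k + 1) * r ≤ 80 * n := by
    rw [pow_succ]; nlinarith
  have hc := hF.chain hx (L := L) (by linarith) hr hk
  have hkl : κ ≤ hh F x (L ^ k * r) := by
    refine (hlow x hx _ ?_ h1)
    rw [div_le_iff₀ (by positivity)]
    rw [pow_succ] at h2
    nlinarith
  have hp := seq_pos (H := fun j => hh F x (L ^ j * r)) (fun j => hh_nonneg _ _ _) hc (hκ.trans_le hkl)
  have hrat := seq_ratio (H := fun j => hh F x (L ^ j * r)) hc hp k le_rfl
  simp only [pow_one, pow_zero, one_mul] at hrat
  have hku := hup x hx _ (by positivity) hk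
  have g1 := hh_le hF.sm x hr
  have g2 := sg_sq_le hF.sm x (r := 10 * n * r) (R := L * r) (by positivity) (by nlinarith) (hF.hfb hx (by nlinarith))
  rw [show 2 * (L * r) / (L * r - 10 * n * r) = 4 by
    rw [hL, show 20 * n * r - 10 * n * r = 10 * n * r by ring]; field_simp; norm_num] at g2
  have q := hh_nonneg F x (L * r)
  have q0 := hh_nonneg F x r
  have q1 := hh_nonneg F x (L ^ (k + 1) * r)
  have g3 : hh F x (L * r) * κ ≤ I2 n * sg F x r ^ 2 * K := by
    calc _ ≤ hh F x (L * r) * hh F x (L ^ k * r) := by gcongr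
      _ ≤ _ := hrat
      _ ≤ _ := by gcongr
  calc _ ≤ _ := g2
    _ = 4 ^ (n + 2) / I2 n * (hh F x (L * r) * κ) / κ := by field_simp
    _ ≤ 4 ^ (n + 2) / I2 n * (I2 n * sg F x r ^ 2 * K) / κ := by gcongr
    _ = _ := by field_simp

/-- doubling hypothesis -/
def Dbl (F : Fin n → EE n → ℝ) (N : ℝ) : Prop := ∀ x ∈ cube (0 : EE n) 1, ∀ r, 0 < r → r ≤ 1 →
    sg F x (10 * n * r) ≤ Real.exp N * sg F x r

/-- doubling exponent -/
noncomputable def dd (n : ℕ) (N : ℝ) : ℝ := N / Real.log (10 * n)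

theorem log10n (hn : 2 ≤ n) : 1 ≤ Real.log (10 * n) := by
  have : (2:ℝ) ≤ n := by exact_mod_cast hn
  rw [Real.le_log_iff_exp_le (by positivity)]
  linarith [Real.exp_one_lt_d9]

theorem dbl_pow {F : Fin n → EE n → ℝ} (hn : 2 ≤ n) (hF : SF F) {N : ℝ} (hN : 0 ≤ N) (hD : Dbl F N) {x : EE n}
    (hx : x ∈ cube (0 : EE n) 1) {r R : ℝ} (hr : 0 < r) (hrR : r ≤ R) (hR : R ≤ 10 * n) :
    sg F x R ≤ Real.exp N * (R / r) ^ (dd n N) * sg F x r := by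
  have hn2 : (2:ℝ) ≤ n := by exact_mod_cast hn
  have hR0 : 0 < R := hr.trans_le hrR
  have hl := log10n hn
  have hb : (0:ℝ) < 10 * n := by positivity
  obtain ⟨k, h1, h2⟩ := exists_nat_pow_near (x := R / r) (y := 10 * n) ((one_le_div hr).2 hrR) (by linarith)
  have hit : ∀ j : ℕ, sg F x R ≤ Real.exp N ^ j * sg F x (R / (10 * n) ^ j) := by
    intro j
    induction j with
    | zero => simp
    | succ j ih =>
      refine ih.trans ?_
      rw [pow_succ, mul_assoc]
      gcongr
      have h3 := hD x hx (R / (10 * n) ^ (j + 1)) (by positivity) (by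
        rw [div_le_one (by positivity), pow_succ]
        have : (1:ℝ) ≤ (10 * n) ^ j := one_le_pow₀ (by linarith)
        nlinarith)
      rwa [show 10 * n * (R / (10 * n) ^ (j + 1)) = R / (10 * n) ^ j by rw [pow_succ]; field_simp] at h3
  refine (hit (k + 1)).trans ?_
  have hs : sg F x (R / (10 * n) ^ (k + 1)) ≤ sg F x r := by
    apply hF.sg_mono; apply ball_subset_ball
    rw [div_le_iff₀ (by positivity)]
    rw [div_lt_iff₀ hr] at h2; linarith
  have he : Real.exp N ^ (k + 1) ≤ Real.exp N * (R / r) ^ (dd n N) := by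
    rw [pow_succ, mul_comm]
    gcongr
    rw [← Real.exp_nat_mul, Real.rpow_def_of_pos (by positivity), Real.exp_le_exp, dd]
    have : k * Real.log (10 * n) ≤ Real.log (R / r) := by
      rw [← Real.log_pow]; exact Real.log_le_log (by positivity) h1
    rw [mul_div_assoc', le_div_iff₀ (by linarith)]
    nlinarith
  have := sg_nonneg F x r
  calc _ ≤ Real.exp N ^ (k + 1) * sg F x r := by gcongr
    _ ≤ _ := by gcongr

end


section
variable {n : ℕ}

/-- bad point -/
def BadAt (F : Fin n → EE n → ℝ) (N c : ℝ) (x : EE n) (r : ℝ) : Prop :=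
  Real.exp (N / (1 + c)) * sg F x r < sg F x (10 * n * r)

/-- ratio used for radii -/
noncomputable def Lam (n : ℕ) (ε : ℝ) : ℝ := 10 * n * (1 + ε / 4)

/-- constant -/
noncomputable def K1 (n : ℕ) (ε : ℝ) : ℝ := (2 * (1 + ε / 4) / (ε / 4)) ^ (n + 2)

theorem bad_theta {F : Fin n → EE n → ℝ} (hF : Stg F) {ε : ℝ} (hε : 0 < ε) (hε1 : ε < 1) {N : ℝ} (hN : 0 ≤ N)
    (hNK : Real.log (K1 n ε) ≤ ε * N) {x : EE n} (hx : x ∈ cube (0 : EE n) 1) {r : ℝ} (hr : 0 < r) (hr1 : r ≤ 1)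
    (hbad : BadAt F N (ε / 4) x r) :
    Lam n ε ^ (2 * ((1 - ε) * dd n N)) * hh F x r ≤ hh F x (Lam n ε * r) := by
  have hn := hF.n2'
  have hI := I2_pos (n := n)
  have hl := log10n hF.n2
  have hL0 : 0 < Lam n ε := by unfold Lam; positivity
  have hK0 : 0 < K1 n ε := by unfold K1; positivity
  have g1 := hh_le hF.sm x hr
  have hLn : Lam n ε ≤ 20 * n := by unfold Lam; nlinarith
  have hLn' : 10 * n < Lam n ε := by unfold Lam; nlinarith
  have g2 := sg_sq_le hF.sm x (r := 10 * n * r) (R := Lam n ε * r) (by positivity) (by gcongr) (hF.hfb hx (by nlinarith))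
  rw [show 2 * (Lam n ε * r) / (Lam n ε * r - 10 * n * r) = 2 * (1 + ε / 4) / (ε / 4) by
    unfold Lam
    rw [show 10 * n * (1 + ε / 4) * r - 10 * n * r = 10 * n * r * (ε / 4) by ring]
    field_simp] at g2
  change _ ≤ K1 n ε / I2 n * _ at g2
  have hb2 : (Real.exp (N / (1 + ε / 4)) * sg F x r) ^ 2 ≤ sg F x (10 * n * r) ^ 2 := by
    have := sg_nonneg F x r
    unfold BadAt at hbad
    gcongr
  have key : Lam n ε ^ (2 * ((1 - ε) * dd n N)) ≤ Real.exp (N / (1 + ε / 4)) ^ 2 / K1 n ε := by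
    rw [le_div_iff₀ hK0]
    have h1 : Real.log (Lam n ε) ≤ Real.log (10 * n) * (1 + ε / 4) := by
      unfold Lam
      rw [Real.log_mul (by positivity) (by positivity)]
      have := Real.log_le_sub_one_of_pos (show 0 < 1 + ε / 4 by positivity)
      nlinarith
    rw [Real.rpow_def_of_pos hL0]
    have hKe := Real.exp_log hK0
    set κ := K1 n ε
    rw [← hKe, ← Real.exp_add, ← Real.exp_nat_mul, Real.exp_le_exp]
    have h2 : N * (1 - ε / 4) ≤ N / (1 + ε / 4) := by
      rw [le_div_iff₀ (by positivity)]; nlinarith [mul_nonneg hN (sq_nonneg ε)]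
    have h3 : Real.log (Lam n ε) * dd n N ≤ N * (1 + ε / 4) := by
      unfold dd
      rw [mul_div_assoc', div_le_iff₀ (by linarith)]
      nlinarith
    have h4 : Real.log (Lam n ε) * (2 * ((1 - ε) * dd n N)) ≤ 2 * (1 - ε) * (N * (1 + ε / 4)) := by
      calc _ = 2 * (1 - ε) * (Real.log (Lam n ε) * dd n N) := by ring
        _ ≤ _ := by
          have : 0 ≤ 1 - ε := by linarith
          gcongr
    push_cast
    nlinarith [mul_nonneg hN (sq_nonneg ε), mul_nonneg hN hε.le]
  have hh0 := hh_nonneg F x r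
  have e2 : Real.exp (N / (1 + ε / 4)) ^ 2 * hh F x r ≤ K1 n ε * hh F x (Lam n ε * r) := by
    calc _ ≤ Real.exp (N / (1 + ε / 4)) ^ 2 * (I2 n * sg F x r ^ 2) := by gcongr
      _ = I2 n * (Real.exp (N / (1 + ε / 4)) * sg F x r) ^ 2 := by ring
      _ ≤ I2 n * (K1 n ε / I2 n * hh F x (Lam n ε * r)) := by
        have := hb2.trans g2
        gcongr
      _ = _ := by field_simp
  calc _ ≤ Real.exp (N / (1 + ε / 4)) ^ 2 / K1 n ε * hh F x r := by gcongr
    _ = (Real.exp (N / (1 + ε / 4)) ^ 2 * hh F x r) / K1 n ε := by ring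
    _ ≤ _ := by rw [div_le_iff₀ hK0]; linarith

theorem bad_decay {F : Fin n → EE n → ℝ} (hF : Stg F) {ε : ℝ} (hε : 0 < ε) (hε1 : ε < 1) {N : ℝ} (hN : 0 ≤ N)
    (hNK : Real.log (K1 n ε) ≤ ε * N) {x : EE n} (hx : x ∈ cube (0 : EE n) 1) {r ρ R : ℝ} (hr : 0 < r)
    (hrρ : r ≤ ρ) (hρR : ρ ≤ R) (hR1 : R ≤ 1)
    (hbad : BadAt F N (ε / 4) x r) :
    sg F x ρ ≤ 2 ^ (n + 2) * (2 * Lam n ε ^ 2 * ρ / R) ^ ((1 - ε) * dd n N) * sg F x R := by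
  have hn := hF.n2'
  have hI := I2_pos (n := n)
  have hl := log10n hF.n2
  have hth := bad_theta hF hε hε1 hN hNK hx hr (by linarith) hbad
  have hL1 : 1 < Lam n ε := by unfold Lam; nlinarith
  have hLn : Lam n ε ≤ 20 * n := by unfold Lam; nlinarith
  have hdd : 0 ≤ (1 - ε) * dd n N := mul_nonneg (by linarith) (by unfold dd; positivity)
  set L := Lam n ε with hLd
  set p := (1 - ε) * dd n N with hp
  have hL0 : 0 < L := by linarith
  have hρ : 0 < ρ := by linarith
  have hR : 0 < R := by linarith
  have hsgR := sg_nonneg F x R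
  obtain ⟨i, i1, i2⟩ := exists_nat_pow_near (x := 2 * ρ / r) (y := L) ((one_le_div hr).2 (by linarith)) hL1
  obtain ⟨l, l1, l2⟩ := exists_nat_pow_near (x := R / r) (y := L) ((one_le_div hr).2 (by linarith)) hL1
  rw [le_div_iff₀ hr] at i1 l1
  rw [div_lt_iff₀ hr] at i2 l2
  have h2n : (1:ℝ) ≤ 2 ^ (n + 2) := one_le_pow₀ (by norm_num)
  rcases lt_or_ge l (i + 1) with hli | hil
  · have h1 : R < 2 * L ^ 2 * ρ := by
      calc R < L ^ (l + 1) * r := l2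
        _ ≤ L ^ (i + 1) * r := by gcongr <;> first | exact hL1.le | omega
        _ = L * (L ^ i * r) := by ring
        _ ≤ L * (2 * ρ) := by gcongr
        _ ≤ L ^ 2 * (2 * ρ) := by gcongr; nlinarith
        _ = _ := by ring
    have h2 : 1 ≤ 2 * L ^ 2 * ρ / R := (one_le_div hR).2 h1.le
    have h3 : 1 ≤ (2 * L ^ 2 * ρ / R) ^ p := Real.one_le_rpow h2 hdd
    have h4 : sg F x ρ ≤ sg F x R := hF.sm.sg_mono (ball_subset_ball hρR)
    have h5 : (1:ℝ) ≤ 2 ^ (n + 2) * (2 * L ^ 2 * ρ / R) ^ p := by nlinarith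
    nlinarith
  have hkl : L ^ (l + 1) * r ≤ 80 * n := by
    rw [pow_succ]; nlinarith
  have hc := hF.chain hx hL1.le hr hkl
  have hpos := seq_pos (H := fun j => hh F x (L ^ j * r)) (fun j => hh_nonneg _ _ _) hc
    (hF.hh_pos hx (by positivity) (by linarith))
  have hrat := seq_ratio (H := fun j => hh F x (L ^ j * r)) hc hpos
  have h0 := hpos 0 (Nat.zero_le _)
  simp only [pow_one, pow_zero, one_mul] at hrat h0
  set θ := L ^ (2 * p) with hθ
  have hθ0 : 0 < θ := by positivity
  have step : ∀ j ≤ l, θ * hh F x (L ^ j * r) ≤ hh F x (L ^ (j + 1) * r) := by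
    intro j hj
    have h1 := hrat j hj
    have h2 := (hpos j hj).le
    have : hh F x r * (θ * hh F x (L ^ j * r)) ≤ hh F x r * hh F x (L ^ (j + 1) * r) := by
      calc _ = (θ * hh F x r) * hh F x (L ^ j * r) := by ring
        _ ≤ hh F x (L * r) * hh F x (L ^ j * r) := by gcongr
        _ ≤ _ := h1
    exact le_of_mul_le_mul_left this h0
  have stepk : ∀ k, i + 1 + k ≤ l → θ ^ k * hh F x (L ^ (i + 1) * r) ≤ hh F x (L ^ (i + 1 + k) * r) := by
    intro k
    induction k with
    | zero => intro _; simp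
    | succ k ih =>
      intro hk
      calc _ = θ * (θ ^ k * hh F x (L ^ (i + 1) * r)) := by ring
        _ ≤ θ * hh F x (L ^ (i + 1 + k) * r) := by gcongr; exact ih (by omega)
        _ ≤ _ := step _ (by omega)
  obtain ⟨k, rfl⟩ := Nat.exists_eq_add_of_le hil
  have hs := stepk k le_rfl
  set R' := L ^ (i + 1) * r with hR'
  have hR'l : R' ≤ 80 * n := by
    refine le_trans ?_ hkl
    rw [hR']; gcongr
    · exact hL1.le
    · omega
  have a1 := sg_sq_le hF.sm x (r := ρ) (R := R') hρ (by linarith) (hF.hfb hx hR'l)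
  have a2 : 2 * R' / (R' - ρ) ≤ 4 := by
    rw [div_le_iff₀ (by linarith)]; linarith
  have a3 := hh_le hF.sm x (r := L ^ (i + 1 + k) * r) (by positivity)
  have a4 : sg F x (L ^ (i + 1 + k) * r) ≤ sg F x R := hF.sm.sg_mono (ball_subset_ball l1)
  have a5 := sg_nonneg F x (L ^ (i + 1 + k) * r)
  have hR'0 : 0 < R' := by positivity
  have a6 : sg F x ρ ^ 2 ≤ 4 ^ (n + 2) / I2 n * hh F x R' := by
    have := hh_nonneg F x R'
    refine a1.trans ?_
    have : 0 ≤ 2 * R' / (R' - ρ) := div_nonneg (by positivity) (by linarith)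
    gcongr
  have a7 : θ ^ k * hh F x R' ≤ I2 n * sg F x R ^ 2 := hs.trans (a3.trans (by gcongr))
  have a8 : (R / (2 * L ^ 2 * ρ)) ^ (2 * p) ≤ θ ^ k := by
    rw [hθ, ← Real.rpow_natCast (L ^ (2 * p)), ← Real.rpow_mul hL0.le, mul_comm (2 * p), Real.rpow_mul hL0.le, Real.rpow_natCast]
    apply Real.rpow_le_rpow (by positivity) _ (by linarith)
    rw [div_le_iff₀ (by positivity)]
    calc R ≤ L ^ (i + 1 + k + 1) * r := l2.le
      _ = L ^ k * L ^ 2 * (L ^ i * r) := by ring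
      _ ≤ L ^ k * L ^ 2 * (2 * ρ) := by gcongr
      _ = _ := by ring
  have a9 : (R / (2 * L ^ 2 * ρ)) ^ (2 * p) = ((2 * L ^ 2 * ρ / R) ^ p ^ 1)⁻¹ ^ 2 := by
    rw [← inv_div, Real.inv_rpow (by positivity), pow_one, mul_comm 2 p, Real.rpow_mul (by positivity), inv_pow]
    norm_cast
  rw [pow_one] at a9
  set X := (2 * L ^ 2 * ρ / R) ^ p with hX
  have hX0 : 0 < X := by positivity
  rw [a9] at a8
  have hhR' := hh_nonneg F x R'
  have b1 : hh F x R' ≤ X ^ 2 * (I2 n * sg F x R ^ 2) := by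
    have : X⁻¹ ^ 2 * hh F x R' ≤ I2 n * sg F x R ^ 2 := le_trans (by gcongr) a7
    calc hh F x R' = X ^ 2 * (X⁻¹ ^ 2 * hh F x R') := by field_simp
      _ ≤ _ := by gcongr
  apply abs_le_of_sq_le_sq' _ (by positivity) |>.2
  calc _ ≤ _ := a6
    _ ≤ 4 ^ (n + 2) / I2 n * (X ^ 2 * (I2 n * sg F x R ^ 2)) := by gcongr
    _ = 4 ^ (n + 2) * X ^ 2 * sg F x R ^ 2 := by field_simp
    _ = _ := by
      rw [show (4:ℝ) = 2 ^ 2 by norm_num, ← pow_mul, mul_comm 2, pow_mul]; ring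

end


section
variable {n : ℕ}

theorem pow_le_cube {X d : ℝ} (hX : 1 ≤ X) {k : ℕ} (hk : (k:ℝ) ≤ 3 * d) : X ^ k ≤ (X ^ 3) ^ d := by
  rw [← Real.rpow_natCast X k, ← Real.rpow_natCast X 3, ← Real.rpow_mul (by linarith)]
  exact Real.rpow_le_rpow_of_exponent_le hX (by push_cast; linarith)

theorem join_num {α d ρ B W V : ℝ} (hα1 : α ≤ 1 / 2) (hd : 16 ≤ α * d) (hd1 : 1 ≤ d)
    (hρ : 0 < ρ) (hρ1 : ρ ≤ 1) (hB : 1 ≤ B) (hW : 1 ≤ W) (hV : 1 ≤ V) {a b : ℕ} (ha : (a:ℝ) ≤ 3 / 4 * α * d)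
    (hb : (b:ℝ) ≤ (1 - α / 2) * d + 2) (hm1 : (1 + α / 4) * d ≤ (a + b : ℕ)) (hm2 : ((a + b : ℕ) : ℝ) ≤ 3 * d) :
    12 ^ (a + b) * ((B * ρ ^ α) ^ d * (ρ / W)⁻¹ ^ a + (B * ρ ^ (1 - α / 8)) ^ d * (ρ / W)⁻¹ ^ b)
      + (V * ρ) ^ (a + b) * (B * ρ⁻¹) ^ d ≤ (3 * 12 ^ 3 * W ^ 3 * V ^ 3 * B * ρ ^ (α / 4)) ^ d := by
  have hB0 : 0 < B := by linarith
  have hW0 : 0 < W := by linarith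
  have hV0 : 0 < V := by linarith
  have ham : (a:ℝ) ≤ 3 * d := le_trans (by push_cast; linarith [(b.cast_nonneg : (0:ℝ) ≤ b)]) hm2
  have hbm : (b:ℝ) ≤ 3 * d := le_trans (by push_cast; linarith [(a.cast_nonneg : (0:ℝ) ≤ a)]) hm2
  have p12 : (12:ℝ) ^ (a + b) ≤ (12 ^ 3) ^ d := pow_le_cube (by norm_num) hm2
  have pWa : W ^ a ≤ (W ^ 3) ^ d := pow_le_cube hW ham
  have pWb : W ^ b ≤ (W ^ 3) ^ d := pow_le_cube hW hbm
  have pV : V ^ (a + b) ≤ (V ^ 3) ^ d := pow_le_cube hV hm2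
  have o12 : (1:ℝ) ≤ (12 ^ 3) ^ d := Real.one_le_rpow (by norm_num) (by linarith)
  have oW : (1:ℝ) ≤ (W ^ 3) ^ d := Real.one_le_rpow (one_le_pow₀ hW) (by linarith)
  have oV : (1:ℝ) ≤ (V ^ 3) ^ d := Real.one_le_rpow (one_le_pow₀ hV) (by linarith)
  have hBd : 0 < B ^ d := by positivity
  set T : ℝ := (12 ^ 3) ^ d * (W ^ 3) ^ d * (V ^ 3) ^ d * B ^ d * ρ ^ (α * d / 4) with hT
  have hT0 : 0 < T := by positivity
  have inv_e : ∀ k : ℕ, (ρ / W)⁻¹ ^ k = W ^ k * ρ ^ (-(k:ℝ)) := by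
    intro k
    rw [inv_div, div_pow, Real.rpow_neg hρ.le, Real.rpow_natCast]; rfl
  have ex : ∀ u : ℝ, α * d / 4 ≤ u → ρ ^ u ≤ ρ ^ (α * d / 4) := fun u hu =>
    Real.rpow_le_rpow_of_exponent_ge hρ hρ1 hu
  have t1 : 12 ^ (a + b) * ((B * ρ ^ α) ^ d * (ρ / W)⁻¹ ^ a) ≤ T := by
    have h1 : ρ ^ (α * d) * ρ ^ (-(a:ℝ)) ≤ ρ ^ (α * d / 4) := by
      rw [← Real.rpow_add hρ]; apply ex; linarith
    rw [inv_e, Real.mul_rpow (by positivity) (by positivity), ← Real.rpow_mul hρ.le]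
    calc 12 ^ (a + b) * (B ^ d * ρ ^ (α * d) * (W ^ a * ρ ^ (-(a:ℝ))))
        = 12 ^ (a + b) * W ^ a * 1 * B ^ d * (ρ ^ (α * d) * ρ ^ (-(a:ℝ))) := by ring
      _ ≤ T := by rw [hT]; gcongr
  have t2 : 12 ^ (a + b) * ((B * ρ ^ (1 - α / 8)) ^ d * (ρ / W)⁻¹ ^ b) ≤ T := by
    have h1 : ρ ^ ((1 - α / 8) * d) * ρ ^ (-(b:ℝ)) ≤ ρ ^ (α * d / 4) := by
      rw [← Real.rpow_add hρ]; apply ex; linarith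
    rw [inv_e, Real.mul_rpow (by positivity) (by positivity), ← Real.rpow_mul hρ.le]
    calc 12 ^ (a + b) * (B ^ d * ρ ^ ((1 - α / 8) * d) * (W ^ b * ρ ^ (-(b:ℝ))))
        = 12 ^ (a + b) * W ^ b * 1 * B ^ d * (ρ ^ ((1 - α / 8) * d) * ρ ^ (-(b:ℝ))) := by ring
      _ ≤ T := by rw [hT]; gcongr
  have t3 : (V * ρ) ^ (a + b) * (B * ρ⁻¹) ^ d ≤ T := by
    have h1 : ρ ^ (((a + b : ℕ)) : ℝ) * ρ ^ (-d) ≤ ρ ^ (α * d / 4) := by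
      rw [← Real.rpow_add hρ]; apply ex; linarith
    rw [Real.mul_rpow (by positivity) (by positivity), Real.inv_rpow hρ.le, ← Real.rpow_neg hρ.le, mul_pow,
      ← Real.rpow_natCast ρ]
    calc V ^ (a + b) * ρ ^ (((a + b : ℕ)) : ℝ) * (B ^ d * ρ ^ (-d))
        = 1 * 1 * V ^ (a + b) * B ^ d * (ρ ^ (((a + b : ℕ)) : ℝ) * ρ ^ (-d)) := by ring
      _ ≤ T := by rw [hT]; gcongr
  have e3 : (3:ℝ) ≤ 3 ^ d := by
    calc (3:ℝ) = 3 ^ (1:ℝ) := by norm_num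
      _ ≤ _ := Real.rpow_le_rpow_of_exponent_le (by norm_num) hd1
  have eT : (3 * 12 ^ 3 * W ^ 3 * V ^ 3 * B * ρ ^ (α / 4)) ^ d = 3 ^ d * T := by
    rw [Real.mul_rpow (by positivity) (by positivity), Real.mul_rpow (by positivity) (by positivity),
      Real.mul_rpow (by positivity) (by positivity), Real.mul_rpow (by positivity) (by positivity),
      Real.mul_rpow (by positivity) (by positivity), ← Real.rpow_mul hρ.le, hT,
      show α / 4 * d = α * d / 4 by ring]
    ring
  rw [eT, mul_add]
  nlinarith

set_option maxHeartbeats 1000000 in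
theorem join_step {f : EE n → ℝ} (hf : Sm f) (hn : 2 ≤ n) {α d ρ B w s μ : ℝ} (hα : 0 < α) (hα1 : α ≤ 1 / 2)
    (hd : 16 ≤ α * d) (hρ : 0 < ρ) (hρ1 : ρ ≤ 1 / (8 * n)) (hB : 1 ≤ B) (hw : 1 ≤ w) (hs : 0 < s) (hμ : 0 ≤ μ)
    {p x : EE n} (hpx : ‖x - p‖ ≤ n * s)
    (hA : ∀ ξ : EE n, ‖ξ‖ < ρ * s / w → |f (p + ξ)| ≤ μ * (B * ρ ^ α) ^ d)
    (hX : ∀ ξ : EE n, ‖ξ‖ < ρ * s / w → |f (x + ξ)| ≤ μ * (B * ρ ^ (1 - α / 8)) ^ d)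
    (hM : ∀ z ∈ ball p (s / (2 * ρ)), |f z| ≤ μ * (B * ρ⁻¹) ^ d)
    (hh : ∀ z ∈ ball p (s / (2 * ρ)), lap f z = 0) {ξ : EE n} (hξ : ‖ξ‖ < ρ * s / (2 * w)) {t : ℝ}
    (ht : t ∈ Icc (0:ℝ) 1) :
    |f (p + ξ + t • (x - p))| ≤ μ * (3 * 12 ^ 3 * (2 * n * w) ^ 3 * (12 * Cg n * n) ^ 3 * B * ρ ^ (α / 4)) ^ d := by
  have hn2 : (2:ℝ) ≤ n := by exact_mod_cast hn
  have hC := Cg_ge (n := n)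
  have hd0 : 0 < d := by
    by_contra h
    nlinarith
  have hd1 : 1 ≤ d := by nlinarith
  have hρn : ρ * (8 * n) ≤ 1 := by rwa [le_div_iff₀ (by positivity)] at hρ1
  have hρ1' : ρ ≤ 1 := by nlinarith
  set a := ⌊3 / 4 * α * d⌋₊ with ha
  set m := ⌈(1 + α / 4) * d⌉₊ with hm
  have ha1 : (a:ℝ) ≤ 3 / 4 * α * d := Nat.floor_le (by positivity)
  have ha2 : 3 / 4 * α * d < a + 1 := Nat.lt_floor_add_one _
  have hm1 : (1 + α / 4) * d ≤ m := Nat.le_ceil _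
  have hm2 : (m:ℝ) < (1 + α / 4) * d + 1 := Nat.ceil_lt_add_one (by positivity)
  have ha0 : 0 < a := by
    have : (0:ℝ) < a := by linarith
    exact_mod_cast this
  have ham : a < m := by
    have : (a:ℝ) < m := by nlinarith
    exact_mod_cast this
  obtain ⟨b, hb⟩ := Nat.exists_eq_add_of_lt ham
  have hb' : m = a + (b + 1) := by omega
  set b' := b + 1 with hb'd
  have hbr : (m:ℝ) = a + b' := by exact_mod_cast hb'
  set v := x - p with hv
  set τ := ρ / (2 * n * w) with hτ
  have hτ0 : 0 < τ := by positivity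
  have hτ1 : τ ≤ 1 / 4 := by
    rw [hτ, div_le_iff₀ (by positivity)]
    nlinarith
  have hτs : τ * (n * s) = ρ * s / (2 * w) := by rw [hτ]; field_simp
  have htau : ∀ t : ℝ, 0 ≤ t → t ≤ τ → ‖t • v‖ ≤ ρ * s / (2 * w) := by
    intro t h0 h1
    rw [norm_smul, Real.norm_eq_abs, abs_of_nonneg h0, ← hτs]
    gcongr
  have hhalf : ρ * s / (2 * w) + ρ * s / (2 * w) = ρ * s / w := by field_simp; norm_num
  set ρ' := s / (4 * ρ * m) with hρ'
  have hm0 : (0:ℝ) < m := by linarith [hm1, show 0 < (1 + α / 4) * d by positivity]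
  have hρ'0 : 0 < ρ' := by positivity
  have hmρ : m * ρ' = s / (4 * ρ) := by rw [hρ']; field_simp
  have key := interp2 ha0 (show 0 < b' by omega) hτ0 hτ1 (fun i t => (pd v)^[i] f (p + ξ + t • v))
    (fun i t => by
      have h := hasDerivAt_ray (iter_pd_sm hf v i) (p + ξ) v (hasDerivAt_id t)
      rw [one_mul] at h
      rw [Function.iterate_succ_apply']
      exact h)
    (A := μ * (B * ρ ^ α) ^ d) (B := μ * (B * ρ ^ (1 - α / 8)) ^ d)
    (D := (Cg n * ‖v‖ / ρ') ^ m * (μ * (B * ρ⁻¹) ^ d))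
    (by
      intro t ht
      simp only [Function.iterate_zero, id]
      rw [add_assoc]
      apply hA
      refine (norm_add_le _ _).trans_lt ?_
      linarith [htau t ht.1 ht.2])
    (by
      intro t ht
      simp only [Function.iterate_zero, id]
      have : p + ξ + t • v = x + (ξ - (1 - t) • v) := by rw [hv]; module
      rw [this]
      apply hX
      refine (norm_sub_le _ _).trans_lt ?_
      linarith [htau (1 - t) (by linarith [ht.2]) (by linarith [ht.1])])
    (by
      intro t ht
      rw [← hb']
      have hsub : closedBall (p + ξ + t • v) (m * ρ') ⊆ ball p (s / (2 * ρ)) := by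
        apply closedBall_subset_ball'
        rw [hmρ, dist_eq_norm, show p + ξ + t • v - p = ξ + t • v by abel]
        have h1 : ‖t • v‖ ≤ n * s := by
          rw [norm_smul, Real.norm_eq_abs, abs_of_nonneg ht.1]
          calc t * ‖v‖ ≤ 1 * (n * s) := by gcongr; exact ht.2
            _ = _ := one_mul _
        have h2 := norm_add_le ξ (t • v)
        have h3 : ρ * s / (2 * w) ≤ s := by
          rw [div_le_iff₀ (by positivity)]; nlinarith
        have h4 : 2 * n * s ≤ s / (4 * ρ) := by
          rw [le_div_iff₀ (by positivity)]; nlinarith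
        have h5 : s / (2 * ρ) = s / (4 * ρ) + s / (4 * ρ) := by field_simp; norm_num
        nlinarith
      exact iter_grad_est v hρ'0 m hf _ (fun z hz => hh z (hsub (ball_subset_closedBall hz)))
        (fun z hz => hM z (hsub hz))) ht
  simp only [Function.iterate_zero, id] at key
  refine key.trans ?_
  have hV1 : 1 ≤ 12 * Cg n * n := by nlinarith
  have hnum := join_num (B := B) (W := 2 * n * w) (V := 12 * Cg n * n) hα1 hd hd1 hρ hρ1' hB (by nlinarith) hV1
    (b := b') ha1 (by linarith) (by rw [← hb']; exact hm1) (by rw [← hb']; nlinarith)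
  rw [← hτ] at hnum
  have hfac : (Cg n * ‖v‖ / ρ') ^ m / m.factorial ≤ (12 * Cg n * n * ρ) ^ m := by
    have e1 : Cg n * ‖v‖ / ρ' ≤ 4 * Cg n * n * ρ * m := by
      rw [hρ', div_le_iff₀ (by positivity)]
      calc Cg n * ‖v‖ ≤ Cg n * (n * s) := by gcongr
        _ = _ := by field_simp
    have e2 := Real.pow_div_factorial_le_exp m (by positivity) m
    have e3 : Real.exp m ≤ 3 ^ m := by
      have : Real.exp (m:ℝ) = Real.exp 1 ^ m := by rw [← Real.exp_nat_mul, mul_one]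
      rw [this]
      gcongr
      linarith [Real.exp_one_lt_d9]
    calc _ ≤ (4 * Cg n * n * ρ * m) ^ m / m.factorial := by gcongr
      _ = (4 * Cg n * n * ρ) ^ m * ((m:ℝ) ^ m / m.factorial) := by rw [mul_pow]; ring
      _ ≤ (4 * Cg n * n * ρ) ^ m * 3 ^ m := by gcongr; exact e2.trans e3
      _ = _ := by rw [← mul_pow]; ring
  calc 12 ^ (a + b') * (μ * (B * ρ ^ α) ^ d * τ⁻¹ ^ a + μ * (B * ρ ^ (1 - α / 8)) ^ d * τ⁻¹ ^ b') +
        (Cg n * ‖v‖ / ρ') ^ m * (μ * (B * ρ⁻¹) ^ d) / (a + b').factorial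
      = μ * (12 ^ (a + b') * ((B * ρ ^ α) ^ d * τ⁻¹ ^ a + (B * ρ ^ (1 - α / 8)) ^ d * τ⁻¹ ^ b') +
        ((Cg n * ‖v‖ / ρ') ^ m / m.factorial) * (B * ρ⁻¹) ^ d) := by rw [← hb']; ring
    _ ≤ μ * (12 ^ (a + b') * ((B * ρ ^ α) ^ d * τ⁻¹ ^ a + (B * ρ ^ (1 - α / 8)) ^ d * τ⁻¹ ^ b') +
        (12 * Cg n * n * ρ) ^ (a + b') * (B * ρ⁻¹) ^ d) := by
          rw [← hb']
          gcongr
    _ ≤ _ := by gcongr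

end


section
variable {n : ℕ}

/-- epsilon -/
noncomputable def epn (n : ℕ) : ℝ := 1 / (32 * 4 ^ n)
/-- exponents -/
noncomputable def aln (j : ℕ) : ℝ := 1 / (2 * 4 ^ j)
/-- constants -/
noncomputable def Bs (n : ℕ) : ℕ → ℝ
  | 0 => 2 ^ (n + 2) * (4 * (20 * n) ^ 2) * (10 * n)
  | (j + 1) => 3 * 12 ^ 3 * (2 * n * 2 ^ j) ^ 3 * (12 * Cg n * n) ^ 3 * Bs n j

theorem Bs_mono (hn : 2 ≤ n) (j : ℕ) : Bs n 0 ≤ Bs n j ∧ 1 ≤ Bs n j := by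
  have hn2 : (2:ℝ) ≤ n := by exact_mod_cast hn
  have hC := Cg_ge (n := n)
  have h0 : 1 ≤ Bs n 0 := by
    unfold Bs
    have : (1:ℝ) ≤ 2 ^ (n + 2) := one_le_pow₀ (by norm_num)
    have h2 : (1:ℝ) ≤ 4 * (20 * n) ^ 2 := by nlinarith
    have h3 : (1:ℝ) ≤ 10 * n := by linarith
    calc (1:ℝ) = 1 * 1 * 1 := by norm_num
      _ ≤ _ := by gcongr
  have hs : ∀ j, 1 ≤ Bs n j → Bs n j ≤ Bs n (j + 1) := by
    intro j hj
    have h1 : (1:ℝ) ≤ 2 ^ j := one_le_pow₀ (by norm_num)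
    have h2 : (1:ℝ) ≤ (2 * n * 2 ^ j) ^ 3 := one_le_pow₀ (by nlinarith)
    have h3 : (1:ℝ) ≤ (12 * Cg n * n) ^ 3 := one_le_pow₀ (by nlinarith)
    have h4 : (1:ℝ) ≤ 3 * 12 ^ 3 := by norm_num
    calc Bs n j = 1 * 1 * 1 * Bs n j := by ring
      _ ≤ 3 * 12 ^ 3 * (2 * n * 2 ^ j) ^ 3 * (12 * Cg n * n) ^ 3 * Bs n j := by gcongr
      _ = Bs n (j + 1) := rfl
  induction j with
  | zero => exact ⟨le_rfl, h0⟩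
  | succ j ih => exact ⟨ih.1.trans (hs j ih.2), ih.2.trans (hs j ih.2)⟩

theorem aln_le {j k : ℕ} (h : j ≤ k) : aln k ≤ aln j := by
  unfold aln
  gcongr
  norm_num

theorem aln_pos (j : ℕ) : 0 < aln j := by unfold aln; positivity

/-- configuration of bad points -/
structure Cfg (F : Fin n → EE n → ℝ) (N ρ s : ℝ) (S : Finset (EE n)) (y : EE n) : Prop where
  st : Stg F
  N0 : 0 ≤ N
  db : Dbl F N
  NK : Real.log (K1 n (epn n)) ≤ epn n * N
  d0 : 16 ≤ aln n * dd n N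
  ρ0 : 0 < ρ
  ρ1 : ρ ≤ 1 / (8 * n)
  s0 : 0 < s
  s1 : s ≤ ρ
  cu : ∀ x ∈ S, x ∈ cube (0 : EE n) 1
  bad : ∀ x ∈ S, ∃ r, 0 < r ∧ r ≤ ρ * s ∧ BadAt F N (epn n / 4) x r
  ds : ∀ x ∈ S, ∀ z ∈ S, dist x z ≤ n * s
  card : S.card ≤ n
  yS : y ∈ convexHull ℝ (S : Set (EE n))

theorem convex_cube : Convex ℝ (cube (0 : EE n) 1) := by
  intro x hx z hz a b ha hb hab i
  have h1 := hx i
  have h2 := hz i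
  simp only [PiLp.zero_apply, sub_zero, PiLp.add_apply, PiLp.smul_apply, smul_eq_mul] at *
  calc |a * x i + b * z i| ≤ |a * x i| + |b * z i| := abs_add_le _ _
    _ = a * |x i| + b * |z i| := by rw [abs_mul, abs_mul, abs_of_nonneg ha, abs_of_nonneg hb]
    _ ≤ a * (1 / 2) + b * (1 / 2) := by gcongr
    _ = _ := by rw [← add_mul, hab, one_mul]

variable {F : Fin n → EE n → ℝ} {N ρ s : ℝ} {S : Finset (EE n)} {y : EE n}

theorem exp_N (hn : 2 ≤ n) (N : ℝ) : Real.exp N = (10 * n : ℝ) ^ dd n N := by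
  have hn2 : (2:ℝ) ≤ n := by exact_mod_cast hn
  have := log10n hn
  rw [Real.rpow_def_of_pos (by positivity), dd, mul_div_cancel₀]
  linarith

theorem Cfg.yc (h : Cfg F N ρ s S y) : y ∈ cube (0 : EE n) 1 :=
  convexHull_min (s := (S : Set (EE n))) (fun x hx => h.cu x hx) convex_cube h.yS

theorem Cfg.hull_dist (h : Cfg F N ρ s S y) {p q : EE n} (hp : p ∈ convexHull ℝ (S : Set (EE n)))
    (hq : q ∈ convexHull ℝ (S : Set (EE n))) : dist p q ≤ n * s := by
  have h1 : ∀ x ∈ S, convexHull ℝ (S : Set (EE n)) ⊆ closedBall x (n * s) := fun x hx =>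
    convexHull_min (fun z hz => h.ds z hz x hx) (convex_closedBall _ _)
  have h2 : convexHull ℝ (S : Set (EE n)) ⊆ closedBall q (n * s) :=
    convexHull_min (fun z hz => by rw [mem_closedBall, dist_comm]; exact h1 z hz hq) (convex_closedBall _ _)
  exact h2 hp

theorem Cfg.d1 (h : Cfg F N ρ s S y) : 1 ≤ dd n N := by
  have h1 := h.d0
  have h2 : aln n ≤ 1 / 2 := by have := aln_le (Nat.zero_le n); simpa [aln] using this
  have h3 := aln_pos n
  have : 0 ≤ dd n N := by
    have := log10n h.st.n2; unfold dd; exact div_nonneg h.N0 (by linarith)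
  nlinarith

theorem Cfg.rn (h : Cfg F N ρ s S y) : ρ * (8 * n) ≤ 1 := by
  have := h.ρ1
  have hn := h.st.n2'
  rwa [le_div_iff₀ (by positivity)] at this

theorem Cfg.hM (h : Cfg F N ρ s S y) : sg F y (s / ρ) ≤ sg F y s * (10 * n * ρ⁻¹) ^ dd n N := by
  have hn := h.st.n2'
  have h1 := h.ρ0
  have h2 := h.s0
  have h3 := h.rn
  have h4 := dbl_pow h.st.n2 h.st.sm h.N0 h.db h.yc h.s0 (R := s / ρ)
    (by rw [le_div_iff₀ h1]; nlinarith) (by rw [div_le_iff₀ h1]; nlinarith [h.s1])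
  rw [exp_N h.st.n2, show s / ρ / s = ρ⁻¹ by field_simp] at h4
  rw [Real.mul_rpow (by positivity) (by positivity), mul_comm]
  exact h4

theorem Cfg.hX (h : Cfg F N ρ s S y) {x : EE n} (hx : x ∈ S) :
    sg F x (ρ * s) ≤ sg F y s * (Bs n 0 * ρ ^ (1 - 2 * epn n)) ^ dd n N := by
  have hn := h.st.n2'
  have h1 := h.ρ0
  have h2 := h.s0
  have h3 := h.rn
  have hd := h.d1
  have hμ := sg_nonneg F y s
  have he0 : 0 < epn n := by unfold epn; positivity
  have he1 : epn n ≤ 1 / 32 := by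
    unfold epn
    gcongr
    have : (1:ℝ) ≤ 4 ^ n := one_le_pow₀ (by norm_num)
    linarith
  obtain ⟨r, r0, r1, hr⟩ := h.bad x hx
  have hsρ : s / (2 * ρ) ≤ 1 := by rw [div_le_iff₀ (by positivity)]; linarith [h.s1]
  have hc := bad_decay h.st he0 (by linarith) h.N0 h.NK (h.cu x hx) (ρ := ρ * s) (R := s / (2 * ρ)) r0 r1
    (by rw [le_div_iff₀ (by positivity)]; nlinarith [mul_pos h1 h2, mul_pos (mul_pos h1 h2) h1]) hsρ hr
  have hsub : sg F x (s / (2 * ρ)) ≤ sg F y (s / ρ) := by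
    apply h.st.sm.sg_mono
    apply ball_subset_ball'
    have := h.hull_dist (subset_convexHull ℝ _ hx) h.yS
    have h4 : n * s ≤ s / (2 * ρ) := by
      rw [le_div_iff₀ (by positivity)]; nlinarith
    have h5 : s / ρ = s / (2 * ρ) + s / (2 * ρ) := by field_simp; norm_num
    linarith
  have hL0 : 0 < Lam n (epn n) := by unfold Lam; positivity
  have hLn : Lam n (epn n) ≤ 20 * n := by unfold Lam; nlinarith
  set d := dd n N with hdd
  have e1 : (2 * Lam n (epn n) ^ 2 * (ρ * s) / (s / (2 * ρ))) = (4 * Lam n (epn n) ^ 2) * ρ ^ 2 := by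
    field_simp; ring
  have e2 : ((4 * Lam n (epn n) ^ 2) * ρ ^ 2) ^ ((1 - epn n) * d) ≤ (4 * (20 * n) ^ 2) ^ d * ρ ^ (2 * (1 - epn n) * d) := by
    rw [Real.mul_rpow (by positivity) (by positivity)]
    have a1 : (4 * Lam n (epn n) ^ 2) ^ ((1 - epn n) * d) ≤ (4 * (20 * n) ^ 2) ^ d := by
      calc _ ≤ (4 * (20 * n : ℝ) ^ 2) ^ ((1 - epn n) * d) := by
            apply Real.rpow_le_rpow (by positivity) (by gcongr)
            apply mul_nonneg <;> linarith
        _ ≤ _ := Real.rpow_le_rpow_of_exponent_le (by nlinarith) (by nlinarith)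
    have a2 : (ρ ^ 2) ^ ((1 - epn n) * d) = ρ ^ (2 * (1 - epn n) * d) := by
      rw [← Real.rpow_natCast ρ 2, ← Real.rpow_mul h1.le]; push_cast; ring_nf
    rw [a2]; gcongr
  have e3 : (2:ℝ) ^ (n + 2) ≤ (2 ^ (n + 2)) ^ d := by
    calc (2:ℝ) ^ (n + 2) = (2 ^ (n + 2)) ^ (1:ℝ) := by rw [Real.rpow_one]
      _ ≤ _ := Real.rpow_le_rpow_of_exponent_le (one_le_pow₀ (by norm_num)) hd
  rw [e1] at hc
  have e4 : (10 * n * ρ⁻¹) ^ d = (10 * n) ^ d * ρ ^ (-d) := by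
    rw [Real.mul_rpow (by positivity) (by positivity), Real.inv_rpow h1.le, ← Real.rpow_neg h1.le]
  have e5 : ρ ^ (2 * (1 - epn n) * d) * ρ ^ (-d) = (ρ ^ (1 - 2 * epn n)) ^ d := by
    rw [← Real.rpow_add h1, ← Real.rpow_mul h1.le]; ring_nf
  calc _ ≤ _ := hc
    _ ≤ (2 ^ (n + 2)) ^ d * ((4 * (20 * n) ^ 2) ^ d * ρ ^ (2 * (1 - epn n) * d)) * (sg F y s * (10 * n * ρ⁻¹) ^ d) := by
      have := hsub.trans h.hM
      have := sg_nonneg F x (s / (2 * ρ))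
      gcongr
    _ = sg F y s * ((2 ^ (n + 2)) ^ d * (4 * (20 * n) ^ 2) ^ d * (10 * n) ^ d * (ρ ^ (2 * (1 - epn n) * d) * ρ ^ (-d))) := by
      rw [e4]; ring
    _ = _ := by
      rw [e5, ← Real.mul_rpow (by positivity) (by positivity), ← Real.mul_rpow (by positivity) (by positivity),
        ← Real.mul_rpow (by positivity) (by positivity)]
      rfl

theorem Cfg.tube (h : Cfg F N ρ s S y) (k : Fin n) : ∀ T : Finset (EE n), T ⊆ S → T.Nonempty →
    ∀ p ∈ convexHull ℝ (T : Set (EE n)), ∀ ξ : EE n, ‖ξ‖ < ρ * s / 2 ^ T.card →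
      |F k (p + ξ)| ≤ sg F y s * (Bs n T.card * ρ ^ aln T.card) ^ dd n N := by
  have hn := h.st.n2'
  have hρ := h.ρ0
  have hs := h.s0
  have h3 := h.rn
  have hd := h.d1
  have hμ := sg_nonneg F y s
  have hρ1 : ρ ≤ 1 := by nlinarith
  have hXb : ∀ x ∈ S, ∀ j, ∀ α : ℝ, α ≤ 1 - 2 * epn n → ∀ w : ℝ, 1 ≤ w → ∀ ξ : EE n, ‖ξ‖ < ρ * s / w →
      |F k (x + ξ)| ≤ sg F y s * (Bs n j * ρ ^ α) ^ dd n N := by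
    intro x hx j α hα w hw ξ hξ
    have h1 : x + ξ ∈ ball x (ρ * s) := by
      rw [mem_ball, dist_eq_norm, add_sub_cancel_left]
      refine hξ.trans_le (div_le_self (by positivity) hw)
    refine (h.st.sm.abs_le_sg h1 k).trans ((h.hX hx).trans ?_)
    have hb0 := (Bs_mono h.st.n2 0).2
    have hbj := (Bs_mono h.st.n2 j).1
    have hbj0 : 0 ≤ Bs n j := by linarith
    have : ρ ^ (1 - 2 * epn n) ≤ ρ ^ α := Real.rpow_le_rpow_of_exponent_ge hρ hρ1 hα
    gcongr
  classical
  intro T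
  induction T using Finset.induction_on with
  | empty => intro _ h; simp at h
  | insert x T hxT ih =>
    intro hTS _ p hp ξ hξ
    have hxS : x ∈ S := hTS (Finset.mem_insert_self x T)
    have hTS' : T ⊆ S := (Finset.subset_insert x T).trans hTS
    have hcard : (insert x T).card = T.card + 1 := Finset.card_insert_of_notMem hxT
    have hle : T.card + 1 ≤ n := by rw [← hcard]; exact (Finset.card_le_card hTS).trans h.card
    have hep : 2 * epn n ≤ 1 / 16 := by
      unfold epn
      rw [mul_one_div, div_le_div_iff₀ (by positivity) (by norm_num)]
      have : (1:ℝ) ≤ 4 ^ n := one_le_pow₀ (by norm_num)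
      linarith
    rcases T.eq_empty_or_nonempty with rfl | hne
    · simp at hp
      subst hp
      refine hXb _ hxS _ _ ?_ (2 ^ (insert p (∅ : Finset (EE n))).card) (one_le_pow₀ (by norm_num)) _ hξ
      have : aln (insert p (∅ : Finset (EE n))).card ≤ 1 / 2 := by
        have := aln_le (Nat.zero_le (insert p (∅ : Finset (EE n))).card); simpa [aln] using this
      linarith
    · rw [Finset.coe_insert, convexHull_insert (by simpa using hne), mem_convexJoin] at hp
      obtain ⟨x', hx', q, hq, hpq⟩ := hp
      rw [mem_singleton_iff] at hx'
      subst hx'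
      rw [segment_symm, segment_eq_image'] at hpq
      obtain ⟨t, ht, rfl⟩ := hpq
      have hqS : q ∈ convexHull ℝ (S : Set (EE n)) := convexHull_mono (by exact_mod_cast hTS') hq
      have hxSh : x' ∈ convexHull ℝ (S : Set (EE n)) := subset_convexHull ℝ _ hxS
      rw [hcard] at hξ ⊢
      have hal : aln T.card ≤ 1 / 2 := by
        have := aln_le (Nat.zero_le T.card); simpa [aln] using this
      have hsub : ball q (s / (2 * ρ)) ⊆ ball y (s / ρ) := by
        apply ball_subset_ball'
        have := h.hull_dist hqS h.yS
        have h4 : n * s ≤ s / (2 * ρ) := by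
          rw [le_div_iff₀ (by positivity)]; nlinarith
        have h5 : s / ρ = s / (2 * ρ) + s / (2 * ρ) := by field_simp; norm_num
        linarith
      have hBj := Bs_mono h.st.n2 T.card
      have := join_step (h.st.sm k) h.st.n2 (α := aln T.card) (d := dd n N) (B := Bs n T.card) (w := 2 ^ T.card)
        (aln_pos _) hal (h.d0.trans (by have := aln_le (show T.card ≤ n by omega); gcongr)) hρ h.ρ1
        hBj.2 (one_le_pow₀ (by norm_num)) hs hμ (p := q) (x := x')
        (by rw [← dist_eq_norm]; exact h.hull_dist hxSh hqS)
        (ih hTS' hne q hq)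
        (hXb x' hxS T.card _ (by
          have : 2 * epn n ≤ aln T.card / 8 := by
            have h1 := aln_le (show T.card ≤ n by omega)
            have : 2 * epn n = aln n / 8 := by unfold epn aln; field_simp; norm_num
            linarith
          linarith) _ (one_le_pow₀ (by norm_num)))
        (fun z hz => ((h.st.sm.abs_le_sg (hsub hz) k).trans h.hM).trans (by
          have h0 : 10 * n ≤ Bs n 0 := by
            unfold Bs
            have h1 : (1:ℝ) ≤ 2 ^ (n + 2) := one_le_pow₀ (by norm_num)
            have h2 : (1:ℝ) ≤ 4 * (20 * n) ^ 2 := by nlinarith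
            calc (10 * n : ℝ) = 1 * 1 * (10 * n) := by ring
              _ ≤ _ := by gcongr
          have := h0.trans hBj.1
          gcongr))
        (fun z hz => h.st.hfb h.yc (R := s / ρ) (by
          rw [div_le_iff₀ hρ]; nlinarith [h.s1]) k z (hsub hz))
        (ξ := ξ) (by rw [pow_succ] at hξ; rwa [mul_comm 2]) ht
      have e : aln T.card / 4 = aln (T.card + 1) := by unfold aln; rw [pow_succ]; field_simp
      rw [e] at this
      rw [show q + t • (x' - q) + ξ = q + ξ + t • (x' - q) by abel]
      exact this

end


section
variable {n : ℕ}

/-- smooth step -/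
noncomputable def TT : ℝ → ℝ := Real.smoothTransition

theorem TT_smooth : ContDiff ℝ (⊤ : ℕ∞) TT := Real.smoothTransition.contDiff

theorem TT1_smooth : ContDiff ℝ (⊤ : ℕ∞) (deriv TT) := by
  have h : ContDiff ℝ ((⊤ : ℕ∞) + 1) TT := TT_smooth
  exact (contDiff_succ_iff_deriv.1 h).2.2

theorem TT2_smooth : ContDiff ℝ (⊤ : ℕ∞) (deriv (deriv TT)) := by
  have h : ContDiff ℝ ((⊤ : ℕ∞) + 1) (deriv TT) := TT1_smooth
  exact (contDiff_succ_iff_deriv.1 h).2.2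

theorem TT_out {t : ℝ} (ht : t ∉ Icc (0:ℝ) 1) : deriv TT t = 0 ∧ deriv (deriv TT) t = 0 := by
  have h : ∃ c : ℝ, TT =ᶠ[nhds t] fun _ => c := by
    rw [mem_Icc, not_and_or, not_le, not_le] at ht
    rcases ht with ht | ht
    · refine ⟨0, ?_⟩
      filter_upwards [Iio_mem_nhds ht] with x hx
      exact Real.smoothTransition.zero_of_nonpos (le_of_lt hx)
    · refine ⟨1, ?_⟩
      filter_upwards [Ioi_mem_nhds ht] with x hx
      exact Real.smoothTransition.one_of_one_le (le_of_lt hx)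
  obtain ⟨c, hc⟩ := h
  have h1 : deriv TT =ᶠ[nhds t] deriv (fun _ => c) := hc.deriv
  have h2 := h1.deriv
  constructor
  · rw [h1.eq_of_nhds]; simp
  · rw [h2.eq_of_nhds]; simp

theorem TT_bound : ∃ C : ℝ, 1 ≤ C ∧ ∀ t, |deriv TT t| ≤ C ∧ |deriv (deriv TT) t| ≤ C := by
  obtain ⟨C1, h1⟩ := isCompact_Icc.exists_bound_of_continuousOn (s := Icc (0:ℝ) 1) TT1_smooth.continuous.continuousOn
  obtain ⟨C2, h2⟩ := isCompact_Icc.exists_bound_of_continuousOn (s := Icc (0:ℝ) 1) TT2_smooth.continuous.continuousOn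
  refine ⟨max 1 (max C1 C2), le_max_left _ _, fun t => ?_⟩
  by_cases ht : t ∈ Icc (0:ℝ) 1
  · exact ⟨(h1 t ht).trans ((le_max_left _ _).trans (le_max_right _ _)),
      (h2 t ht).trans ((le_max_right _ _).trans (le_max_right _ _))⟩
  · rw [(TT_out ht).1, (TT_out ht).2]
    simp

theorem Sm_cut {T : ℝ → ℝ} (hT : ContDiff ℝ (⊤ : ℕ∞) T) (c : ℝ) (y ν : EE n) :
    Sm (fun z : EE n => T (c * ⟪ν, z - y⟫)) :=
  hT.comp (contDiff_const.mul (contDiff_const.inner ℝ (contDiff_id.sub contDiff_const)))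

theorem pd_cut {T : ℝ → ℝ} (hT : ContDiff ℝ (⊤ : ℕ∞) T) (c : ℝ) (y ν v : EE n) {f : EE n → ℝ} (hf : Sm f) (z : EE n) :
    pd v (fun z => T (c * ⟪ν, z - y⟫) * f z) z =
      T (c * ⟪ν, z - y⟫) * pd v f z + c * ⟪ν, v⟫ * (deriv T (c * ⟪ν, z - y⟫) * f z) := by
  have h0 : HasFDerivAt (fun z : EE n => c * ⟪ν, z - y⟫) (c • innerSL ℝ ν) z := by
    have h1 : HasFDerivAt (fun z : EE n => innerSL ℝ ν (z - y)) (innerSL ℝ ν) z := by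
      exact ((innerSL ℝ ν).hasFDerivAt).comp z ((hasFDerivAt_id z).sub_const y)
    exact h1.const_mul c
  have h1 := ((hT.differentiable (by simp)) (c * ⟪ν, z - y⟫)).hasDerivAt.comp_hasFDerivAt z h0
  have h2 := h1.mul (hf.diff z).hasFDerivAt
  unfold pd
  have h3 := h2.fderiv
  have h4 : fderiv ℝ (fun z => T (c * ⟪ν, z - y⟫) * f z) z v = _ := congrArg (fun L => L v) h3
  rw [h4]
  simp
  ring

theorem lap_cut (c : ℝ) (y : EE n) {ν : EE n} (hν : ‖ν‖ = 1) {f : EE n → ℝ} (hf : Sm f) (z : EE n) :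
    lap (fun z => TT (c * ⟪ν, z - y⟫) * f z) z = TT (c * ⟪ν, z - y⟫) * lap f z
      + 2 * c * deriv TT (c * ⟪ν, z - y⟫) * pd ν f z + c ^ 2 * deriv (deriv TT) (c * ⟪ν, z - y⟫) * f z := by
  set e : Fin n → EE n := fun i => EuclideanSpace.single i 1 with he
  have hin : ∀ i, ⟪ν, e i⟫ = ν i := by intro i; rw [he, EuclideanSpace.inner_single_right]; simp
  have hi : ∀ i, pd (e i) (pd (e i) (fun z => TT (c * ⟪ν, z - y⟫) * f z)) z =
      TT (c * ⟪ν, z - y⟫) * pd (e i) (pd (e i) f) z + 2 * c * deriv TT (c * ⟪ν, z - y⟫) * (ν i * pd (e i) f z)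
      + c ^ 2 * deriv (deriv TT) (c * ⟪ν, z - y⟫) * f z * ν i ^ 2 := by
    intro i
    have h1 : pd (e i) (fun z => TT (c * ⟪ν, z - y⟫) * f z) = fun z =>
        TT (c * ⟪ν, z - y⟫) * pd (e i) f z + c * ⟪ν, e i⟫ * (deriv TT (c * ⟪ν, z - y⟫) * f z) :=
      funext fun z => pd_cut TT_smooth c y ν (e i) hf z
    have s1 : Sm (fun z => TT (c * ⟪ν, z - y⟫) * pd (e i) f z) := (Sm_cut TT_smooth c y ν).mul (hf.pd _)
    have s2 : Sm (fun z => (deriv TT (c * ⟪ν, z - y⟫) * f z)) := (Sm_cut TT1_smooth c y ν).mul hf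
    have h2 : pd (e i) (fun z => TT (c * ⟪ν, z - y⟫) * pd (e i) f z + c * ⟪ν, e i⟫ * (deriv TT (c * ⟪ν, z - y⟫) * f z)) z
        = pd (e i) (fun z => TT (c * ⟪ν, z - y⟫) * pd (e i) f z) z +
          c * ⟪ν, e i⟫ * pd (e i) (fun z => (deriv TT (c * ⟪ν, z - y⟫) * f z)) z := by
      have := ((s1.diff z).hasFDerivAt.add ((s2.diff z).hasFDerivAt.const_mul (c * ⟪ν, e i⟫))).fderiv
      have h4 := congrArg (fun L => L (e i)) this
      unfold pd at *
      exact h4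
    rw [h1, h2, pd_cut TT_smooth c y ν (e i) (hf.pd _), pd_cut TT1_smooth c y ν (e i) hf, hin]
    ring
  unfold lap
  rw [Finset.sum_congr rfl fun i _ => hi i, Finset.sum_add_distrib, Finset.sum_add_distrib, ← Finset.mul_sum,
    ← Finset.mul_sum, ← Finset.mul_sum]
  have a1 : ∑ i, ν i * pd (e i) f z = pd ν f z := sum_coord_fderiv (fderiv ℝ f z) ν
  have a2 : ∑ i, ν i ^ 2 = 1 := by
    have := EuclideanSpace.norm_sq_eq ν
    rw [hν] at this
    simpa using this.symm
  rw [a1, a2, mul_one]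

theorem cauchy_half : ∃ C : ℝ, 1 ≤ C ∧ ∀ {F : Fin n → EE n → ℝ} (_ : SF F) {y ν : EE n} (_ : ‖ν‖ = 1) {σ b μ E : ℝ}
    (_ : 0 < σ) (_ : 66 * σ ≤ b) (_ : HF F (ball y b)) (_ : 0 ≤ μ) (_ : 0 ≤ E)
    (_ : ∀ k, ∀ z ∈ ball y b, |F k z| ≤ μ)
    (_ : ∀ k, ∀ z ∈ ball y b, |⟪ν, z - y⟫| < σ → |F k z| ≤ E),
    ∀ z ∈ ball y (b / 66), σ ≤ ⟪ν, z - y⟫ → sq2 F z ≤ C * (b / σ) ^ (n + 4) * (μ * E) := by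
  obtain ⟨CT, hCT1, hCT⟩ := TT_bound
  have hCg := Cg_ge (n := n)
  have hI := I2_pos (n := n)
  refine ⟨n * (3 * 1024 * 2 * 12 * CT * Cg n) * 8 ^ (n + 2) + 1, by
    have : 0 ≤ n * (3 * 1024 * 2 * 12 * CT * Cg n) * 8 ^ (n + 2) := by positivity
    linarith, ?_⟩
  intro F hF y ν hν σ b μ E hσ hσb hH hμ hE hbμ hbE z hz hzσ
  set c := 2 / σ with hc
  have hb : 0 < b := by linarith
  set τ := b / 66 with hτ
  have hτ0 : 0 < τ := by positivity
  have hστ : σ ≤ τ := by rw [hτ, le_div_iff₀ (by norm_num)]; linarith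
  have hinn : ∀ w : EE n, |⟪ν, w⟫| ≤ ‖w‖ := fun w => by
    have := abs_real_inner_le_norm ν w
    rwa [hν, one_mul] at this
  set G : Fin n → EE n → ℝ := fun k z => TT (c * ⟪ν, z - y⟫) * F k z with hG
  have hGs : SF G := fun k => (Sm_cut TT_smooth c y ν).mul (hF k)
  have T0 : ∀ t, 0 ≤ TT t := Real.smoothTransition.nonneg
  have T1 : ∀ t, TT t ≤ 1 := Real.smoothTransition.le_one
  have hGμ : ∀ k, ∀ z ∈ ball y b, |G k z| ≤ μ := by
    intro k z hz
    rw [hG, abs_mul, abs_of_nonneg (T0 _)]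
    calc _ ≤ 1 * |F k z| := by gcongr; exact T1 _
      _ ≤ _ := by rw [one_mul]; exact hbμ k z hz
  set e := 12 * CT * Cg n * E / σ ^ 2 with he
  have he0 : 0 ≤ e := by positivity
  have hGe : ∀ k, ∀ z ∈ ball y (b / 2), |lap (G k) z| ≤ e := by
    intro k z hz
    have hzb : z ∈ ball y b := ball_subset_ball (by linarith) hz
    rw [hG, lap_cut c y hν (hF k), hH k z hzb, mul_zero, zero_add]
    by_cases ht : c * ⟪ν, z - y⟫ ∈ Icc (0:ℝ) 1
    · obtain ⟨t0, t1⟩ := ht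
      have hc0 : 0 < c := by positivity
      have u0 : 0 ≤ ⟪ν, z - y⟫ := nonneg_of_mul_nonneg_right t0 hc0
      have u1 : ⟪ν, z - y⟫ ≤ σ / 2 := by
        rw [hc, div_mul_eq_mul_div, div_le_one hσ] at t1; linarith
      have f1 : |F k z| ≤ E := hbE k z hzb (by rw [abs_of_nonneg u0]; linarith)
      have hsub : ball z (σ / 2) ⊆ ball y b := ball_subset_ball' (by rw [mem_ball] at hz; linarith)
      have f2 := grad_est (hF k) z ν (r := σ / 2) (M := E) (by positivity) (fun w hw => hH k w (hsub hw)) (by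
        intro w hw
        apply hbE k w (hsub hw)
        have : w - y = (w - z) + (z - y) := by abel
        rw [this, inner_add_right]
        have h1 := hinn (w - z)
        rw [mem_ball, dist_eq_norm] at hw
        have h2 := abs_add_le ⟪ν, w - z⟫ ⟪ν, z - y⟫
        rw [abs_of_nonneg u0] at h2
        linarith)
      rw [hν] at f2
      obtain ⟨d1, d2⟩ := hCT (c * ⟪ν, z - y⟫)
      calc _ ≤ |2 * c * deriv TT (c * ⟪ν, z - y⟫) * pd ν (F k) z| + |c ^ 2 * deriv (deriv TT) (c * ⟪ν, z - y⟫) * F k z| := abs_add_le _ _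
        _ = 2 * c * |deriv TT (c * ⟪ν, z - y⟫)| * |pd ν (F k) z| + c ^ 2 * |deriv (deriv TT) (c * ⟪ν, z - y⟫)| * |F k z| := by
          rw [abs_mul, abs_mul (2 * c), abs_of_pos (show 0 < 2 * c by positivity), abs_mul (c ^ 2 * _), abs_mul (c ^ 2), abs_of_pos (show 0 < c ^ 2 by positivity)]
        _ ≤ 2 * c * CT * (Cg n * 1 / (σ / 2) * E) + c ^ 2 * CT * E := by gcongr
        _ = (8 * CT * Cg n * E + 4 * CT * E) / σ ^ 2 := by rw [hc]; field_simp; ring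
        _ ≤ _ := by
          rw [he]
          gcongr
          nlinarith [mul_nonneg (show 0 ≤ CT by linarith) hE]
    · rw [(TT_out ht).1, (TT_out ht).2]
      simpa using he0
  set p := y - τ • ν with hp
  have hpy : dist p y = τ := by rw [dist_eq_norm, hp, sub_sub_cancel_left, norm_neg, norm_smul, hν, Real.norm_of_nonneg hτ0.le, mul_one]
  have hs32 : ball p (8 * (4 * τ)) ⊆ ball y (b / 2) := ball_subset_ball' (by rw [hpy, hτ]; linarith)
  have hs4 : ball p (4 * τ) ⊆ ball p (8 * (4 * τ)) := ball_subset_ball (by linarith)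
  have hsb : ball y (b / 2) ⊆ ball y b := ball_subset_ball (by linarith)
  have hGG : ∀ k, GG (G k) (G k) p (4 * τ) (4 * τ) ≤ 3 * (8 * (4 * τ)) ^ 2 * (μ * e + μ * e) * I2 n := by
    intro k
    have h1 := GG_diff (hGs k) (hGs k) p (r := 4 * τ) (l := 8) (mf := μ) (ef := e) (mg := μ) (eg := e) (by positivity) (by norm_num)
      (fun z hz => hGμ k z (hsb (hs32 (hs4 hz)))) (fun z hz => hGe k z (hs32 (hs4 hz)))
      (fun z hz => hGμ k z (hsb (hs32 hz))) (fun z hz => hGe k z (hs32 hz))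
    have h2 : GG (G k) (G k) p (4 * τ / 8) (4 * τ * 8) = 0 := by
      unfold GG
      rw [← integral_zero (α := EE n) (G := ℝ) (μ := volume)]
      congr 1
      funext w
      by_cases hw : 1 ≤ ‖w‖
      · rw [pw_zero (by norm_num) hw, zero_mul]
      · have : G k (p + (4 * τ / 8) • w) = 0 := by
          rw [hG]
          simp only
          have : TT (c * ⟪ν, p + (4 * τ / 8) • w - y⟫) = 0 := by
            apply Real.smoothTransition.zero_of_nonpos
            apply mul_nonpos_of_nonneg_of_nonpos (by positivity)
            rw [hp, show y - τ • ν + (4 * τ / 8) • w - y = (4 * τ / 8) • w - τ • ν by abel, inner_sub_right,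
              inner_smul_right, inner_smul_right, real_inner_self_eq_norm_sq, hν]
            have := (le_abs_self _).trans (hinn w)
            push Not at hw
            nlinarith
          rw [this, zero_mul]
        rw [this]; ring
    rw [h2, zero_sub, abs_neg] at h1
    have h3 : Real.log 8 ≤ 3 := by
      rw [Real.log_le_iff_le_exp (by norm_num)]
      have := Real.exp_one_gt_d9
      calc (8:ℝ) ≤ (Real.exp 1) ^ 3 := by nlinarith [mul_pos (Real.exp_pos 1) (Real.exp_pos 1)]
        _ = _ := by rw [← Real.exp_nat_mul]; norm_num
    refine (le_abs_self _).trans (h1.trans ?_)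
    gcongr
  have hhG : hh G p (4 * τ) ≤ n * (3 * (8 * (4 * τ)) ^ 2 * (μ * e + μ * e) * I2 n) := by
    rw [hGs.hh_eq]
    refine (Finset.sum_le_sum fun k _ => hGG k).trans ?_
    simp
  have hzy : ‖z - y‖ < τ := by rwa [mem_ball, dist_eq_norm] at hz
  have m1 := sq2_le_mean hF z (σ := σ / 2) (by positivity) (fun k w hw => hH k w (by
    have : ball z (σ / 2) ⊆ ball y b := ball_subset_ball' (by rw [mem_ball] at hz; linarith)
    exact this hw))
  have m2 : ∫ w, pw 2 w * sq2 F (z + (σ / 2) • w) = ∫ w, pw 2 w * sq2 G (z + (σ / 2) • w) := by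
    congr 1
    funext w
    by_cases hw : 1 ≤ ‖w‖
    · rw [pw_zero (by norm_num) hw, zero_mul, zero_mul]
    · have : TT (c * ⟪ν, z + (σ / 2) • w - y⟫) = 1 := by
        apply Real.smoothTransition.one_of_one_le
        rw [hc, div_mul_eq_mul_div, one_le_div hσ, show z + (σ / 2) • w - y = (z - y) + (σ / 2) • w by abel,
          inner_add_right, inner_smul_right]
        have := (neg_le_abs _).trans (hinn w)
        push Not at hw
        nlinarith
      congr 1
      unfold sq2
      simp only [hG, this, one_mul]
  have m3 := mean_le_hh hGs p z (σ := σ / 2) (R := 4 * τ) (by positivity) (by positivity) (by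
    have h1 := dist_triangle z y p
    rw [dist_comm y p, hpy] at h1
    rw [mem_ball] at hz
    linarith)
  rw [m2] at m1
  have hq : sq2 F z * I2 n ≤ (4 * τ / (σ / 2)) ^ (n + 2) * (n * (3 * (8 * (4 * τ)) ^ 2 * (μ * e + μ * e) * I2 n)) :=
    m1.trans (m3.trans (by gcongr))
  have hq2 : sq2 F z ≤ (4 * τ / (σ / 2)) ^ (n + 2) * (n * (3 * (8 * (4 * τ)) ^ 2 * (μ * e + μ * e))) := by
    refine le_of_mul_le_mul_right (hq.trans (le_of_eq ?_)) hI
    ring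
  refine hq2.trans ?_
  have hτb : τ ≤ b := by rw [hτ]; linarith
  have e1 : 4 * τ / (σ / 2) ≤ 8 * (b / σ) := by
    rw [show 4 * τ / (σ / 2) = 8 * (τ / σ) by field_simp; norm_num]; gcongr
  calc _ ≤ (8 * (b / σ)) ^ (n + 2) * (n * (3 * (8 * (4 * b)) ^ 2 * (μ * e + μ * e))) := by gcongr
    _ = n * (3 * 1024 * 2 * 12 * CT * Cg n) * 8 ^ (n + 2) * (b / σ) ^ (n + 4) * (μ * E) := by
      rw [he, mul_pow, show (b / σ) ^ (n + 4) = (b / σ) ^ (n + 2) * (b ^ 2 / σ ^ 2) by rw [← div_pow, ← pow_add]]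
      generalize (b / σ) ^ (n + 2) = X
      field_simp; ring
    _ ≤ _ := by gcongr; linarith

end


section
variable {n : ℕ}

theorem key_num {C Y d α ρ : ℝ} {m : ℕ} (hC : 1 ≤ C) (hY : 0 < Y) (hd : 1 ≤ d) (hm : 2 * (m:ℝ) ≤ α * d)
    (hρ : 0 < ρ) (hρ1 : ρ ≤ 1) (h : C * Y * ρ ^ (α / 2) ≤ 1 / 2) :
    C * (1 / ρ) ^ m * (Y * ρ ^ α) ^ d ≤ 1 / 2 := by
  have h1 : (1 / ρ) ^ m ≤ (ρ ^ (-(α / 2))) ^ d := by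
    rw [← Real.rpow_mul hρ.le, one_div, inv_pow, ← Real.rpow_natCast, ← Real.rpow_neg hρ.le]
    apply Real.rpow_le_rpow_of_exponent_ge hρ hρ1
    nlinarith
  have h2 : C ≤ C ^ d := by
    conv_lhs => rw [← Real.rpow_one C]
    exact Real.rpow_le_rpow_of_exponent_le hC hd
  have hp := Real.rpow_pos_of_pos hρ (α / 2)
  calc C * (1 / ρ) ^ m * (Y * ρ ^ α) ^ d ≤ C ^ d * (ρ ^ (-(α / 2))) ^ d * (Y * ρ ^ α) ^ d := by gcongr
    _ = (C * Y * ρ ^ (α / 2)) ^ d := by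
      rw [← Real.mul_rpow (by positivity) (by positivity), ← Real.mul_rpow (by positivity) (by positivity)]
      congr 1
      have : ρ ^ α = ρ ^ (α / 2) * ρ ^ (α / 2) := by rw [← Real.rpow_add hρ]; congr 1; ring
      rw [this, Real.rpow_neg hρ.le]
      field_simp
    _ ≤ (1 / 2) ^ d := by gcongr
    _ ≤ (1 / 2) ^ (1:ℝ) := Real.rpow_le_rpow_of_exponent_ge (by norm_num) (by norm_num) hd
    _ = 1 / 2 := by simp

set_option maxHeartbeats 1000000 in
theorem key_lemma (hn : 2 ≤ n) {β : ℝ} (hβ : 0 < β) (hβ1 : β ≤ 1) : ∃ ρ0 : ℝ, 0 < ρ0 ∧ ∀ {F : Fin n → EE n → ℝ}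
    {N ρ s : ℝ} {S : Finset (EE n)} {y ν : EE n}, ρ ≤ ρ0 → Cfg F N ρ s S y → S.card = n →
    2 * ((n : ℝ) + 4) ≤ aln n * dd n N → ‖ν‖ = 1 →
    (∀ z, ⟪ν, z - y⟫ = 0 → ‖z - y‖ ≤ β * s → z ∈ convexHull ℝ (S : Set (EE n))) → False := by
  obtain ⟨C, hC1, hC⟩ := cauchy_half (n := n)
  have hn2 : (2:ℝ) ≤ n := by exact_mod_cast hn
  obtain ⟨B, hB⟩ : ∃ B, B = Bs n n := ⟨_, rfl⟩
  have hB1 : 1 ≤ B := hB ▸ (Bs_mono hn n).2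
  obtain ⟨α, hα⟩ : ∃ α, α = aln n := ⟨_, rfl⟩
  have hα0 : 0 < α := hα ▸ aln_pos n
  obtain ⟨D, hD⟩ : ∃ D : ℝ, D = 10 * n * (66 / β) := ⟨_, rfl⟩
  have hD0 : 0 < D := by rw [hD]; positivity
  obtain ⟨C3, hC3⟩ : ∃ C3 : ℝ, C3 = (C * n) * (2 ^ n) ^ (n + 4) := ⟨_, rfl⟩
  have hCn : 1 ≤ C * n := by nlinarith
  have hC31 : 1 ≤ C3 := by
    rw [hC3]
    exact one_le_mul_of_one_le_of_one_le hCn (one_le_pow₀ (one_le_pow₀ (by norm_num)))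
  obtain ⟨X, hX⟩ : ∃ X, X = C3 * (D ^ 2 * B) := ⟨_, rfl⟩
  have hX0 : 0 < X := by rw [hX]; positivity
  refine ⟨min (β / 66) ((1 / (2 * X)) ^ (2 / α)), lt_min (by positivity) (by positivity), ?_⟩
  intro F N ρ s S y ν hρ h hcard hdn hν hhull
  have hρ1 : ρ ≤ β / 66 := hρ.trans (min_le_left _ _)
  have hρ2 := hρ.trans (min_le_right _ _)
  have hρ0 := h.ρ0
  have hs0 := h.s0
  have hs1 := h.s1
  have hy := h.yc
  have hsF := h.st.sm
  have hd1 := h.d1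
  obtain ⟨d, hd⟩ : ∃ d, d = dd n N := ⟨_, rfl⟩
  rw [← hd, ← hα] at hdn
  rw [← hd] at hd1
  have hxs : X * ρ ^ (α / 2) ≤ 1 / 2 := by
    calc X * ρ ^ (α / 2) ≤ X * ((1 / (2 * X)) ^ (2 / α)) ^ (α / 2) := by gcongr
      _ = 1 / 2 := by
        rw [← Real.rpow_mul (by positivity), show 2 / α * (α / 2) = 1 by field_simp, Real.rpow_one]
        field_simp
  obtain ⟨b, hb⟩ : ∃ b, b = β * s := ⟨_, rfl⟩
  obtain ⟨σ, hσ⟩ : ∃ σ, σ = ρ * s / 2 ^ n := ⟨_, rfl⟩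
  have hσ0 : 0 < σ := by rw [hσ]; positivity
  have hb0 : 0 < b := by rw [hb]; positivity
  have hbs : b ≤ s := by rw [hb]; nlinarith
  have hs2 : s ≤ 1 := by linarith
  obtain ⟨μ, hμ⟩ : ∃ μ, μ = sg F y s := ⟨_, rfl⟩
  have hμ0 : 0 < μ := hμ ▸ h.st.sg_pos hy hs0 (by linarith)
  obtain ⟨E, hE⟩ : ∃ E, E = μ * (B * ρ ^ α) ^ d := ⟨_, rfl⟩
  have hE0 : 0 ≤ E := by rw [hE]; positivity
  have h66 : 66 * σ ≤ b := by
    have h1 : σ ≤ ρ * s := by rw [hσ]; exact div_le_self (by positivity) (one_le_pow₀ (by norm_num))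
    rw [hb]
    nlinarith
  have hH : HF F (ball y b) := h.st.hfb hy (by linarith)
  have hm : ∀ k, ∀ z ∈ ball y b, |F k z| ≤ μ := fun k z hz => by
    rw [hμ]; exact hsF.abs_le_sg (ball_subset_ball hbs hz) k
  have hSne : S.Nonempty := by rw [← Finset.card_pos, hcard]; omega
  have he : ∀ k, ∀ z ∈ ball y b, |⟪ν, z - y⟫| < σ → |F k z| ≤ E := by
    intro k z hz hzν
    have h1 : z = (z - ⟪ν, z - y⟫ • ν) + ⟪ν, z - y⟫ • ν := by abel
    rw [h1, hE, hμ, hB, hd, hα]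
    have hp : z - ⟪ν, z - y⟫ • ν ∈ convexHull ℝ (S : Set (EE n)) := by
      have e : z - ⟪ν, z - y⟫ • ν - y = (z - y) - ⟪ν, z - y⟫ • ν := by abel
      apply hhull
      · rw [e, inner_sub_right, inner_smul_right, real_inner_self_eq_norm_sq, hν]; ring
      · rw [e]
        rw [mem_ball, dist_eq_norm] at hz
        rw [← hb]
        refine le_trans ?_ hz.le
        apply abs_le_of_sq_le_sq' _ (norm_nonneg _) |>.2
        rw [norm_sub_sq_real, inner_smul_right, norm_smul, hν, real_inner_comm, mul_one, Real.norm_eq_abs, sq_abs]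
        nlinarith [sq_nonneg ⟪ν, z - y⟫]
    have := h.tube k S subset_rfl hSne _ hp (⟪ν, z - y⟫ • ν) (by
      rw [norm_smul, hν, mul_one, hcard, ← hσ]; exact hzν)
    rw [hcard] at this
    exact this
  have hbσ : 1 ≤ b / σ := by rw [le_div_iff₀ hσ0]; linarith
  have hsq : ∀ z ∈ ball y (b / 66), sq2 F z ≤ C * n * (b / σ) ^ (n + 4) * (μ * E) := by
    intro z hz
    have hCC : C * (b / σ) ^ (n + 4) * (μ * E) ≤ C * n * (b / σ) ^ (n + 4) * (μ * E) := by
      gcongr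
      nlinarith
    rcases le_or_gt σ ⟪ν, z - y⟫ with h1 | h1
    · exact (hC hsF hν hσ0 h66 hH hμ0.le hE0 hm he z hz h1).trans hCC
    rcases le_or_gt σ (-⟪ν, z - y⟫) with h2 | h2
    · refine (hC hsF (ν := -ν) (by rw [norm_neg, hν]) hσ0 h66 hH hμ0.le hE0 hm (fun k w hw hw2 => ?_) z hz ?_).trans hCC
      · rw [inner_neg_left, abs_neg] at hw2
        exact he k w hw hw2
      · rw [inner_neg_left]; exact h2
    · have hzb : z ∈ ball y b := ball_subset_ball (by linarith) hz
      have h3 : ∀ k, |F k z| ≤ E := fun k => he k z hzb (abs_lt.2 ⟨by linarith, h1⟩)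
      calc sq2 F z ≤ ∑ _k : Fin n, μ * E := Finset.sum_le_sum fun k _ => by
            rw [← sq_abs, sq]
            exact mul_le_mul (hm k z hzb) (h3 k) (abs_nonneg _) hμ0.le
        _ = 1 * n * 1 * (μ * E) := by simp
        _ ≤ _ := by
          gcongr
          exact one_le_pow₀ hbσ
  obtain ⟨g, hg⟩ : ∃ g, g = sg F y (b / 66) := ⟨_, rfl⟩
  have hg0 : 0 < g := hg ▸ h.st.sg_pos hy (by positivity) (by linarith)
  have hμE : 0 ≤ μ * E := by positivity
  have hgsq : g ^ 2 ≤ C * n * (b / σ) ^ (n + 4) * (μ * E) := by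
    have hR : 0 ≤ C * n * (b / σ) ^ (n + 4) * (μ * E) := by positivity
    have : g ≤ Real.sqrt (C * n * (b / σ) ^ (n + 4) * (μ * E)) := by
      rw [hg]
      apply sg_le (Real.sqrt_nonneg _)
      intro z hz
      apply Real.le_sqrt_of_sq_le
      rw [gn_sq]
      exact hsq z hz
    calc g ^ 2 ≤ Real.sqrt (C * n * (b / σ) ^ (n + 4) * (μ * E)) ^ 2 := by gcongr
      _ = _ := Real.sq_sqrt hR
  have hμg : μ ≤ D ^ d * g := by
    have := dbl_pow hn hsF h.N0 h.db hy (r := b / 66) (R := s) (by positivity) (by linarith) (by linarith)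
    rw [exp_N hn, ← hd, ← Real.mul_rpow (by positivity) (by positivity), ← hg, ← hμ] at this
    rw [hD]
    rwa [show s / (b / 66) = 66 / β by rw [hb]; field_simp] at this
  have hbσ2 : b / σ ≤ 2 ^ n * (1 / ρ) := by
    rw [hb, hσ]
    calc β * s / (ρ * s / 2 ^ n) = β * (2 ^ n * (1 / ρ)) := by field_simp
      _ ≤ 1 * (2 ^ n * (1 / ρ)) := by gcongr
      _ = _ := one_mul _
  have hfin : g ^ 2 ≤ (1 / 2) * g ^ 2 := by
    calc g ^ 2 ≤ C * n * (2 ^ n * (1 / ρ)) ^ (n + 4) * (μ ^ 2 * (B * ρ ^ α) ^ d) := by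
          refine hgsq.trans ?_
          rw [hE, ← mul_assoc μ μ, ← sq μ]
          gcongr
      _ ≤ C * n * (2 ^ n * (1 / ρ)) ^ (n + 4) * ((D ^ d * g) ^ 2 * (B * ρ ^ α) ^ d) := by gcongr
      _ = (C3 * (1 / ρ) ^ (n + 4) * (D ^ 2 * B * ρ ^ α) ^ d) * g ^ 2 := by
          have e1 : (D ^ 2 * B * ρ ^ α) ^ d = (D ^ d) ^ 2 * (B * ρ ^ α) ^ d := by
            rw [mul_assoc, Real.mul_rpow (by positivity) (by positivity), sq D, Real.mul_rpow hD0.le hD0.le, sq]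
          rw [e1, hC3, mul_pow _ (1 / ρ)]
          ring
      _ ≤ (1 / 2) * g ^ 2 := by
          gcongr
          apply key_num hC31 (by positivity) hd1 _ hρ0 (by linarith) (by rw [← hX]; exact hxs)
          push_cast
          exact hdn
  nlinarith [sq_nonneg g, pow_pos hg0 2]
end


section
variable {n : ℕ}

theorem finrank_sup_span {L : Submodule ℝ (EE n)} {w : EE n} (hw : w ∉ L) :
    Module.finrank ℝ (L ⊔ Submodule.span ℝ {w} : Submodule ℝ (EE n)) = Module.finrank ℝ L + 1 := by
  have h := Submodule.finrank_sup_add_finrank_inf_eq L (Submodule.span ℝ {w})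
  have hw0 : w ≠ 0 := fun h => hw (h ▸ L.zero_mem)
  have hinf : L ⊓ Submodule.span ℝ {w} = ⊥ := by
    rw [Submodule.eq_bot_iff]
    intro z hz
    obtain ⟨h1, h2⟩ := Submodule.mem_inf.1 hz
    obtain ⟨c, rfl⟩ := Submodule.mem_span_singleton.1 h2
    by_cases hc : c = 0
    · simp [hc]
    · exact absurd ((Submodule.smul_mem_iff L hc).1 h1) hw
  rw [hinf, finrank_bot, finrank_span_singleton hw0] at h
  omega

theorem geom_step {γ b s : ℝ} (hγ : 0 < γ) (hγ1 : γ ≤ 1) (hb : 0 < b) (hb1 : b ≤ 1) (hs : 0 < s)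
    {S : Finset (EE n)} {x y : EE n} {L : Submodule ℝ (EE n)}
    (hSx : ∀ p ∈ S, dist p x ≤ n * s) (hy : y ∈ convexHull ℝ (S : Set (EE n))) (hSL : ∀ p ∈ S, p - y ∈ L)
    (hL : ∀ v ∈ L, ‖v‖ ≤ b * s → y + v ∈ convexHull ℝ (S : Set (EE n)))
    (hx : ∀ l ∈ L, γ * s < ‖x - y - l‖) :
    x - y ∉ L ∧ x ∉ S ∧ ∃ y' ∈ convexHull ℝ (insert x (S : Set (EE n))),
      (∀ p ∈ insert x (S : Set (EE n)), p - y' ∈ L ⊔ Submodule.span ℝ {x - y}) ∧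
      (∀ v ∈ L ⊔ Submodule.span ℝ {x - y}, ‖v‖ ≤ b * (γ / (4 * (n + 1))) * s →
        y' + v ∈ convexHull ℝ (insert x (S : Set (EE n)))) := by
  have hxL : x - y ∉ L := fun h => by
    have := hx _ h
    rw [sub_self, norm_zero] at this
    nlinarith
  have hsub : convexHull ℝ (S : Set (EE n)) ⊆ convexHull ℝ (insert x (S : Set (EE n))) :=
    convexHull_mono (subset_insert _ _)
  have hxc : x ∈ convexHull ℝ (insert x (S : Set (EE n))) := subset_convexHull _ _ (mem_insert _ _)
  have hconv := convex_convexHull ℝ (insert x (S : Set (EE n)))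
  have hw : ‖x - y‖ ≤ n * s := by
    have h1 : convexHull ℝ (S : Set (EE n)) ⊆ closedBall x (n * s) :=
      convexHull_min (fun p hp => mem_closedBall.2 (hSx p hp)) (convex_closedBall _ _)
    have := h1 hy
    rwa [mem_closedBall, dist_comm, dist_eq_norm] at this
  refine ⟨hxL, fun h => hxL (hSL x h), y + (1 / 2 : ℝ) • (x - y), ?_, ?_, ?_⟩
  · have := hconv (hsub hy) hxc (a := 1 / 2) (b := 1 / 2) (by norm_num) (by norm_num) (by norm_num)
    convert this using 1
    module
  · intro p hp
    rcases hp with rfl | hp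
    · have : p - (y + (1 / 2 : ℝ) • (p - y)) = (1 / 2 : ℝ) • (p - y) := by module
      rw [this]
      exact Submodule.smul_mem _ _ (Submodule.mem_sup_right (Submodule.mem_span_singleton_self _))
    · have : p - (y + (1 / 2 : ℝ) • (x - y)) = (p - y) - (1 / 2 : ℝ) • (x - y) := by module
      rw [this]
      exact Submodule.sub_mem _ (Submodule.mem_sup_left (hSL p hp))
        (Submodule.smul_mem _ _ (Submodule.mem_sup_right (Submodule.mem_span_singleton_self _)))
  · intro v' hv' hn'
    obtain ⟨v, hv, w', hw', rfl⟩ := Submodule.mem_sup.1 hv'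
    obtain ⟨c, rfl⟩ := Submodule.mem_span_singleton.1 hw'
    have hc : |c| * (γ * s) ≤ ‖v + c • (x - y)‖ := by
      by_cases h0 : c = 0
      · simp [h0]
      · have h1 := hx (-(c⁻¹ • v)) (L.neg_mem (L.smul_mem _ hv))
        have h2 : v + c • (x - y) = c • (x - y - -(c⁻¹ • v)) := by
          rw [sub_neg_eq_add, smul_add, smul_smul, mul_inv_cancel₀ h0, one_smul, add_comm]
        rw [h2, norm_smul, Real.norm_eq_abs]
        gcongr
    have hn0 : (0:ℝ) ≤ n := by positivity
    have hc2 : |c| ≤ b / (4 * (n + 1)) := by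
      have : |c| * (γ * s) ≤ b / (4 * (n + 1)) * (γ * s) := by
        refine hc.trans (hn'.trans (le_of_eq ?_))
        field_simp
      exact le_of_mul_le_mul_right this (by positivity)
    have hc4 : |c| ≤ 1 / 4 := by
      refine hc2.trans ?_
      rw [div_le_div_iff₀ (by positivity) (by norm_num)]
      nlinarith
    obtain ⟨hc5, hc6⟩ := abs_le.1 hc4
    have hvn : 4 * ‖v‖ ≤ b * s := by
      have h1 : ‖v‖ ≤ ‖v + c • (x - y)‖ + |c| * ‖x - y‖ := by
        have := norm_sub_le (v + c • (x - y)) (c • (x - y))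
        rwa [add_sub_cancel_right, norm_smul, Real.norm_eq_abs] at this
      have h2 : |c| * ‖x - y‖ ≤ b / (4 * (n + 1)) * (n * s) := by gcongr
      have h3 : b * (γ / (4 * (n + 1))) * s ≤ b * (1 / (4 * (n + 1))) * s := by gcongr
      have h4 : 4 * (b * (1 / (4 * (n + 1))) * s + b / (4 * (n + 1)) * (n * s)) = b * s := by
        field_simp; ring
      linarith
    have hθ : 0 < 1 / 2 - c := by linarith
    have hmem : y + (1 / 2 - c)⁻¹ • v ∈ convexHull ℝ (S : Set (EE n)) := by
      apply hL _ (L.smul_mem _ hv)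
      rw [norm_smul, norm_inv, Real.norm_of_nonneg hθ.le]
      have : (1 / 2 - c)⁻¹ ≤ 4 := by
        rw [inv_le_comm₀ hθ (by norm_num)]; linarith
      calc _ ≤ 4 * ‖v‖ := by gcongr
        _ ≤ _ := hvn
    have := hconv (hsub hmem) hxc (a := 1 / 2 - c) (b := 1 / 2 + c) hθ.le (by linarith) (by ring)
    convert this using 1
    rw [smul_add, smul_smul, mul_inv_cancel₀ hθ.ne', one_smul]
    module

theorem geom_ind {γ : ℝ} (hγ : 0 < γ) (hγ1 : γ ≤ 1) {s : ℝ} (hs : 0 < s) {P : Set (EE n)} (hP : P.Nonempty)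
    (hPd : ∀ x ∈ P, ∀ z ∈ P, dist x z ≤ n * s) (k : ℕ) (hk : k + 1 ≤ n) :
    (∃ y, ∃ L : Submodule ℝ (EE n), Module.finrank ℝ L + 2 ≤ n ∧ ∀ x ∈ P, ∃ l ∈ L, ‖x - y - l‖ ≤ γ * s) ∨
    (∃ S : Finset (EE n), (S : Set (EE n)) ⊆ P ∧ S.card = k + 1 ∧ ∃ y ∈ convexHull ℝ (S : Set (EE n)),
      ∃ L : Submodule ℝ (EE n), Module.finrank ℝ L = k ∧ (∀ p ∈ S, p - y ∈ L) ∧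
      ∀ v ∈ L, ‖v‖ ≤ (γ / (4 * (n + 1))) ^ k * s → y + v ∈ convexHull ℝ (S : Set (EE n))) := by
  classical
  induction k with
  | zero =>
    right
    obtain ⟨x, hx⟩ := hP
    refine ⟨{x}, by simpa using hx, by simp, x, by simp, ⊥, by simp, by simp, ?_⟩
    intro v hv _
    rw [Submodule.mem_bot] at hv
    simp [hv]
  | succ k ih =>
    rcases ih (by omega) with h | ⟨S, hSP, hc, y, hy, L, hLk, hSL, hL⟩
    · exact Or.inl h
    by_cases hx : ∀ x ∈ P, ∃ l ∈ L, ‖x - y - l‖ ≤ γ * s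
    · exact Or.inl ⟨y, L, by omega, hx⟩
    push Not at hx
    obtain ⟨x, hxP, hx⟩ := hx
    right
    have hr0 : 0 < γ / (4 * ((n:ℝ) + 1)) := by positivity
    have hr1 : γ / (4 * ((n:ℝ) + 1)) ≤ 1 := by
      rw [div_le_one (by positivity)]
      have : (0:ℝ) ≤ n := by positivity
      linarith
    obtain ⟨h1, h2, y', hy', h3, h4⟩ := geom_step hγ hγ1 (pow_pos hr0 k) (pow_le_one₀ hr0.le hr1) hs
      (fun p hp => hPd p (hSP hp) x hxP) hy hSL hL hx
    refine ⟨insert x S, ?_, ?_, y', ?_, L ⊔ Submodule.span ℝ {x - y}, ?_, ?_, ?_⟩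
    · rw [Finset.coe_insert]
      exact insert_subset hxP hSP
    · rw [Finset.card_insert_of_notMem h2, hc]
    · rwa [Finset.coe_insert]
    · rw [finrank_sup_span h1, hLk]
    · intro p hp
      apply h3
      rw [← Finset.coe_insert]
      exact hp
    · rw [Finset.coe_insert, pow_succ]
      exact h4

theorem geom (hn : 1 ≤ n) {γ : ℝ} (hγ : 0 < γ) (hγ1 : γ ≤ 1) : ∃ β : ℝ, 0 < β ∧ β ≤ 1 ∧ ∀ {s : ℝ} (_ : 0 < s)
    {P : Set (EE n)} (_ : P.Nonempty) (_ : ∀ x ∈ P, ∀ z ∈ P, dist x z ≤ n * s),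
    (∃ y, ∃ L : Submodule ℝ (EE n), Module.finrank ℝ L + 2 ≤ n ∧ ∀ x ∈ P, ∃ l ∈ L, ‖x - y - l‖ ≤ γ * s) ∨
    (∃ S : Finset (EE n), (S : Set (EE n)) ⊆ P ∧ S.card = n ∧ ∃ y ∈ convexHull ℝ (S : Set (EE n)),
      ∃ ν : EE n, ‖ν‖ = 1 ∧ ∀ z, ⟪ν, z - y⟫ = 0 → ‖z - y‖ ≤ β * s → z ∈ convexHull ℝ (S : Set (EE n))) := by
  have hr0 : 0 < γ / (4 * ((n:ℝ) + 1)) := by positivity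
  have hr1 : γ / (4 * ((n:ℝ) + 1)) ≤ 1 := by
    rw [div_le_one (by positivity)]
    have : (0:ℝ) ≤ n := by positivity
    linarith
  refine ⟨(γ / (4 * (n + 1))) ^ (n - 1), pow_pos hr0 _, pow_le_one₀ hr0.le hr1, ?_⟩
  intro s hs P hP hPd
  rcases geom_ind hγ hγ1 hs hP hPd (n - 1) (by omega) with h | ⟨S, hSP, hc, y, hy, L, hLk, hSL, hL⟩
  · exact Or.inl h
  right
  refine ⟨S, hSP, by omega, y, hy, ?_⟩
  have hfr := L.finrank_add_finrank_orthogonal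
  rw [finrank_euclideanSpace, Fintype.card_fin] at hfr
  have h1 : Module.finrank ℝ Lᗮ = 1 := by omega
  have : Nontrivial Lᗮ := Module.nontrivial_of_finrank_pos (R := ℝ) (by omega)
  obtain ⟨w, hw⟩ := exists_ne (0 : Lᗮ)
  have hw0 : (w : EE n) ≠ 0 := by simpa using hw
  refine ⟨(‖(w : EE n)‖)⁻¹ • (w : EE n), by rw [norm_smul, norm_inv, norm_norm, inv_mul_cancel₀ (norm_ne_zero_iff.2 hw0)], ?_⟩
  intro z hz hzb
  have hle : L ≤ (Submodule.span ℝ {(w : EE n)})ᗮ := by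
    intro l hl
    rw [Submodule.mem_orthogonal_singleton_iff_inner_right]
    exact Submodule.inner_left_of_mem_orthogonal hl w.2
  have heq : L = (Submodule.span ℝ {(w : EE n)})ᗮ := by
    apply Submodule.eq_of_le_of_finrank_eq hle
    have := (Submodule.span ℝ {(w : EE n)}).finrank_add_finrank_orthogonal
    rw [finrank_euclideanSpace, Fintype.card_fin, finrank_span_singleton hw0] at this
    omega
  have hzL : z - y ∈ L := by
    rw [heq, Submodule.mem_orthogonal_singleton_iff_inner_right]
    rw [inner_smul_left] at hz
    simpa [hw0] using hz
  have := hL _ hzL hzb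
  rwa [add_sub_cancel] at this
end


section
variable {n : ℕ}

/-- counting constant -/
def Cf (n : ℕ) : ℕ := (6 * n + 7) ^ n * (3 * n) ^ n

theorem coord_le (x : EE n) (i : Fin n) : |x i| ≤ ‖x‖ := by
  have := PiLp.norm_apply_le x i
  rwa [Real.norm_eq_abs] at this

theorem flat_near {h : ℝ} (hh : 0 < h) {L : Submodule ℝ (EE n)} (hL : Module.finrank ℝ L ≤ n) {u l e : EE n}
    (hl : l ∈ L) (hu : u = l + e) (he : ‖e‖ ≤ 2 * h)
    (hb : ∀ j, |⟪((stdOrthonormalBasis ℝ L j : L) : EE n), u⟫| ≤ h) : ‖u‖ ≤ (3 * n + 2) * h := by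
  have h1 := (stdOrthonormalBasis ℝ L).sum_sq_norm_inner_right ⟨l, hl⟩
  have h2 : ∀ j, ‖⟪stdOrthonormalBasis ℝ L j, (⟨l, hl⟩ : L)⟫‖ ^ 2 ≤ (3 * h) ^ 2 := by
    intro j
    have e1 : ⟪stdOrthonormalBasis ℝ L j, (⟨l, hl⟩ : L)⟫ = ⟪((stdOrthonormalBasis ℝ L j : L) : EE n), u⟫
        - ⟪((stdOrthonormalBasis ℝ L j : L) : EE n), e⟫ := by
      rw [← inner_sub_right, hu, add_sub_cancel_right]; rfl
    have e2 : |⟪((stdOrthonormalBasis ℝ L j : L) : EE n), e⟫| ≤ 2 * h := by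
      refine (abs_real_inner_le_norm _ _).trans ?_
      have : ‖((stdOrthonormalBasis ℝ L j : L) : EE n)‖ = 1 := (stdOrthonormalBasis ℝ L).norm_eq_one j
      rw [this, one_mul]; exact he
    gcongr
    rw [e1, Real.norm_eq_abs]
    have := abs_sub (⟪((stdOrthonormalBasis ℝ L j : L) : EE n), u⟫) (⟪((stdOrthonormalBasis ℝ L j : L) : EE n), e⟫)
    linarith [hb j]
  have h3 : ‖l‖ ^ 2 ≤ n * (3 * h) ^ 2 := by
    have : ‖(⟨l, hl⟩ : L)‖ = ‖l‖ := rfl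
    rw [← this, ← h1]
    calc _ ≤ ∑ _j : Fin (Module.finrank ℝ L), (3 * h) ^ 2 := Finset.sum_le_sum fun j _ => h2 j
      _ = Module.finrank ℝ L * (3 * h) ^ 2 := by simp
      _ ≤ _ := by gcongr
  have h4 : ‖l‖ ≤ 3 * n * h := by
    apply abs_le_of_sq_le_sq' _ (by positivity) |>.2
    refine h3.trans ?_
    have : (n:ℝ) ≤ n ^ 2 := by
      rcases Nat.eq_zero_or_pos n with h0 | h0
      · simp [h0]
      · have : (1:ℝ) ≤ n := by exact_mod_cast h0
        nlinarith
    calc (n:ℝ) * (3 * h) ^ 2 ≤ n ^ 2 * (3 * h) ^ 2 := by gcongr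
      _ = _ := by ring
  calc ‖u‖ ≤ ‖l‖ + ‖e‖ := by rw [hu]; exact norm_add_le _ _
    _ ≤ _ := by linarith

theorem flat_count (hn : 2 ≤ n) {q : ℕ} (hq : 1 ≤ q) {h : ℝ} (hh : 0 < h) {y : EE n} {L : Submodule ℝ (EE n)}
    (hL : Module.finrank ℝ L + 2 ≤ n) (I : Finset (Fin n → ℕ)) (X : (Fin n → ℕ) → EE n)
    (hc : ∀ κ ∈ I, ∀ i, κ i * h ≤ X κ i + 1 / 2 ∧ X κ i + 1 / 2 ≤ (κ i + 1) * h)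
    (hf : ∀ κ ∈ I, ∃ l ∈ L, ‖X κ - y - l‖ ≤ h)
    (hd : ∀ κ ∈ I, ∀ κ' ∈ I, dist (X κ) (X κ') ≤ n * (q * h)) : I.card ≤ Cf n * q ^ (n - 2) := by
  classical
  rcases I.eq_empty_or_nonempty with rfl | ⟨κ0, h0⟩
  · simp
  set b := stdOrthonormalBasis ℝ L with hb
  have hbn : ∀ j, ‖((b j : L) : EE n)‖ = 1 := fun j => b.norm_eq_one j
  let φ : (Fin n → ℕ) → (Fin (Module.finrank ℝ L) → ℤ) := fun κ j => ⌊⟪((b j : L) : EE n), X κ - X κ0⟫ / h⌋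
  have himg : I.image φ ⊆ Fintype.piFinset (fun _ => Finset.Icc (-((n * q : ℕ) : ℤ)) ((n * q : ℕ) : ℤ)) := by
    intro f hf'
    obtain ⟨κ, hκ, rfl⟩ := Finset.mem_image.1 hf'
    rw [Fintype.mem_piFinset]
    intro j
    have h1 : |⟪((b j : L) : EE n), X κ - X κ0⟫| ≤ n * (q * h) := by
      refine (abs_real_inner_le_norm _ _).trans ?_
      rw [hbn, one_mul, ← dist_eq_norm]
      exact hd κ hκ κ0 h0
    obtain ⟨h2, h3⟩ := abs_le.1 h1
    rw [Finset.mem_Icc]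
    constructor
    · apply Int.le_floor.2
      rw [le_div_iff₀ hh]
      push_cast
      linarith
    · have : ⟪((b j : L) : EE n), X κ - X κ0⟫ / h ≤ ((n * q : ℕ) : ℤ) := by
        rw [div_le_iff₀ hh]
        push_cast
        linarith
      exact_mod_cast (Int.floor_le _).trans this
  have hcard1 : (I.image φ).card ≤ (3 * n) ^ n * q ^ (n - 2) := by
    refine (Finset.card_le_card himg).trans ?_
    rw [Fintype.card_piFinset]
    simp only [Int.card_Icc, Finset.prod_const, Finset.card_univ, Fintype.card_fin]
    have h1 : ((n * q : ℕ) + 1 - -((n * q : ℕ) : ℤ)).toNat ≤ 3 * n * q := by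
      have : 1 ≤ n * q := Nat.mul_pos (by omega) hq
      rw [mul_assoc 3 n q]
      omega
    calc _ ≤ (3 * n * q) ^ Module.finrank ℝ L := Nat.pow_le_pow_left h1 _
      _ = (3 * n) ^ Module.finrank ℝ L * q ^ Module.finrank ℝ L := mul_pow _ _ _
      _ ≤ _ := Nat.mul_le_mul (Nat.pow_le_pow_right (by omega) (by omega)) (Nat.pow_le_pow_right hq (by omega))
  have hfib : ∀ f ∈ I.image φ, (I.filter (fun κ => φ κ = f)).card ≤ (6 * n + 7) ^ n := by
    intro f hf'
    obtain ⟨κ1, hκ1, rfl⟩ := Finset.mem_image.1 hf'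
    have hsub : I.filter (fun κ => φ κ = φ κ1) ⊆
        Fintype.piFinset (fun i => Finset.Icc (κ1 i - (3 * n + 3)) (κ1 i + (3 * n + 3))) := by
      intro κ hκ
      obtain ⟨hκ, hφ⟩ := Finset.mem_filter.1 hκ
      obtain ⟨l, hl, hle⟩ := hf κ hκ
      obtain ⟨l1, hl1, hle1⟩ := hf κ1 hκ1
      have hu := flat_near hh (L := L) (by omega) (u := X κ - X κ1) (l := l - l1) (e := (X κ - y - l) - (X κ1 - y - l1))
        (L.sub_mem hl hl1) (by abel) (by
          refine (norm_sub_le _ _).trans ?_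
          linarith) (by
          intro j
          have h1 := congrFun hφ j
          have h2 : ⟪((b j : L) : EE n), X κ - X κ1⟫ / h = ⟪((b j : L) : EE n), X κ - X κ0⟫ / h - ⟪((b j : L) : EE n), X κ1 - X κ0⟫ / h := by
            rw [← sub_div, ← inner_sub_right]; congr 2; abel
          have h3 := Int.abs_sub_lt_one_of_floor_eq_floor h1
          rw [← h2, abs_div, abs_of_pos hh, div_lt_one hh] at h3
          exact h3.le)
      rw [Fintype.mem_piFinset]
      intro i
      have h1 := (coord_le (X κ - X κ1) i).trans hu
      rw [PiLp.sub_apply] at h1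
      obtain ⟨h2, h3⟩ := abs_le.1 h1
      obtain ⟨a1, a2⟩ := hc κ hκ i
      obtain ⟨b1, b2⟩ := hc κ1 hκ1 i
      have h4 : (κ i : ℝ) ≤ κ1 i + (3 * n + 3) := by
        have : (κ i : ℝ) * h ≤ (κ1 i + (3 * n + 3)) * h := by linarith
        exact le_of_mul_le_mul_right this hh
      have h5 : (κ1 i : ℝ) ≤ κ i + (3 * n + 3) := by
        have : (κ1 i : ℝ) * h ≤ (κ i + (3 * n + 3)) * h := by linarith
        exact le_of_mul_le_mul_right this hh
      have h4' : κ i ≤ κ1 i + (3 * n + 3) := by exact_mod_cast h4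
      have h5' : κ1 i ≤ κ i + (3 * n + 3) := by exact_mod_cast h5
      rw [Finset.mem_Icc]
      omega
    refine (Finset.card_le_card hsub).trans ?_
    rw [Fintype.card_piFinset]
    calc _ ≤ ∏ _i : Fin n, (6 * n + 7) := Finset.prod_le_prod' fun i _ => by
          rw [Nat.card_Icc]; omega
      _ = _ := by simp
  calc I.card ≤ (6 * n + 7) ^ n * (I.image φ).card := Finset.card_le_mul_card_image _ _ hfib
    _ ≤ (6 * n + 7) ^ n * ((3 * n) ^ n * q ^ (n - 2)) := Nat.mul_le_mul_left _ hcard1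
    _ = _ := by unfold Cf; ring
end


section
variable {n : ℕ}

/-- standing hypotheses -/
structure Hyp (F : Fin n → EE n → ℝ) (N : ℝ) : Prop where
  st : Stg F
  N0 : 0 ≤ N
  db : Dbl F N
  NK : Real.log (K1 n (epn n)) ≤ epn n * N
  d0 : 16 ≤ aln n * dd n N
  dn : 2 * ((n : ℝ) + 4) ≤ aln n * dd n N

/-- grid cell of side `h` -/
def cell (h : ℝ) (κ : Fin n → ℕ) : Set (EE n) := {x | ∀ i, κ i * h ≤ x i + 1 / 2 ∧ x i + 1 / 2 ≤ (κ i + 1) * h}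

theorem cell_dist {s : ℝ} (hs : 0 < s) {τ : Fin n → ℕ} {x z : EE n} (hx : x ∈ cell s τ) (hz : z ∈ cell s τ) :
    dist x z ≤ n * s := by
  rw [EuclideanSpace.dist_eq]
  apply Real.sqrt_le_iff.2
  refine ⟨by positivity, ?_⟩
  calc ∑ i, dist (x i) (z i) ^ 2 ≤ ∑ _i : Fin n, s ^ 2 := Finset.sum_le_sum fun i _ => by
        gcongr
        rw [Real.dist_eq, abs_le]
        have h1 := hx i
        have h2 := hz i
        constructor <;> linarith
    _ = n * s ^ 2 := by simp
    _ ≤ n ^ 2 * s ^ 2 := by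
        gcongr
        exact_mod_cast Nat.le_self_pow (by norm_num) n
    _ = _ := by ring

theorem cell_anc {h : ℝ} (hh : 0 < h) {Q : ℕ} (hQ : 0 < Q) {κ : Fin n → ℕ} {x : EE n} (hx : x ∈ cell h κ) :
    x ∈ cell (Q * h) (fun i => κ i / Q) := by
  intro i
  obtain ⟨h1, h2⟩ := hx i
  have a1 : ((κ i / Q : ℕ) : ℝ) * Q ≤ κ i := by exact_mod_cast Nat.div_mul_le_self (κ i) Q
  have a2 : (κ i : ℝ) + 1 ≤ (((κ i / Q : ℕ) : ℝ) + 1) * Q := by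
    exact_mod_cast Nat.lt_mul_of_div_lt (Nat.lt_succ_self (κ i / Q)) hQ
  constructor
  · refine le_trans ?_ h1
    rw [← mul_assoc]
    gcongr
  · refine h2.trans ?_
    rw [← mul_assoc]
    gcongr

theorem local_count (hn : 2 ≤ n) {q : ℕ} (hq : 1 ≤ q) : ∃ ρ : ℝ, 0 < ρ ∧ ∀ {F : Fin n → EE n → ℝ} {N s : ℝ},
    Hyp F N → 0 < s → s ≤ ρ → ∀ (τ : Fin n → ℕ) (I : Finset (Fin n → ℕ)) (X : (Fin n → ℕ) → EE n),
    (∀ κ ∈ I, ∀ i, κ i / q = τ i) → (∀ κ ∈ I, X κ ∈ cell (s / q) κ) → (∀ κ ∈ I, X κ ∈ cube (0 : EE n) 1) →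
    (∀ κ ∈ I, ∃ r, 0 < r ∧ r ≤ ρ * s ∧ BadAt F N (epn n / 4) (X κ) r) → I.card ≤ Cf n * q ^ (n - 2) := by
  have hq0 : (0:ℝ) < q := by exact_mod_cast hq
  have hq1 : (1:ℝ) ≤ q := by exact_mod_cast hq
  have hn0 : (0:ℝ) < n := by exact_mod_cast (by omega : 0 < n)
  obtain ⟨β, hβ, hβ1, hg⟩ := geom (n := n) (by omega) (γ := 1 / q) (by positivity) (by
    rw [div_le_one hq0]; exact hq1)
  obtain ⟨ρ0, hρ0, hk⟩ := key_lemma hn hβ hβ1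
  refine ⟨min ρ0 (1 / (8 * n)), lt_min hρ0 (by positivity), ?_⟩
  intro F N s hH hs hsρ τ I X hτ hX hXc hbad
  have hcell : ∀ κ ∈ I, X κ ∈ cell s τ := by
    intro κ hκ
    have := cell_anc (by positivity) (Q := q) (by omega) (hX κ hκ)
    rw [mul_div_cancel₀ _ hq0.ne'] at this
    rwa [show (fun i => κ i / q) = τ from funext (hτ κ hκ)] at this
  rcases I.eq_empty_or_nonempty with rfl | ⟨κ0, hκ0⟩
  · simp
  have hPd : ∀ x ∈ X '' (I : Set (Fin n → ℕ)), ∀ z ∈ X '' (I : Set (Fin n → ℕ)), dist x z ≤ n * s := by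
    rintro _ ⟨κ, hκ, rfl⟩ _ ⟨κ', hκ', rfl⟩
    exact cell_dist hs (hcell κ hκ) (hcell κ' hκ')
  rcases hg hs ⟨X κ0, mem_image_of_mem _ hκ0⟩ hPd with ⟨y, L, hL, hP⟩ | ⟨S, hS, hc, y, hy, ν, hν, hz⟩
  · refine flat_count hn hq (h := s / q) (by positivity) (y := y) hL I X (fun κ hκ i => hX κ hκ i) ?_ ?_
    · intro κ hκ
      obtain ⟨l, hl, h⟩ := hP _ (mem_image_of_mem _ hκ)
      refine ⟨l, hl, h.trans (le_of_eq ?_)⟩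
      ring
    · intro κ hκ κ' hκ'
      rw [mul_div_cancel₀ _ hq0.ne']
      exact cell_dist hs (hcell κ hκ) (hcell κ' hκ')
  · exfalso
    refine hk (min_le_left _ (1 / (8 * (n:ℝ)))) (F := F) (N := N) (s := s) (S := S) (y := y) (ν := ν) ?_ hc hH.dn hν hz
    refine ⟨hH.st, hH.N0, hH.db, hH.NK, hH.d0, lt_min hρ0 (by positivity), min_le_right _ _, hs, hsρ, ?_, ?_, ?_, hc.le, hy⟩
    · intro x hx
      obtain ⟨κ, hκ, rfl⟩ := hS hx
      exact hXc κ hκ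
    · intro x hx
      obtain ⟨κ, hκ, rfl⟩ := hS hx
      exact hbad κ hκ
    · intro x hx z hz
      exact hPd x (hS hx) z (hS hz)

open Classical in
/-- indices of bad cubes -/
noncomputable def badI (q J : ℕ) (F : Fin n → EE n → ℝ) (N : ℝ) : Finset (Fin n → ℕ) :=
  (Fintype.piFinset (fun _ => Finset.range (q ^ J))).filter (fun κ => ∃ x ∈ cell ((1 / (q:ℝ)) ^ J) κ, ∃ r, 0 < r ∧ r ≤ (1 / (q:ℝ)) ^ J ∧
    BadAt F N (epn n / 4) x r)

theorem cell_cube {q J : ℕ} (hq : 1 ≤ q) {κ : Fin n → ℕ} (hκ : ∀ i, κ i < q ^ J) {x : EE n}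
    (hx : x ∈ cell ((1 / (q:ℝ)) ^ J) κ) : x ∈ cube (0 : EE n) 1 := by
  intro i
  have hq0 : (0:ℝ) < q := by exact_mod_cast hq
  obtain ⟨h1, h2⟩ := hx i
  have hp : 0 < (1 / (q:ℝ)) ^ J := by positivity
  have h3 : (κ i : ℝ) + 1 ≤ q ^ J := by exact_mod_cast hκ i
  have h4 : ((κ i : ℝ) + 1) * (1 / (q:ℝ)) ^ J ≤ q ^ J * (1 / (q:ℝ)) ^ J := by gcongr
  rw [← mul_pow, mul_one_div_cancel hq0.ne', one_pow] at h4
  have h5 : 0 ≤ (κ i : ℝ) * (1 / (q:ℝ)) ^ J := by positivity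
  rw [PiLp.zero_apply, sub_zero, abs_le]
  constructor <;> linarith

theorem bad_count (hn : 2 ≤ n) {q : ℕ} (hq : 2 ≤ q) : ∃ j0 : ℕ, ∀ {F : Fin n → EE n → ℝ} {N : ℝ}, Hyp F N → ∀ m : ℕ,
    (badI q (2 * j0 + m) F N).card ≤ q ^ (2 * n * j0) * (Cf n * q ^ (n - 2)) ^ m := by
  classical
  obtain ⟨ρ, hρ, hl⟩ := local_count hn (q := q) (by omega)
  have hq0 : (0:ℝ) < q := by exact_mod_cast (by omega : 0 < q)
  have hq1 : (1:ℝ) / q < 1 := by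
    rw [div_lt_one hq0]; exact_mod_cast (by omega : 1 < q)
  obtain ⟨j0, hj0⟩ := exists_pow_lt_of_lt_one hρ hq1
  refine ⟨j0, ?_⟩
  intro F N hH m
  set J := 2 * j0 + m with hJ
  set Bd := badI q J F N with hB
  let T : ℕ → Finset (Fin n → ℕ) := fun j => Bd.image (fun κ i => κ i / q ^ (J - j))
  have hTs : ∀ j, j < J → (T (j + 1)).image (fun κ i => κ i / q) = T j := by
    intro j hj
    simp only [T, Finset.image_image]
    congr 1
    funext κ i
    simp only [Function.comp]
    rw [Nat.div_div_eq_div_mul, ← pow_succ]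
    congr 2
    omega
  have hstep : ∀ j w, j < J → (∀ τ, ((T (j + 1)).filter (fun κ => (fun i => κ i / q) = τ)).card ≤ w) →
      (T (j + 1)).card ≤ w * (T j).card := by
    intro j w hj h
    rw [← hTs j hj]
    exact Finset.card_le_mul_card_image _ _ (fun τ _ => h τ)
  have htriv : ∀ j, j < J → (T (j + 1)).card ≤ q ^ n * (T j).card := by
    intro j hj
    apply hstep j _ hj
    intro τ
    have hsub : (T (j + 1)).filter (fun κ => (fun i => κ i / q) = τ) ⊆
        Fintype.piFinset (fun i => Finset.Ico (τ i * q) (τ i * q + q)) := by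
      intro κ hκ
      obtain ⟨_, h2⟩ := Finset.mem_filter.1 hκ
      rw [Fintype.mem_piFinset]
      intro i
      have h3 : κ i / q = τ i := congrFun h2 i
      have h4 := Nat.div_add_mod (κ i) q
      have h5 := Nat.mod_lt (κ i) (by omega : q > 0)
      rw [h3, mul_comm] at h4
      rw [Finset.mem_Ico]
      omega
    refine (Finset.card_le_card hsub).trans ?_
    rw [Fintype.card_piFinset]
    simp
  have hgood : ∀ j, j0 ≤ j → j + j0 ≤ J → j < J → (T (j + 1)).card ≤ Cf n * q ^ (n - 2) * (T j).card := by
    intro j h1 h2 hj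
    apply hstep j _ hj
    intro τ
    have hex : ∀ κ ∈ T (j + 1), ∃ x ∈ cell ((1 / (q:ℝ)) ^ j / q) κ, x ∈ cube (0 : EE n) 1 ∧
        ∃ r, 0 < r ∧ r ≤ ρ * (1 / (q:ℝ)) ^ j ∧ BadAt F N (epn n / 4) x r := by
      intro κ hκ
      obtain ⟨κ1, hκ1, rfl⟩ := Finset.mem_image.1 hκ
      obtain ⟨hm, x, hx, r, hr, hr1, hb⟩ := Finset.mem_filter.1 hκ1
      rw [Fintype.mem_piFinset] at hm
      refine ⟨x, ?_, cell_cube (by omega) (fun i => Finset.mem_range.1 (hm i)) hx, r, hr, hr1.trans ?_, hb⟩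
      · have := cell_anc (by positivity) (Q := q ^ (J - (j + 1))) (Nat.pow_pos (by omega)) hx
        have e : (1 / (q:ℝ)) ^ j / q = ((q ^ (J - (j + 1)) : ℕ) : ℝ) * (1 / (q:ℝ)) ^ J := by
          have e1 : (1 / (q:ℝ)) ^ J = (1 / (q:ℝ)) ^ (J - (j + 1)) * ((1 / (q:ℝ)) ^ j * (1 / q)) := by
            rw [← pow_succ, ← pow_add]
            congr 1
            omega
          rw [e1, ← mul_assoc, Nat.cast_pow, ← mul_pow, mul_one_div_cancel hq0.ne', one_pow]
          ring
        rw [e]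
        exact this
      · have e1 : (1 / (q:ℝ)) ^ J = (1 / (q:ℝ)) ^ (J - j) * (1 / (q:ℝ)) ^ j := by
          rw [← pow_add]
          congr 1
          omega
        rw [e1]
        gcongr
        refine le_trans ?_ hj0.le
        exact pow_le_pow_of_le_one (by positivity) hq1.le (by omega)
    choose! X hX1 hX2 hX3 using hex
    refine hl hH (s := (1 / (q:ℝ)) ^ j) (by positivity) ?_ τ _ X ?_ ?_ ?_ ?_
    · exact (pow_le_pow_of_le_one (by positivity) hq1.le h1).trans hj0.le
    · intro κ hκ i
      exact congrFun (Finset.mem_filter.1 hκ).2 i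
    · exact fun κ hκ => hX1 κ (Finset.mem_filter.1 hκ).1
    · exact fun κ hκ => hX2 κ (Finset.mem_filter.1 hκ).1
    · exact fun κ hκ => hX3 κ (Finset.mem_filter.1 hκ).1
  have hT0 : (T 0).card ≤ 1 := by
    rw [Finset.card_le_one]
    have : ∀ a ∈ T 0, a = fun _ => 0 := by
      intro a ha
      obtain ⟨κ1, hκ1, rfl⟩ := Finset.mem_image.1 ha
      have hm := (Finset.mem_filter.1 hκ1).1
      rw [Fintype.mem_piFinset] at hm
      funext i
      exact Nat.div_eq_of_lt (Finset.mem_range.1 (hm i))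
    intro a ha b hb
    rw [this a ha, this b hb]
  have p1 : ∀ i, i ≤ j0 → (T i).card ≤ q ^ (n * i) := by
    intro i
    induction i with
    | zero => intro _; simpa using hT0
    | succ i ih =>
      intro hi
      refine (htriv i (by omega)).trans ?_
      rw [mul_add, mul_one, pow_add, mul_comm]
      exact Nat.mul_le_mul_right _ (ih (by omega))
  have p2 : ∀ i, i ≤ m → (T (j0 + i)).card ≤ q ^ (n * j0) * (Cf n * q ^ (n - 2)) ^ i := by
    intro i
    induction i with
    | zero => intro _; simpa using p1 j0 le_rfl
    | succ i ih =>
      intro hi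
      rw [← add_assoc]
      by_cases hlt : j0 + i < J
      · refine (hgood (j0 + i) (by omega) (by omega) hlt).trans ?_
        calc _ ≤ Cf n * q ^ (n - 2) * (q ^ (n * j0) * (Cf n * q ^ (n - 2)) ^ i) := Nat.mul_le_mul_left _ (ih (by omega))
          _ = _ := by ring
      · omega
  have p3 : ∀ i, i ≤ j0 → (T (j0 + m + i)).card ≤ q ^ (n * j0) * (Cf n * q ^ (n - 2)) ^ m * q ^ (n * i) := by
    intro i
    induction i with
    | zero => intro _; simpa using p2 m le_rfl
    | succ i ih =>
      intro hi
      refine (htriv (j0 + m + i) (by omega)).trans ?_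
      calc _ ≤ q ^ n * (q ^ (n * j0) * (Cf n * q ^ (n - 2)) ^ m * q ^ (n * i)) := Nat.mul_le_mul_left _ (ih (by omega))
        _ = _ := by ring
  have hTJ : T J = Bd := by
    simp [T]
  have := p3 j0 le_rfl
  rw [show j0 + m + j0 = J by omega, hTJ] at this
  refine this.trans (le_of_eq ?_)
  ring
end


section
variable {n : ℕ}

theorem hc_eq {s : ℝ} (hs : 0 < s) : ∃ μ : OuterMeasure (EE n), ∀ E, hausdorffContent s E = μ E :=
  ⟨OuterMeasure.ofFunction (fun U : Set (EE n) => Metric.ediam U ^ s) (by simp [hs]), fun _ => rfl⟩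

theorem hc_mono {s : ℝ} {E E' : Set (EE n)} (h : E ⊆ E') : hausdorffContent s E ≤ hausdorffContent s E' := by
  unfold hausdorffContent
  refine iInf_mono fun U => ?_
  exact iInf_mono' fun h' => ⟨h.trans h', le_rfl⟩

theorem hc_finset {s : ℝ} (hs : 0 < s) {ι : Type*} (I : Finset ι) (E : ι → Set (EE n)) :
    hausdorffContent s (⋃ i ∈ I, E i) ≤ ∑ i ∈ I, hausdorffContent s (E i) := by
  obtain ⟨μ, hμ⟩ := hc_eq (n := n) hs
  simp only [hμ]
  exact measure_biUnion_finset_le I E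

theorem hc_empty {s : ℝ} (hs : 0 < s) : hausdorffContent s (∅ : Set (EE n)) = 0 := by
  obtain ⟨μ, hμ⟩ := hc_eq (n := n) hs
  rw [hμ, measure_empty]

theorem hc_lt_top {s : ℝ} (hs : 0 < s) {E : Set (EE n)} (hE : Bornology.IsBounded E) : hausdorffContent s E < ⊤ := by
  have h1 : hausdorffContent s E ≤ ∑' i : ℕ, EMetric.diam (if i = 0 then E else ∅) ^ s := by
    unfold hausdorffContent
    refine iInf₂_le_of_le (fun i => if i = 0 then E else ∅) ?_ le_rfl
    exact fun x hx => mem_iUnion.2 ⟨0, by simpa using hx⟩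
  refine h1.trans_lt ?_
  rw [tsum_eq_single 0 (by
    intro b hb
    have : EMetric.diam (∅ : Set (EE n)) = 0 := Metric.ediam_empty
    simp [hb, hs, this])]
  simp only [if_true]
  apply ENNReal.rpow_lt_top_of_nonneg hs.le
  exact (Metric.isBounded_iff_ediam_ne_top.1 hE)

theorem hc_scale {s : ℝ} (hs : 0 < s) {l : ℝ} (hl : 0 < l) (p : EE n) (E : Set (EE n)) :
    hausdorffContent s ((fun x => p + l • x) '' E) ≤ ENNReal.ofReal (l ^ s) * hausdorffContent s E := by
  have hK : ENNReal.ofReal (l ^ s) ≠ 0 := by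
    rw [Ne, ENNReal.ofReal_eq_zero, not_le]; positivity
  conv_rhs => unfold hausdorffContent
  rw [ENNReal.mul_iInf_of_ne hK ENNReal.ofReal_ne_top]
  refine le_iInf fun U => ?_
  rw [ENNReal.mul_iInf_of_ne hK ENNReal.ofReal_ne_top]
  refine le_iInf fun hU => ?_
  rw [← ENNReal.tsum_mul_left]
  unfold hausdorffContent
  refine iInf₂_le_of_le (fun i => (fun x => p + l • x) '' U i) ?_ ?_
  · rw [← image_iUnion]; exact image_mono hU
  · refine ENNReal.tsum_le_tsum fun i => ?_
    rw [← ENNReal.ofReal_rpow_of_pos hl, ← ENNReal.mul_rpow_of_nonneg _ _ hs.le]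
    gcongr
    have hL : LipschitzWith (Real.toNNReal l) (fun x : EE n => p + l • x) := by
      apply LipschitzWith.of_dist_le_mul
      intro x y
      rw [dist_add_left, dist_smul₀, Real.norm_of_nonneg hl.le, Real.coe_toNNReal _ hl.le]
    exact hL.ediam_image_le (U i)

theorem fderiv_resc (u : EE n → ℝ) (p : EE n) (l : ℝ) (x : EE n) :
    fderiv ℝ (fun x => u (p + l • x)) x = l • fderiv ℝ u (p + l • x) := by
  have h1 : (fun x => u (p + l • x)) = fun x => (fun z => u (p + z)) (l • x) := rfl
  rw [h1, fderiv_comp_smul (f := fun z => u (p + z)), fderiv_comp_add_left]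

theorem harm_resc {u : EE n → ℝ} {p : EE n} {l : ℝ} {U V : Set (EE n)} (hu : IsHarmonicOn u U)
    (hV : ∀ x ∈ V, p + l • x ∈ U) : IsHarmonicOn (fun x => u (p + l • x)) V := by
  refine ⟨?_, ?_⟩
  · refine hu.1.comp (t := U) ?_ hV
    exact (contDiff_const.add ((contDiff_id (𝕜 := ℝ)).const_smul l)).contDiffOn
  · intro x hx
    have h0 := hu.2 _ (hV x hx)
    calc _ = ∑ i : Fin n, l * (l * fderiv ℝ (fun y => fderiv ℝ u y (EuclideanSpace.single i 1)) (p + l • x) (EuclideanSpace.single i 1)) := by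
          refine Finset.sum_congr rfl fun i _ => ?_
          have h1 : (fun y => fderiv ℝ (fun x => u (p + l • x)) y (EuclideanSpace.single i 1)) =
              l • fun y => (fun z => fderiv ℝ u z (EuclideanSpace.single i 1)) (p + l • y) := by
            funext y
            rw [fderiv_resc]
            simp
          rw [h1, fderiv_const_smul_field, Pi.smul_apply, fderiv_resc (fun z => fderiv ℝ u z (EuclideanSpace.single i 1))]
          simp
      _ = l * (l * ∑ i : Fin n, fderiv ℝ (fun y => fderiv ℝ u y (EuclideanSpace.single i 1)) (p + l • x) (EuclideanSpace.single i 1)) := by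
          rw [Finset.mul_sum, Finset.mul_sum]
      _ = 0 := by rw [h0]; simp

theorem dual_norm (L : EE n →L[ℝ] ℝ) : ‖L‖ = Real.sqrt (∑ i, L (EuclideanSpace.single i 1) ^ 2) := by
  set g := (InnerProductSpace.toDual ℝ (EE n)).symm L with hg
  have h1 : ‖L‖ = ‖g‖ := by rw [hg, LinearIsometryEquiv.norm_map]
  have h2 : ∀ i, L (EuclideanSpace.single i 1) = g i := by
    intro i
    have : ⟪g, EuclideanSpace.single i 1⟫ = L (EuclideanSpace.single i 1) := by
      rw [hg, InnerProductSpace.toDual_symm_apply]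
    rw [← this, EuclideanSpace.inner_single_right]
    simp
  rw [h1, EuclideanSpace.norm_eq]
  simp [h2]

theorem globalize (hn : 1 ≤ n) {u : EE n → ℝ} (hu : IsHarmonicOn u (ball 0 (100 * n))) :
    ∃ F : Fin n → EE n → ℝ, SF F ∧ HF F (ball 0 (90 * n)) ∧ ∀ x ∈ ball (0 : EE n) (90 * n), ‖fderiv ℝ u x‖ = gn F x := by
  have hn1 : (1:ℝ) ≤ n := by exact_mod_cast hn
  let χ : ContDiffBump (0 : EE n) := ⟨91 * n, 95 * n, by linarith, by linarith⟩
  let f : EE n → ℝ := fun x => χ x * u x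
  have hf : Sm f := by
    show ContDiff ℝ (⊤ : ℕ∞) f
    rw [contDiff_iff_contDiffAt]
    intro x
    by_cases hx : x ∈ ball (0 : EE n) (100 * n)
    · exact χ.contDiff.contDiffAt.mul (hu.1.contDiffAt (isOpen_ball.mem_nhds hx))
    · have : f =ᶠ[nhds x] fun _ => 0 := by
        have hx2 : x ∈ (closedBall (0 : EE n) (95 * n))ᶜ := by
          rw [mem_compl_iff, mem_closedBall, not_le]
          rw [mem_ball, not_lt] at hx
          linarith
        filter_upwards [isClosed_closedBall.isOpen_compl.mem_nhds hx2] with z hz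
        have : χ z = 0 := by
          apply χ.zero_of_le_dist
          rw [mem_compl_iff, mem_closedBall, not_le] at hz
          exact hz.le
        simp [f, this]
      exact contDiffAt_const.congr_of_eventuallyEq this
  have heq : ∀ x ∈ ball (0 : EE n) (90 * n), f =ᶠ[nhds x] u := by
    intro x hx
    filter_upwards [isOpen_ball.mem_nhds hx] with z hz
    have : χ z = 1 := by
      apply χ.one_of_mem_closedBall
      rw [mem_ball] at hz
      rw [mem_closedBall]
      show dist z 0 ≤ 91 * n
      linarith
    simp [f, this]
  refine ⟨fun k => pd (EuclideanSpace.single k 1) f, fun k => hf.pd _, ?_, ?_⟩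
  · intro k
    apply lap_pd_zero hf _ isOpen_ball
    intro x hx
    rw [← hu.2 x (ball_subset_ball (by linarith) hx)]
    unfold lap
    refine Finset.sum_congr rfl fun i _ => ?_
    have h1 : pd (EuclideanSpace.single i 1) f =ᶠ[nhds x] fun y => fderiv ℝ u y (EuclideanSpace.single i 1) := by
      filter_upwards [(heq x hx).fderiv (𝕜 := ℝ)] with z hz
      unfold pd
      rw [hz]
    unfold pd at h1 ⊢
    rw [h1.fderiv_eq]
  · intro x hx
    rw [dual_norm]
    unfold gn sq2 pd
    simp only [(heq x hx).fderiv_eq]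
end


section
variable {n : ℕ}

/-- admissible size of N -/
structure Nok (n : ℕ) (N : ℝ) : Prop where
  N0 : 0 ≤ N
  NK : Real.log (K1 n (epn n)) ≤ epn n * N
  d0 : 16 ≤ aln n * dd n N
  dn : 2 * ((n : ℝ) + 4) ≤ aln n * dd n N

/-- gradient family represents gradient of u -/
def GRep (u : EE n → ℝ) (F : Fin n → EE n → ℝ) : Prop := ∀ x ∈ ball (0 : EE n) (90 * n), ‖fderiv ℝ u x‖ = gn F x

theorem GRep.sup {u : EE n → ℝ} {F : Fin n → EE n → ℝ} (h : GRep u F) {x : EE n} {r : ℝ}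
    (hs : ball x r ⊆ ball 0 (90 * n)) : supGrad u (ball x r) = sg F x r := by
  unfold supGrad sg
  congr 1
  exact image_congr fun z hz => h z (hs hz)

theorem GRep.dbl {u : EE n → ℝ} {F : Fin n → EE n → ℝ} (h : GRep u F) (hF : Stg F) {N : ℝ}
    (hN : cubeDoublingIndex u 0 1 ≤ N) : Dbl F N := by
  intro x hx r hr hr1
  have hn2 := hF.n2'
  obtain ⟨B, hB⟩ := hF.bdd
  have key : ∀ x ∈ cube (0 : EE n) 1, ∀ r : ℝ, 0 < r → r ≤ 1 →
      supGrad u (ball x (10 * n * r)) / supGrad u (ball x r) = sg F x (10 * n * r) / sg F x r := by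
    intro x hx r hr hr1
    rw [h.sup (cube_sub hx (by nlinarith)), h.sup (cube_sub hx (by nlinarith))]
  have hbd : BddAbove {t | ∃ x ∈ cube (0 : EE n) 1, ∃ r : ℝ, 0 < r ∧ r ≤ 1 ∧
    t = Real.log (supGrad u (ball x (10 * n * r)) / supGrad u (ball x r))} := by
    refine ⟨1 + B, ?_⟩
    rintro t ⟨x, hx, r, hr, hr1, rfl⟩
    rw [key x hx r hr hr1]
    have hp := hF.sg_pos hx hr (by linarith)
    have h1 := hB x hx r hr hr1
    have h2 : (sg F x (10 * n * r) / sg F x r) ^ 2 ≤ B := by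
      rw [div_pow, div_le_iff₀ (by positivity)]; exact h1
    have h3 := Real.log_le_self (x := sg F x (10 * n * r) / sg F x r) (div_nonneg (sg_nonneg _ _ _) hp.le)
    nlinarith [sq_nonneg (sg F x (10 * n * r) / sg F x r - 1)]
  have hp := hF.sg_pos hx hr (by linarith)
  have hp2 : 0 < sg F x (10 * n * r) := hp.trans_le (hF.sm.sg_mono (ball_subset_ball (by nlinarith)))
  have h1 : Real.log (supGrad u (ball x (10 * n * r)) / supGrad u (ball x r)) ≤ N :=
    (le_csSup hbd ⟨x, hx, r, hr, hr1, rfl⟩).trans hN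
  rw [key x hx r hr hr1, Real.log_le_iff_le_exp (by positivity), div_le_iff₀ hp] at h1
  exact h1

/-- center of grid cell -/
noncomputable def ctr (l : ℝ) (κ : Fin n → ℕ) : EE n := WithLp.toLp 2 (fun i => (κ i + 1 / 2) * l - 1 / 2)

theorem ctr_mem {l : ℝ} (hl : 0 < l) {κ : Fin n → ℕ} {x : EE n} :
    ctr l κ + l • x ∈ cell l κ ↔ x ∈ cube (0 : EE n) 1 := by
  refine forall_congr' fun i => ?_
  simp only [PiLp.add_apply, PiLp.smul_apply, smul_eq_mul, PiLp.zero_apply, sub_zero, abs_le, ctr]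
  constructor
  · rintro ⟨h1, h2⟩
    constructor
    · by_contra h; push Not at h; nlinarith
    · by_contra h; push Not at h; nlinarith
  · rintro ⟨h1, h2⟩
    constructor <;> nlinarith

theorem image_ball {l : ℝ} (hl : 0 < l) (p x : EE n) (r : ℝ) :
    (fun z => p + l • z) '' ball x r = ball (p + l • x) (l * r) := by
  ext z
  constructor
  · rintro ⟨y, hy, rfl⟩
    rw [mem_ball] at hy ⊢
    rw [dist_add_left, dist_smul₀, Real.norm_of_nonneg hl.le]
    gcongr
  · intro hz
    refine ⟨l⁻¹ • (z - p), ?_, ?_⟩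
    · rw [mem_ball] at hz ⊢
      have e : z = p + l • (l⁻¹ • (z - p)) := by rw [smul_smul, mul_inv_cancel₀ hl.ne', one_smul]; abel
      rw [e, dist_add_left, dist_smul₀, Real.norm_of_nonneg hl.le] at hz
      exact lt_of_mul_lt_mul_left hz hl.le
    · show p + l • (l⁻¹ • (z - p)) = z
      rw [smul_smul, mul_inv_cancel₀ hl.ne', one_smul]; abel

theorem norm_resc (u : EE n → ℝ) (p : EE n) {l : ℝ} (hl : 0 < l) (x : EE n) :
    ‖fderiv ℝ (fun x => u (p + l • x)) x‖ = l * ‖fderiv ℝ u (p + l • x)‖ := by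
  rw [fderiv_resc, norm_smul, Real.norm_of_nonneg hl.le]

theorem sup_resc (u : EE n → ℝ) (p : EE n) {l : ℝ} (hl : 0 < l) (x : EE n) (r : ℝ) :
    supGrad (fun x => u (p + l • x)) (ball x r) = l * supGrad u (ball (p + l • x) (l * r)) := by
  unfold supGrad
  rw [← image_ball hl, image_image, ← smul_eq_mul, ← Real.sSup_smul_of_nonneg hl.le, ← image_smul, image_image]
  congr 1
  exact image_congr fun z _ => norm_resc u p hl z

theorem index_resc {u : EE n → ℝ} {F : Fin n → EE n → ℝ} (h : GRep u F) (hF : Stg F) {p : EE n} {l K : ℝ}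
    (hl : 0 < l) (hl1 : l ≤ 1) (hK : 0 ≤ K) (hp : ∀ x ∈ cube (0 : EE n) 1, p + l • x ∈ cube (0 : EE n) 1)
    (hd : ∀ x ∈ cube (0 : EE n) 1, ∀ r, 0 < r → r ≤ l →
      sg F (p + l • x) (10 * n * r) ≤ Real.exp K * sg F (p + l • x) r) :
    cubeDoublingIndex (fun x => u (p + l • x)) 0 1 ≤ K := by
  have hn2 := hF.n2'
  unfold cubeDoublingIndex
  apply Real.sSup_le _ hK
  rintro t ⟨x, hx, r, hr, hr1, rfl⟩
  have hx' := hp x hx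
  have hlr : 0 < l * r := by positivity
  have hlr1 : l * r ≤ 1 := by nlinarith
  rw [sup_resc u p hl, sup_resc u p hl, h.sup (cube_sub hx' (by nlinarith)), h.sup (cube_sub hx' (by nlinarith)),
    mul_div_mul_left _ _ hl.ne', show l * (10 * n * r) = 10 * n * (l * r) by ring]
  have hp1 := hF.sg_pos hx' hlr (by linarith)
  have hp2 : 0 < sg F (p + l • x) (10 * n * (l * r)) := hp1.trans_le (hF.sm.sg_mono (ball_subset_ball (by nlinarith)))
  rw [Real.log_le_iff_le_exp (by positivity), div_le_iff₀ hp1]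
  exact hd x hx _ hlr (by nlinarith)

theorem cube_bdd : cube (0 : EE n) 1 ⊆ closedBall 0 n := fun x hx => by
  rw [mem_closedBall, dist_zero_right]; exact cube_norm hx

theorem bdd_resc {u : EE n → ℝ} {F : Fin n → EE n → ℝ} (h : GRep u F) (hF : Stg F) {p : EE n} {l : ℝ}
    (hl : 0 < l) (hp : ∀ x ∈ cube (0 : EE n) 1, p + l • x ∈ cube (0 : EE n) 1) :
    BddAbove ((fun x => ‖fderiv ℝ (fun x => u (p + l • x)) x‖) '' cube 0 1) := by
  have hn2 := hF.n2'
  refine ⟨l * sg F 0 (90 * n), ?_⟩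
  rintro _ ⟨x, hx, rfl⟩
  have hm : p + l • x ∈ ball (0 : EE n) (90 * n) := by
    have := cube_bdd (hp x hx)
    rw [mem_closedBall] at this
    rw [mem_ball]; linarith
  show ‖fderiv ℝ (fun x => u (p + l • x)) x‖ ≤ _
  rw [norm_resc u p hl, h _ hm]
  gcongr
  exact hF.sm.le_sg hm

theorem sup_lower {u : EE n → ℝ} {F : Fin n → EE n → ℝ} (h : GRep u F) (hF : Stg F) {N : ℝ} (hN : 0 ≤ N)
    (hD : Dbl F N) {p : EE n} {l : ℝ} (hl : 0 < l) (hl1 : l ≤ 1)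
    (hp : ∀ x ∈ cube (0 : EE n) 1, p + l • x ∈ cube (0 : EE n) 1) :
    supGrad u (cube 0 1) ≤ Real.exp ((1 + Real.log (4 * n / l)) * N) * (l⁻¹ * supGrad (fun x => u (p + l • x)) (cube 0 1)) := by
  have hn2 := hF.n2'
  have h0 : (0 : EE n) ∈ cube (0 : EE n) 1 := by intro i; simp
  have hpc : p ∈ cube (0 : EE n) 1 := by simpa using hp 0 h0
  have h1 : supGrad u (cube 0 1) ≤ sg F p (2 * n) := by
    apply Real.sSup_le _ (sg_nonneg _ _ _)
    rintro _ ⟨x, hx, rfl⟩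
    have hm : x ∈ ball p (2 * n) := by
      have := cube_dist hx hpc
      rw [mem_ball]
      by_contra hc
      push Not at hc
      nlinarith
    show ‖fderiv ℝ u x‖ ≤ _
    rw [h x (cube_sub hpc (by linarith) hm)]
    exact hF.sm.le_sg hm
  have h2 := dbl_pow hF.n2 hF.sm hN hD hpc (r := l / 2) (R := 2 * n) (by positivity) (by linarith) (by linarith)
  have hb := bdd_resc h hF hl hp
  have h3 : sg F p (l / 2) ≤ l⁻¹ * supGrad (fun x => u (p + l • x)) (cube 0 1) := by
    have hnn : 0 ≤ supGrad (fun x => u (p + l • x)) (cube 0 1) := Real.sSup_nonneg (by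
      rintro _ ⟨z, _, rfl⟩; exact norm_nonneg _)
    apply sg_le (by positivity)
    intro z hz
    have e : ball p (l / 2) = (fun z => p + l • z) '' ball 0 (1 / 2) := by
      rw [image_ball hl]; simp; congr 1
    rw [e] at hz
    obtain ⟨y, hy, rfl⟩ := hz
    have hyc : y ∈ cube (0 : EE n) 1 := by
      intro i
      rw [mem_ball, dist_zero_right] at hy
      have := coord_le y i
      rw [PiLp.zero_apply, sub_zero]
      linarith
    have hm : p + l • y ∈ ball (0 : EE n) (90 * n) := by
      have := cube_bdd (hp y hyc)
      rw [mem_closedBall] at this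
      rw [mem_ball]; linarith
    show gn F (p + l • y) ≤ _
    rw [← h _ hm, ← div_eq_inv_mul, le_div_iff₀ hl, mul_comm, ← norm_resc u p hl]
    exact le_csSup hb (mem_image_of_mem _ hyc)
  have hsn := sg_nonneg F p (l / 2)
  have hL := log10n hF.n2
  have hb4 : 1 ≤ 4 * n / l := by
    rw [le_div_iff₀ hl]; linarith
  have h4 : Real.exp N * (2 * n / (l / 2)) ^ dd n N ≤ Real.exp ((1 + Real.log (4 * n / l)) * N) := by
    rw [show 2 * (n:ℝ) / (l / 2) = 4 * n / l by field_simp; norm_num, Real.rpow_def_of_pos (by positivity), ← Real.exp_add]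
    apply Real.exp_le_exp.2
    have : dd n N ≤ N := by
      unfold dd
      exact div_le_self hN hL
    have := mul_le_mul_of_nonneg_left this (Real.log_nonneg hb4)
    linarith
  calc _ ≤ _ := h1
    _ ≤ _ := h2
    _ ≤ _ := by gcongr
end


section
variable {n : ℕ}

theorem grid_cover {Q : ℕ} (hQ : 1 ≤ Q) {x : EE n} (hx : x ∈ cube (0 : EE n) 1) :
    ∃ κ : Fin n → ℕ, (∀ i, κ i < Q) ∧ x ∈ cell (1 / (Q:ℝ)) κ := by
  have hQ0 : (0:ℝ) < Q := by exact_mod_cast hQ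
  have hi : ∀ i, ∃ k : ℕ, k < Q ∧ (k:ℝ) * (1 / (Q:ℝ)) ≤ x i + 1 / 2 ∧ x i + 1 / 2 ≤ (k + 1) * (1 / (Q:ℝ)) := by
    intro i
    have h1 := hx i
    rw [PiLp.zero_apply, sub_zero, abs_le] at h1
    have h0 : 0 ≤ (x i + 1 / 2) * Q := mul_nonneg (by linarith) hQ0.le
    have hle : (x i + 1 / 2) * Q ≤ Q := by nlinarith
    have key : ∃ k : ℕ, k < Q ∧ (k:ℝ) ≤ (x i + 1 / 2) * Q ∧ (x i + 1 / 2) * Q ≤ k + 1 := by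
      rcases lt_or_ge ⌊(x i + 1 / 2) * Q⌋₊ Q with h | h
      · exact ⟨_, h, Nat.floor_le h0, (Nat.lt_floor_add_one _).le⟩
      · refine ⟨Q - 1, by omega, ?_, ?_⟩
        · have : (Q:ℝ) ≤ (x i + 1 / 2) * Q := by
            refine le_trans ?_ (Nat.floor_le h0)
            exact Nat.cast_le.2 h
          rw [Nat.cast_sub hQ]; push_cast; linarith
        · rw [Nat.cast_sub hQ]; push_cast; linarith
    obtain ⟨k, hk, h2, h3⟩ := key
    refine ⟨k, hk, ?_, ?_⟩
    · rw [mul_one_div, div_le_iff₀ hQ0]; exact h2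
    · rw [mul_one_div, le_div_iff₀ hQ0]; exact h3
  choose κ h1 h2 using hi
  exact ⟨κ, h1, h2⟩

theorem M_mono {δ N N' a a' : ℝ} (hN : N ≤ N') (ha : a' ≤ a) : Mquantity n δ N a ≤ Mquantity n δ N' a' := by
  unfold Mquantity
  refine iSup_mono fun u => ?_
  refine iSup_mono' fun h => ⟨⟨h.1, h.2.trans hN⟩, ?_⟩
  unfold sublevelContent
  apply hc_mono
  rintro x ⟨hx, h1⟩
  refine ⟨hx, h1.trans_le ?_⟩
  have : 0 ≤ supGrad u (cube 0 1) := Real.sSup_nonneg (by rintro _ ⟨z, _, rfl⟩; exact norm_nonneg _)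
  gcongr

theorem le_M {δ N a : ℝ} {u : EE n → ℝ} (h1 : IsHarmonicOn u (ball 0 (100 * n))) (h2 : cubeDoublingIndex u 0 1 ≤ N) :
    sublevelContent n δ u a ≤ Mquantity n δ N a := by
  unfold Mquantity
  exact le_iSup₂_of_le u ⟨h1, h2⟩ le_rfl

/-- scale loss -/
noncomputable def LL (n Q : ℕ) : ℝ := 1 + Real.log (4 * n / (1 / (Q:ℝ)))

theorem one_step_u (hn : 2 ≤ n) {δ : ℝ} (hδ : 0 < δ) {q J w : ℕ} (hq : 2 ≤ q) (hJ : 1 ≤ J) {N : ℝ} (hN : Nok n N)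
    (hw : ∀ F : Fin n → EE n → ℝ, Hyp F N → (badI q J F N).card ≤ w) (hwA : w ≤ (q ^ J) ^ n) (a : ℝ)
    {u : EE n → ℝ} (hu : IsHarmonicOn u (ball 0 (100 * n))) (hui : cubeDoublingIndex u 0 1 ≤ N) :
    sublevelContent n δ u a ≤ ENNReal.ofReal ((1 / ((q ^ J : ℕ) : ℝ)) ^ ((n:ℝ) - 2 + δ)) *
      ((((q ^ J) ^ n - w : ℕ) : ℝ≥0∞) * Mquantity n δ (N / (1 + epn n / 4)) (a - LL n (q ^ J) * N)
        + (w : ℝ≥0∞) * Mquantity n δ N (a - LL n (q ^ J) * N)) := by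
  classical
  have hn2 : (2:ℝ) ≤ n := by exact_mod_cast hn
  have hs : 0 < (n:ℝ) - 2 + δ := by linarith
  obtain ⟨F, hF1, hF2, hF3⟩ := globalize (by omega) hu
  have hrep : GRep u F := hF3
  by_cases hnd : ∃ z ∈ cube (0 : EE n) 1, 0 < gn F z
  swap
  · have : {x ∈ cube (0 : EE n) 1 | ‖fderiv ℝ u x‖ < Real.exp (-a) * supGrad u (cube 0 1)} = ∅ := by
      push Not at hnd
      have h0 : supGrad u (cube 0 1) ≤ 0 := by
        apply Real.sSup_le _ le_rfl
        rintro _ ⟨x, hx, rfl⟩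
        show ‖fderiv ℝ u x‖ ≤ 0
        rw [hrep x (by
          have := cube_bdd hx
          rw [mem_closedBall] at this
          rw [mem_ball]; linarith)]
        exact hnd x hx
      rw [eq_empty_iff_forall_notMem]
      rintro x ⟨_, hx⟩
      have h1 : Real.exp (-a) * supGrad u (cube 0 1) ≤ 0 := mul_nonpos_of_nonneg_of_nonpos (Real.exp_pos _).le h0
      linarith [norm_nonneg (fderiv ℝ u x)]
    unfold sublevelContent
    rw [this, hc_empty hs]
    exact zero_le
  have hst : Stg F := ⟨hn, hF1, hF2, hnd⟩
  have hdb : Dbl F N := hrep.dbl hst hui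
  have hH : Hyp F N := ⟨hst, hN.N0, hdb, hN.NK, hN.d0, hN.dn⟩
  have hbw := hw F hH
  obtain ⟨Q, hQ⟩ : ∃ Q : ℕ, Q = q ^ J := ⟨_, rfl⟩
  have hQ2 : 2 ≤ Q := by
    rw [hQ]
    calc 2 ≤ q := hq
      _ = q ^ 1 := (pow_one q).symm
      _ ≤ q ^ J := Nat.pow_le_pow_right (by omega) hJ
  have hQ0 : (0:ℝ) < Q := by exact_mod_cast (by omega : 0 < Q)
  have hQ2' : (2:ℝ) ≤ Q := by exact_mod_cast hQ2
  obtain ⟨l, hl⟩ : ∃ l : ℝ, l = 1 / Q := ⟨_, rfl⟩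
  have hl0 : 0 < l := by rw [hl]; positivity
  have hl2 : l ≤ 1 / 2 := by rw [hl]; gcongr
  have hlJ : l = (1 / (q:ℝ)) ^ J := by rw [hl, hQ]; push_cast; rw [_root_.one_div_pow]
  rw [← hQ] at hwA ⊢
  rw [← hl]
  set M1 := Mquantity n δ (N / (1 + epn n / 4)) (a - LL n Q * N) with hM1
  set M2 := Mquantity n δ N (a - LL n Q * N) with hM2
  have hep : 0 < epn n := by unfold epn; positivity
  have hM12 : M1 ≤ M2 := M_mono (div_le_self hN.N0 (by linarith)) le_rfl
  set G : Finset (Fin n → ℕ) := Fintype.piFinset (fun _ => Finset.range Q) with hG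
  have hGm : ∀ κ ∈ G, ∀ i, κ i < Q := fun κ hκ i => Finset.mem_range.1 (Fintype.mem_piFinset.1 hκ i)
  have hGc : G.card = Q ^ n := by rw [hG, Fintype.card_piFinset]; simp
  have hcc : ∀ κ ∈ G, ∀ x ∈ cube (0 : EE n) 1, ctr l κ + l • x ∈ cube (0 : EE n) 1 := by
    intro κ hκ x hx
    apply cell_cube (q := q) (J := J) (by omega) (κ := κ) (by rw [← hQ]; exact hGm κ hκ)
    rw [← hlJ]
    exact (ctr_mem hl0).2 hx
  let v : (Fin n → ℕ) → EE n → ℝ := fun κ x => u (ctr l κ + l • x)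
  have hvh : ∀ κ ∈ G, IsHarmonicOn (v κ) (ball 0 (100 * n)) := by
    intro κ hκ
    apply harm_resc hu
    intro x hx
    have h0 : (0 : EE n) ∈ cube (0 : EE n) 1 := by intro i; simp
    have h1 : ctr l κ ∈ cube (0 : EE n) 1 := by simpa using hcc κ hκ 0 h0
    have h2 := cube_norm h1
    rw [mem_ball, dist_zero_right] at hx ⊢
    calc ‖ctr l κ + l • x‖ ≤ ‖ctr l κ‖ + l * ‖x‖ := by
          refine (norm_add_le _ _).trans ?_
          rw [norm_smul, Real.norm_of_nonneg hl0.le]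
      _ ≤ n + 1 / 2 * (100 * n) := by gcongr
      _ < _ := by linarith
  have hsub : {x ∈ cube (0 : EE n) 1 | ‖fderiv ℝ u x‖ < Real.exp (-a) * supGrad u (cube 0 1)} ⊆
      ⋃ κ ∈ G, (fun x => ctr l κ + l • x) '' {x ∈ cube (0 : EE n) 1 |
        ‖fderiv ℝ (v κ) x‖ < Real.exp (-(a - LL n Q * N)) * supGrad (v κ) (cube 0 1)} := by
    rintro x ⟨hx, hxa⟩
    obtain ⟨κ, hκ, hxκ⟩ := grid_cover (Q := Q) (by omega) hx
    rw [← hl] at hxκ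
    have hκG : κ ∈ G := Fintype.mem_piFinset.2 fun i => Finset.mem_range.2 (hκ i)
    have e : ctr l κ + l • (l⁻¹ • (x - ctr l κ)) = x := by
      rw [smul_smul, mul_inv_cancel₀ hl0.ne', one_smul]; abel
    rw [mem_iUnion₂]
    refine ⟨κ, hκG, l⁻¹ • (x - ctr l κ), ⟨?_, ?_⟩, e⟩
    · rw [← ctr_mem hl0 (κ := κ), e]; exact hxκ
    · have h1 := sup_lower hrep hst hN.N0 hdb hl0 (by linarith) (hcc κ hκG)
      have h2 : ‖fderiv ℝ (v κ) (l⁻¹ • (x - ctr l κ))‖ = l * ‖fderiv ℝ u x‖ := by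
        rw [norm_resc u (ctr l κ) hl0, e]
      rw [h2]
      have h3 : LL n Q = 1 + Real.log (4 * n / l) := by rw [LL, hl]
      rw [← h3] at h1
      calc l * ‖fderiv ℝ u x‖ < l * (Real.exp (-a) * supGrad u (cube 0 1)) := by gcongr
        _ ≤ l * (Real.exp (-a) * (Real.exp (LL n Q * N) * (l⁻¹ * supGrad (v κ) (cube 0 1)))) := by gcongr
        _ = (l * l⁻¹) * (Real.exp (-a) * Real.exp (LL n Q * N)) * supGrad (v κ) (cube 0 1) := by ring
        _ = _ := by
          rw [mul_inv_cancel₀ hl0.ne', one_mul, ← Real.exp_add]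
          congr 2
          ring
  set B := badI q J F N with hB
  have hBG : B ⊆ G := by
    intro κ hκ
    have := (Finset.mem_filter.1 hκ).1
    rw [← hQ] at this
    exact this
  have hvM2 : ∀ κ ∈ G, sublevelContent n δ (v κ) (a - LL n Q * N) ≤ M2 := by
    intro κ hκ
    apply le_M (hvh κ hκ)
    apply index_resc hrep hst hl0 (by linarith) hN.N0 (hcc κ hκ)
    intro x hx r hr hrl
    exact hdb _ (hcc κ hκ x hx) r hr (by linarith)
  have hvM1 : ∀ κ ∈ G \ B, sublevelContent n δ (v κ) (a - LL n Q * N) ≤ M1 := by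
    intro κ hκ
    obtain ⟨hκ, hκB⟩ := Finset.mem_sdiff.1 hκ
    apply le_M (hvh κ hκ)
    apply index_resc hrep hst hl0 (by linarith) (div_nonneg hN.N0 (by linarith)) (hcc κ hκ)
    intro x hx r hr hrl
    by_contra hc
    push Not at hc
    apply hκB
    refine Finset.mem_filter.2 ⟨by rw [← hQ]; exact hκ, ctr l κ + l • x, ?_, r, hr, ?_, hc⟩
    · rw [← hlJ]; exact (ctr_mem hl0).2 hx
    · rw [← hlJ]; exact hrl
  have hBc : B.card ≤ Q ^ n := hbw.trans hwA
  calc sublevelContent n δ u a ≤ _ := hc_mono hsub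
    _ ≤ _ := hc_finset hs _ _
    _ ≤ ∑ κ ∈ G, ENNReal.ofReal (l ^ ((n:ℝ) - 2 + δ)) * sublevelContent n δ (v κ) (a - LL n Q * N) :=
        Finset.sum_le_sum fun κ _ => hc_scale hs hl0 _ _
    _ = ENNReal.ofReal (l ^ ((n:ℝ) - 2 + δ)) * ∑ κ ∈ G, sublevelContent n δ (v κ) (a - LL n Q * N) := by
        rw [Finset.mul_sum]
    _ ≤ _ := by
        gcongr
        rw [← Finset.sum_sdiff hBG]
        calc _ ≤ ∑ _κ ∈ G \ B, M1 + ∑ _κ ∈ B, M2 := by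
              gcongr with κ hκ κ hκ
              · exact hvM1 κ hκ
              · exact hvM2 κ (hBG hκ)
          _ = ((Q ^ n - B.card : ℕ) : ℝ≥0∞) * M1 + (B.card : ℝ≥0∞) * M2 := by
              rw [Finset.sum_const, Finset.sum_const, Finset.card_sdiff_of_subset hBG, hGc, nsmul_eq_mul, nsmul_eq_mul]
          _ = ((Q ^ n - w : ℕ) : ℝ≥0∞) * M1 + ((w - B.card : ℕ) : ℝ≥0∞) * M1 + (B.card : ℝ≥0∞) * M2 := by
              rw [← add_mul, ← Nat.cast_add]
              congr 3
              omega
          _ ≤ ((Q ^ n - w : ℕ) : ℝ≥0∞) * M1 + ((w - B.card : ℕ) : ℝ≥0∞) * M2 + (B.card : ℝ≥0∞) * M2 := by gcongr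
          _ = _ := by
              rw [add_assoc, ← add_mul, ← Nat.cast_add]
              congr 3
              omega
end


section
variable {n : ℕ}

theorem one_step_M (hn : 2 ≤ n) {δ : ℝ} (hδ : 0 < δ) (hδ2 : δ ≤ 2) : ∃ X Y L : ℝ, 0 ≤ X ∧ 0 ≤ Y ∧ Y ≤ 1 / 2 ∧ 0 < L ∧
    (δ = 2 → X + Y = 1) ∧ ∀ N a : ℝ, Nok n N → Mquantity n δ N a ≤
      ENNReal.ofReal X * Mquantity n δ (N / (1 + epn n / 4)) (a - L * N) + ENNReal.ofReal Y * Mquantity n δ N (a - L * N) := by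
  have hn2 : (2:ℝ) ≤ n := by exact_mod_cast hn
  obtain ⟨s, hs⟩ : ∃ s : ℝ, s = (n:ℝ) - 2 + δ := ⟨_, rfl⟩
  have hs0 : 0 < s := by linarith
  obtain ⟨q, hq2, hqC⟩ : ∃ q : ℕ, 2 ≤ q ∧ (Cf n : ℝ) ≤ (q:ℝ) ^ (δ / 2) := by
    have h1 := ((tendsto_rpow_atTop (show 0 < δ / 2 by linarith)).comp (tendsto_natCast_atTop_atTop (R := ℝ))).eventually_ge_atTop (Cf n : ℝ)
    obtain ⟨q, h2, h3⟩ := (h1.and (Filter.eventually_ge_atTop 2)).exists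
    exact ⟨q, h3, h2⟩
  obtain ⟨j0, hj⟩ := bad_count hn hq2
  have hq1 : (1:ℝ) < q := by exact_mod_cast (by omega : 1 < q)
  have hq0 : (0:ℝ) < q := by linarith
  have hr1 : (q:ℝ) ^ (-(δ / 2)) < 1 := Real.rpow_lt_one_of_one_lt_of_neg hq1 (by linarith)
  have hr0 : 0 < (q:ℝ) ^ (-(δ / 2)) := by positivity
  obtain ⟨m, hm⟩ := exists_pow_lt_of_lt_one (show (0:ℝ) < 1 / (2 * (q:ℝ) ^ (2 * n * j0)) by positivity) hr1
  have hm' : ((q:ℝ) ^ (-(δ / 2))) ^ (m + 1) ≤ 1 / (2 * (q:ℝ) ^ (2 * n * j0)) := by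
    refine le_trans ?_ hm.le
    exact pow_le_pow_of_le_one hr0.le hr1.le (by omega)
  obtain ⟨w, hw⟩ : ∃ w : ℕ, w = q ^ (2 * n * j0) * (Cf n * q ^ (n - 2)) ^ (m + 1) := ⟨_, rfl⟩
  obtain ⟨J, hJ⟩ : ∃ J : ℕ, J = 2 * j0 + (m + 1) := ⟨_, rfl⟩
  obtain ⟨A, hA⟩ : ∃ A : ℕ, A = q ^ J := ⟨_, rfl⟩
  have hA1 : 1 ≤ A := by rw [hA]; exact Nat.one_le_pow _ _ (by omega)
  have hA1' : (1:ℝ) ≤ A := by exact_mod_cast hA1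
  have hA0 : (0:ℝ) < A := by linarith
  have hAs : (1 / (A:ℝ)) ^ s ≤ ((q:ℝ) ^ (-s)) ^ (m + 1) := by
    rw [one_div, ← Real.rpow_neg_one, ← Real.rpow_mul hA0.le, hA]
    push_cast
    rw [← Real.rpow_natCast, ← Real.rpow_natCast, ← Real.rpow_mul hq0.le, ← Real.rpow_mul hq0.le]
    apply Real.rpow_le_rpow_of_exponent_le hq1.le
    have : ((m + 1 : ℕ) : ℝ) ≤ J := by exact_mod_cast (by omega : m + 1 ≤ J)
    nlinarith
  have hY : (1 / (A:ℝ)) ^ s * w ≤ 1 / 2 := by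
    have hwr : (w:ℝ) ≤ (q:ℝ) ^ (2 * n * j0) * ((q:ℝ) ^ (δ / 2) * (q:ℝ) ^ ((n:ℝ) - 2)) ^ (m + 1) := by
      rw [hw]; push_cast
      have : (q:ℝ) ^ ((n:ℝ) - 2) = (q:ℝ) ^ (n - 2) := by
        rw [← Real.rpow_natCast, Nat.cast_sub hn]; norm_num
      rw [this]
      gcongr
    calc (1 / (A:ℝ)) ^ s * w ≤ ((q:ℝ) ^ (-s)) ^ (m + 1) * ((q:ℝ) ^ (2 * n * j0) * ((q:ℝ) ^ (δ / 2) * (q:ℝ) ^ ((n:ℝ) - 2)) ^ (m + 1)) := by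
          gcongr
      _ = (q:ℝ) ^ (2 * n * j0) * ((q:ℝ) ^ (-s) * ((q:ℝ) ^ (δ / 2) * (q:ℝ) ^ ((n:ℝ) - 2))) ^ (m + 1) := by
          rw [mul_pow ((q:ℝ) ^ (-s))]; ring
      _ = (q:ℝ) ^ (2 * n * j0) * ((q:ℝ) ^ (-(δ / 2))) ^ (m + 1) := by
          rw [← Real.rpow_add hq0, ← Real.rpow_add hq0]
          congr 3; rw [hs]; ring
      _ ≤ (q:ℝ) ^ (2 * n * j0) * (1 / (2 * (q:ℝ) ^ (2 * n * j0))) := by gcongr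
      _ = 1 / 2 := by field_simp
  have hAs0 : 0 < (1 / (A:ℝ)) ^ s := by positivity
  have hAinv : (1 / (A:ℝ)) ^ s * (A:ℝ) ^ s = 1 := by
    rw [← Real.mul_rpow (by positivity) hA0.le, one_div, inv_mul_cancel₀ hA0.ne', Real.one_rpow]
  have hAsn : (A:ℝ) ^ s ≤ (A:ℝ) ^ n := by
    rw [← Real.rpow_natCast]
    exact Real.rpow_le_rpow_of_exponent_le hA1' (by linarith)
  have hwA : w ≤ A ^ n := by
    have : (w:ℝ) ≤ (A:ℝ) ^ n := by
      have h1 : (w:ℝ) = (1 / (A:ℝ)) ^ s * w * (A:ℝ) ^ s := by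
        rw [mul_right_comm, hAinv, one_mul]
      have h2 : (0:ℝ) < (A:ℝ) ^ s := by positivity
      nlinarith
    exact_mod_cast this
  have hwA' : (w:ℝ) ≤ (A:ℝ) ^ n := by exact_mod_cast hwA
  refine ⟨(1 / (A:ℝ)) ^ s * ((A:ℝ) ^ n - w), (1 / (A:ℝ)) ^ s * w, LL n A, ?_, by positivity, hY, ?_, ?_, ?_⟩
  · exact mul_nonneg hAs0.le (by linarith)
  · unfold LL
    have : 0 ≤ Real.log (4 * n / (1 / (A:ℝ))) := by
      apply Real.log_nonneg
      rw [div_div_eq_mul_div, div_one]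
      nlinarith
    linarith
  · intro h2
    have : s = (n:ℝ) := by rw [hs, h2]; ring
    rw [← mul_add, sub_add_cancel, ← Real.rpow_natCast, ← this, hAinv]
  · intro N a hN
    have key := fun (u : EE n → ℝ) hu hui => one_step_u hn hδ hq2 (by omega : 1 ≤ J) hN (w := w) (by
      intro F hF; rw [hJ, hw]; exact hj hF _) (by rw [← hA]; exact hwA) a (u := u) hu hui
    rw [← hA, ← hs] at key
    have hfin : Mquantity n δ N a ≤ ENNReal.ofReal ((1 / (A : ℝ)) ^ s) *
      (((A ^ n - w : ℕ) : ℝ≥0∞) * Mquantity n δ (N / (1 + epn n / 4)) (a - LL n A * N)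
        + (w : ℝ≥0∞) * Mquantity n δ N (a - LL n A * N)) := by
      conv_lhs => unfold Mquantity
      exact iSup₂_le fun u h => key u h.1 h.2
    refine hfin.trans (le_of_eq ?_)
    rw [mul_add, ← mul_assoc, ← mul_assoc, ENNReal.ofReal_mul hAs0.le, ENNReal.ofReal_mul hAs0.le, ENNReal.ofReal_natCast]
    congr 4
    rw [← ENNReal.ofReal_natCast, Nat.cast_sub hwA]; push_cast; rfl

theorem iterM {δ X Y L c : ℝ} (hX : 0 ≤ X) (hY : 0 ≤ Y) (hL : 0 < L) {N : ℝ} (hN : 0 ≤ N)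
    (h : ∀ a : ℝ, Mquantity n δ N a ≤
      ENNReal.ofReal X * Mquantity n δ (N / (1 + c)) (a - L * N) + ENNReal.ofReal Y * Mquantity n δ N (a - L * N))
    (p : ℕ) (a : ℝ) : Mquantity n δ N a ≤
      ENNReal.ofReal (X * ∑ i ∈ Finset.range p, Y ^ i) * Mquantity n δ (N / (1 + c)) (a - p * L * N)
        + ENNReal.ofReal (Y ^ p) * Mquantity n δ N (a - p * L * N) := by
  induction p with
  | zero => simp
  | succ p ih =>
    have hS : 0 ≤ ∑ i ∈ Finset.range p, Y ^ i := Finset.sum_nonneg fun i _ => by positivity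
    have hLN : 0 ≤ L * N := by positivity
    have e : a - p * L * N - L * N = a - ((p + 1 : ℕ):ℝ) * L * N := by push_cast; ring
    have h1 := h (a - p * L * N)
    rw [e] at h1
    have h2 : Mquantity n δ (N / (1 + c)) (a - p * L * N) ≤ Mquantity n δ (N / (1 + c)) (a - ((p + 1 : ℕ):ℝ) * L * N) :=
      M_mono le_rfl (by rw [← e]; linarith)
    set M1 := Mquantity n δ (N / (1 + c)) (a - ((p + 1 : ℕ):ℝ) * L * N)
    set M2 := Mquantity n δ N (a - ((p + 1 : ℕ):ℝ) * L * N)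
    calc _ ≤ _ := ih
      _ ≤ ENNReal.ofReal (X * ∑ i ∈ Finset.range p, Y ^ i) * M1 + ENNReal.ofReal (Y ^ p) * (ENNReal.ofReal X * M1 + ENNReal.ofReal Y * M2) := by
          gcongr
      _ = _ := by
          rw [Finset.sum_range_succ, mul_add X, ENNReal.ofReal_add (by positivity) (by positivity), mul_add, ← mul_assoc, ← mul_assoc,
            ← ENNReal.ofReal_mul (by positivity), ← ENNReal.ofReal_mul (by positivity), pow_succ, mul_comm X (Y ^ p)]
          ring

theorem nok_ev (hn : 2 ≤ n) : ∃ N₀ : ℝ, ∀ N, N₀ < N → Nok n N := by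
  have hl := log10n hn
  have hal := aln_pos n
  have hep : 0 < epn n := by unfold epn; positivity
  refine ⟨max 0 (max (Real.log (K1 n (epn n)) / epn n) ((16 + 2 * (n + 4)) * Real.log (10 * n) / aln n)), fun N hN => ?_⟩
  simp only [max_lt_iff] at hN
  obtain ⟨h0, h1, h2⟩ := hN
  rw [div_lt_iff₀ hep] at h1
  rw [div_lt_iff₀ hal] at h2
  have h3 : 16 + 2 * ((n:ℝ) + 4) ≤ aln n * dd n N := by
    unfold dd
    rw [mul_div_assoc', le_div_iff₀ (by linarith)]; linarith
  have hn0 : (0:ℝ) ≤ n := by positivity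
  exact ⟨h0.le, by linarith, by linarith, by linarith⟩

theorem main_small (hn : 2 ≤ n) {δ : ℝ} (hδ : 0 < δ) (hδ2 : δ ≤ 2) :
    ∃ (c C₁ : ℝ) (A : ℕ), 0 < c ∧ 0 < C₁ ∧ 3 ≤ A ∧ (∃ j : ℕ, 2 * A + 1 = 3 ^ j) ∧
      ∀ N a : ℝ, Nok n N →
        Mquantity n δ N a ≤
          ENNReal.ofReal ((A : ℝ) ^ ((2 : ℝ) - δ)) *
              Mquantity n δ (N / (1 + c)) (a - C₁ * N * Real.log A) +
            ENNReal.ofReal ((A : ℝ) ^ (-δ)) *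
              Mquantity n δ N (a - C₁ * N * Real.log A) := by
  obtain ⟨X, Y, L, hX, hY0, hY, hL, hXY, hM⟩ := one_step_M hn hδ hδ2
  have hsum : ∀ p : ℕ, (1 - Y) * ∑ i ∈ Finset.range p, Y ^ i ≤ 1 := by
    intro p
    have := mul_neg_geom_sum Y p
    rw [this]
    have : 0 ≤ Y ^ p := by positivity
    linarith
  have hsum0 : ∀ p : ℕ, 0 ≤ ∑ i ∈ Finset.range p, Y ^ i := fun p => Finset.sum_nonneg fun i _ => by positivity
  obtain ⟨A, j, hA3, hAj, hAX⟩ : ∃ A j : ℕ, 3 ≤ A ∧ 2 * A + 1 = 3 ^ j ∧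
      ∀ p : ℕ, X * ∑ i ∈ Finset.range p, Y ^ i ≤ (A:ℝ) ^ ((2:ℝ) - δ) := by
    rcases hδ2.lt_or_eq with h | h
    · have h1 := ((tendsto_rpow_atTop (show 0 < 2 - δ by linarith)).comp (tendsto_natCast_atTop_atTop (R := ℝ))).eventually_ge_atTop (2 * X)
      obtain ⟨B, hB⟩ := Filter.eventually_atTop.1 h1
      have hodd : ∀ k : ℕ, ∃ A : ℕ, 2 * A + 1 = 3 ^ k ∧ k ≤ A + 1 := by
        intro k
        induction k with
        | zero => exact ⟨0, by norm_num, by norm_num⟩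
        | succ k ih =>
          obtain ⟨A, h1, h2⟩ := ih
          exact ⟨3 * A + 1, by rw [pow_succ, ← h1]; ring, by omega⟩
      obtain ⟨A, h2, h3⟩ := hodd (B + 4)
      refine ⟨A, B + 4, by omega, h2, fun p => ?_⟩
      refine le_trans ?_ (hB A (by omega))
      have := hsum p
      have := hsum0 p
      have : ∑ i ∈ Finset.range p, Y ^ i ≤ 2 := by nlinarith
      nlinarith
    · refine ⟨4, 2, by norm_num, by norm_num, fun p => ?_⟩
      have : X = 1 - Y := by linarith [hXY h]
      rw [this, h]
      simpa using hsum p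
  have hA0 : (3:ℝ) ≤ A := by exact_mod_cast hA3
  have hlog : 0 < Real.log A := Real.log_pos (by linarith)
  obtain ⟨p, hp⟩ := exists_pow_lt_of_lt_one (show (0:ℝ) < (A:ℝ) ^ (-δ) by positivity) (show Y < 1 by linarith)
  have hp' : Y ^ (p + 1) ≤ (A:ℝ) ^ (-δ) := (pow_le_pow_of_le_one hY0 (by linarith) (by omega)).trans hp.le
  have hep : 0 < epn n := by unfold epn; positivity
  refine ⟨epn n / 4, ((p + 1 : ℕ):ℝ) * L / Real.log A, A, by positivity, by positivity, hA3, ⟨j, hAj⟩, fun N a hN => ?_⟩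
  have e : ((p + 1 : ℕ):ℝ) * L / Real.log A * N * Real.log A = ((p + 1 : ℕ):ℝ) * L * N := by field_simp
  rw [e]
  refine (iterM hX hY0 hL hN.N0 (fun a => hM N a hN) (p + 1) a).trans ?_
  gcongr
  exact hAX _

theorem cube_zero (hn : 2 ≤ n) {s : ℝ} (hs : (n:ℝ) < s) : hausdorffContent s (cube (0 : EE n) 1) = 0 := by
  classical
  have hs0 : 0 < s := lt_of_le_of_lt (by positivity) hs
  have hfin : hausdorffContent s (cube (0 : EE n) 1) < ⊤ :=
    hc_lt_top hs0 ((isBounded_closedBall (x := (0 : EE n))).subset fun x hx => cube_bdd hx)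
  obtain ⟨v, hv⟩ : ∃ v, v = hausdorffContent s (cube (0 : EE n) 1) := ⟨_, rfl⟩
  have h1 : v ≤ ENNReal.ofReal ((2:ℝ) ^ n * (1 / 2 : ℝ) ^ s) * v := by
    have hcov : cube (0 : EE n) 1 ⊆ ⋃ κ ∈ Fintype.piFinset (fun _ : Fin n => Finset.range 2),
        (fun x => ctr (1 / 2 : ℝ) κ + (1 / 2 : ℝ) • x) '' cube (0 : EE n) 1 := by
      intro x hx
      obtain ⟨κ, h1, h2⟩ := grid_cover (Q := 2) (by norm_num) hx
      refine mem_iUnion₂.2 ⟨κ, by simpa using h1, (2:ℝ) • (x - ctr (1 / 2 : ℝ) κ), ?_, ?_⟩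
      · rw [← ctr_mem (l := 1 / 2) (κ := κ) (by norm_num)]
        rw [smul_smul]; norm_num
        norm_num at h2
        exact h2
      · simp only [smul_smul]; norm_num
    rw [hv]
    refine (hc_mono hcov).trans ((hc_finset hs0 _ _).trans ?_)
    refine (Finset.sum_le_sum fun κ _ => hc_scale hs0 (by norm_num : (0:ℝ) < 1 / 2) _ _).trans (le_of_eq ?_)
    rw [Finset.sum_const, Fintype.card_piFinset, nsmul_eq_mul, ← mul_assoc, ENNReal.ofReal_mul (by positivity)]
    congr 2
    simp
  have h2 : (2:ℝ) ^ n * (1 / 2 : ℝ) ^ s < 1 := by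
    rw [one_div, ← Real.rpow_neg_one, ← Real.rpow_mul (by norm_num), ← Real.rpow_natCast, ← Real.rpow_add (by norm_num)]
    exact Real.rpow_lt_one_of_one_lt_of_neg (by norm_num) (by linarith)
  rw [← hv] at hfin ⊢
  by_contra h0
  have h3 : ENNReal.ofReal ((2:ℝ) ^ n * (1 / 2 : ℝ) ^ s) * v < 1 * v := by
    rw [ENNReal.mul_lt_mul_iff_left h0 hfin.ne]
    rwa [ENNReal.ofReal_lt_one]
  rw [one_mul] at h3
  exact absurd h1 (not_le.2 h3)

theorem hc_empty_cases (s : ℝ) : hausdorffContent s (∅ : Set (EE n)) = 0 ∨ hausdorffContent s (∅ : Set (EE n)) = ⊤ := by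
  rcases lt_trichotomy s 0 with h | h | h
  · by_cases hd : EMetric.diam (univ : Set (EE n)) = ⊤
    · left
      refine le_antisymm ?_ zero_le
      unfold hausdorffContent
      refine iInf₂_le_of_le (fun _ => univ) (empty_subset _) ?_
      simp only [hd, ENNReal.top_rpow_of_neg h, tsum_zero, le_refl]
    · right
      have hz : n = 0 := by
        by_contra hn
        haveI : Nonempty (Fin n) := ⟨⟨0, by omega⟩⟩
        apply hd
        by_contra hd'
        exact NormedSpace.unbounded_univ ℝ (EE n) (Metric.isBounded_iff_ediam_ne_top.2 hd')
      subst hz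
      unfold hausdorffContent
      refine top_unique (le_iInf₂ fun U _ => ?_)
      have : ∀ i, EMetric.diam (U i) = 0 := fun i => Metric.ediam_subsingleton (Set.subsingleton_of_subsingleton)
      simp only [this, ENNReal.zero_rpow_of_neg h]
      rw [ENNReal.tsum_const_eq_top_of_ne_zero ENNReal.top_ne_zero]
  · right
    unfold hausdorffContent
    refine top_unique (le_iInf₂ fun U _ => ?_)
    simp only [h, ENNReal.rpow_zero]
    rw [ENNReal.tsum_const_eq_top_of_ne_zero one_ne_zero]
  · left; exact hc_empty h

theorem grad_const_one {u : EE 1 → ℝ} (hu : IsHarmonicOn u (ball 0 (100 * ((1:ℕ):ℝ)))) :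
    ∀ x ∈ cube (0 : EE 1) 1, fderiv ℝ u x = fderiv ℝ u 0 := by
  obtain ⟨h1, h2⟩ := hu
  have hsub : ∀ x ∈ cube (0 : EE 1) 1, x ∈ ball (0 : EE 1) (100 * ((1:ℕ):ℝ)) := by
    intro x hx
    have := hx 0
    simp only [PiLp.zero_apply, sub_zero] at this
    rw [mem_ball_zero_iff, EuclideanSpace.norm_eq]
    have e : ∑ i : Fin 1, ‖x i‖ ^ 2 = |x 0| ^ 2 := by simp
    rw [e, Real.sqrt_sq (abs_nonneg _)]; push_cast; linarith
  have hsm : ContDiffOn ℝ (⊤ : ℕ∞) (fun y => fderiv ℝ u y (EuclideanSpace.single (0 : Fin 1) 1)) (ball 0 (100 * ((1:ℕ):ℝ))) := by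
    exact (h1.fderiv_of_isOpen isOpen_ball (by norm_num)).clm_apply contDiffOn_const
  have hext : ∀ L : EE 1 →L[ℝ] ℝ, ∀ v, L v = v 0 * L (EuclideanSpace.single (0 : Fin 1) 1) := by
    intro L v
    have : v = v 0 • EuclideanSpace.single (0 : Fin 1) (1:ℝ) := by
      ext i; fin_cases i; simp
    conv_lhs => rw [this]
    simp
  have hc : ∀ x ∈ ball (0 : EE 1) (100 * ((1:ℕ):ℝ)), (fun y => fderiv ℝ u y (EuclideanSpace.single (0 : Fin 1) 1)) x =
      (fun y => fderiv ℝ u y (EuclideanSpace.single (0 : Fin 1) 1)) 0 := by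
    intro x hx
    refine (isOpen_ball.is_const_of_fderiv_eq_zero (𝕜 := ℝ) (convex_ball (0 : EE 1) _).isPreconnected (hsm.differentiableOn (by norm_num)) ?_ hx (mem_ball_self (by norm_num)))
    intro y hy
    ext v
    rw [hext]
    have := h2 y hy
    simp only [Finset.univ_unique, Fin.default_eq_zero, Finset.sum_singleton] at this
    rw [this]; simp
  intro x hx
  ext v
  rw [hext, hext (fderiv ℝ u 0)]
  congr 1
  exact hc x (hsub x hx)

theorem sub_empty (hn : n ≤ 1) {u : EE n → ℝ} (hu : IsHarmonicOn u (ball 0 (100 * n))) {a : ℝ} (ha : 0 < a) :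
    {x ∈ cube (0 : EE n) 1 | ‖fderiv ℝ u x‖ < Real.exp (-a) * supGrad u (cube 0 1)} = ∅ := by
  have hc : ∀ x ∈ cube (0 : EE n) 1, fderiv ℝ u x = fderiv ℝ u 0 := by
    interval_cases n
    · intro x _
      rw [Subsingleton.elim x 0]
    · exact grad_const_one hu
  rw [eq_empty_iff_forall_notMem]
  rintro x ⟨hx, h⟩
  rw [hc x hx] at h
  have h1 : supGrad u (cube 0 1) ≤ ‖fderiv ℝ u 0‖ := by
    apply Real.sSup_le _ (norm_nonneg _)
    rintro _ ⟨z, hz, rfl⟩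
    simp only [hc z hz, le_refl]
  have h2 : Real.exp (-a) ≤ 1 := Real.exp_le_one_iff.2 (by linarith)
  have h3 := Real.exp_pos (-a)
  have h4 := norm_nonneg (fderiv ℝ u 0)
  nlinarith

theorem M_ge_empty {δ N a : ℝ} (hN : 0 ≤ N) : hausdorffContent ((n:ℝ) - 2 + δ) (∅ : Set (EE n)) ≤ Mquantity n δ N a := by
  have h0 : IsHarmonicOn (fun _ : EE n => (0:ℝ)) (ball 0 (100 * n)) := by
    refine ⟨contDiffOn_const, fun x _ => ?_⟩
    simp
  refine le_trans ?_ (le_M (u := fun _ => 0) h0 (le_trans ?_ hN))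
  · exact hc_mono (empty_subset _)
  · unfold cubeDoublingIndex
    apply Real.sSup_le _ le_rfl
    rintro _ ⟨x, _, r, hr, _, rfl⟩
    have : ∀ s : Set (EE n), supGrad (fun _ : EE n => (0:ℝ)) s ≤ 0 := by
      intro s
      apply Real.sSup_le _ le_rfl
      rintro _ ⟨z, _, rfl⟩
      simp
    have h2 : ∀ s : Set (EE n), supGrad (fun _ : EE n => (0:ℝ)) s = 0 := fun s =>
      le_antisymm (this s) (Real.sSup_nonneg (by rintro _ ⟨z, _, rfl⟩; exact norm_nonneg _))
    simp [h2]

theorem main_low (hn : n ≤ 1) {δ : ℝ} :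
    ∃ (c C₁ : ℝ) (A : ℕ), 0 < c ∧ 0 < C₁ ∧ 3 ≤ A ∧ (∃ j : ℕ, 2 * A + 1 = 3 ^ j) ∧
      ∀ N a : ℝ, 0 < N → C₁ * N * Real.log A < a →
        Mquantity n δ N a ≤
          ENNReal.ofReal ((A : ℝ) ^ ((2 : ℝ) - δ)) *
              Mquantity n δ (N / (1 + c)) (a - C₁ * N * Real.log A) +
            ENNReal.ofReal ((A : ℝ) ^ (-δ)) *
              Mquantity n δ N (a - C₁ * N * Real.log A) := by
  refine ⟨1, 1, 4, one_pos, one_pos, by norm_num, ⟨2, by norm_num⟩, fun N a hN ha => ?_⟩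
  have hlog : 0 < Real.log (4:ℕ) := Real.log_pos (by norm_num)
  have ha0 : 0 < a := lt_trans (by positivity) ha
  have h1 : Mquantity n δ N a ≤ hausdorffContent ((n:ℝ) - 2 + δ) (∅ : Set (EE n)) := by
    unfold Mquantity
    refine iSup₂_le fun u h => ?_
    unfold sublevelContent
    rw [sub_empty hn h.1 ha0]
  rcases hc_empty_cases (n := n) ((n:ℝ) - 2 + δ) with h | h
  · rw [h] at h1
    exact h1.trans zero_le
  · have h2 := M_ge_empty (n := n) (δ := δ) (N := N) (a := a - 1 * N * Real.log (4:ℕ)) hN.le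
    rw [h, top_le_iff] at h2
    rw [h2, ENNReal.mul_top (by
      rw [Ne, ENNReal.ofReal_eq_zero, not_le]; positivity)]
    simp

end

/-- **Recursive inequality.** There are `c, C₁ > 0` and an integer `A ≥ 3` with `2A+1` a
power of 3 (all depending only on `n, δ`) such that for all `N > N₀(n)` and
`a > C₁ N log A`:
`M(N,a) ≤ A^{2-δ} M(N/(1+c), a - C₁ N log A) + A^{-δ} M(N, a - C₁ N log A)`. -/
theorem recursive_inequality (n : ℕ) :
    ∃ N₀ : ℝ, ∀ δ : ℝ, 0 < δ →
    ∃ (c C₁ : ℝ) (A : ℕ), 0 < c ∧ 0 < C₁ ∧ 3 ≤ A ∧ (∃ j : ℕ, 2 * A + 1 = 3 ^ j) ∧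
      ∀ N a : ℝ, N₀ < N → C₁ * N * Real.log A < a →
        Mquantity n δ N a ≤
          ENNReal.ofReal ((A : ℝ) ^ ((2 : ℝ) - δ)) *
              Mquantity n δ (N / (1 + c)) (a - C₁ * N * Real.log A) +
            ENNReal.ofReal ((A : ℝ) ^ (-δ)) *
              Mquantity n δ N (a - C₁ * N * Real.log A) := by
  rcases le_or_gt n 1 with hn | hn
  · exact ⟨0, fun δ _ => main_low hn⟩
  · have hn2 : 2 ≤ n := hn
    obtain ⟨N₀, hN₀⟩ := nok_ev hn2
    refine ⟨N₀, fun δ hδ => ?_⟩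
    rcases le_or_gt δ 2 with h | h
    · obtain ⟨c, C₁, A, h1, h2, h3, h4, h5⟩ := main_small hn2 hδ h
      exact ⟨c, C₁, A, h1, h2, h3, h4, fun N a hN _ => h5 N a (hN₀ N hN)⟩
    · refine ⟨1, 1, 4, one_pos, one_pos, by norm_num, ⟨2, by norm_num⟩, fun N a _ _ => ?_⟩
      have h1 : Mquantity n δ N a ≤ 0 := by
        unfold Mquantity
        refine iSup₂_le fun u _ => ?_
        rw [← cube_zero hn2 (show (n:ℝ) < (n:ℝ) - 2 + δ by linarith)]
        exact hc_mono fun x hx => hx.1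
      exact h1.trans zero_le
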